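/- arXiv:1605.06701 — 5 statements merged into one kernel-verified Lean document; each statement's English description precedes it below -/
import Mathlib

section
/- (Z_p-Tucker–Ky Fan lemma, main conclusion) Let m, n, p, α be integers with m, n ≥ 1, m ≥ α ≥ 1, and p prime. Let λ : (Z_p ∪ {0})^n ∖ {0} → Z_p × [m], written λ(X) = (λ_1(X), λ_2(X)), be a Z_p-equivariant map satisfying: (1) for all X_1 ⊆ X_2 in (Z_p ∪ {0})^n ∖ {0}, if λ_2(X_1) = λ_2(X_2) ≤ α then λ_1(X_1) = λ_1(X_2); and (2) for every chain X_1 ⊆ X_2 ⊆ ⋯ ⊆ X_p in (Z_p ∪ {0})^n ∖ {0}, if λ_2(X_1) = λ_2(X_2) = ⋯ = λ_2(X_p) ≥ α + 1 then |{λ_1(X_1), …, λ_1(X_p)}| < p. Then there exists a chain Z_1 ⊊ Z_2 ⊊ ⋯ ⊊ Z_{n−α} in (Z_p ∪ {0})^n ∖ {0} such that: (a) λ_2(Z_i) ≥ α + 1 for every i ∈ [n−α]; (b) λ(Z_i) ≠ λ(Z_j) for all i ≠ j in [n−α]; and (c) for every ε ∈ Z_p, ⌊(n−α)/p⌋ ≤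 |{j ∈ [n−α] : λ_1(Z_j) = ε}| ≤ ⌈(n−α)/p⌉. -/
/-- `PSub X Y` : the subset relation `X ⊆ Y` on signed vectors in `(Z_p ∪ {0})^n`,
meaning `Y` agrees with `X` on every nonzero coordinate of `X`
(zero is modelled by `none`, the group element `ε ∈ Z_p` by `some ε`). -/
def PSub {n p : ℕ} (X Y : Fin n → Option (ZMod p)) : Prop :=
  ∀ i, X i ≠ none → Y i = X i

namespace ZpTKF

section chains
variable (K : Type) [CommRing K] {V W : Type}

noncomputable def consL (a : V) : (List V →₀ K) →ₗ[K] (List V →₀ K) :=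
  Finsupp.lmapDomain K K (List.cons a)

noncomputable def bdl : List V → (List V →₀ K)
  | [] => 0
  | a :: l => Finsupp.single l 1 - consL K a (bdl l)

noncomputable def bd : (List V →₀ K) →ₗ[K] (List V →₀ K) :=
  Finsupp.linearCombination K (bdl K)

noncomputable def mapL (f : V → W) : (List V →₀ K) →ₗ[K] (List W →₀ K) :=
  Finsupp.lmapDomain K K (List.map f)

noncomputable def sdN (Φ : List V → W) : ℕ → ((List V →₀ K) →ₗ[K] (List W →₀ K))
  | 0 => Finsupp.linearCombination K (fun _ => Finsupp.single [] 1)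
  | k + 1 => Finsupp.linearCombination K (fun σ => consL K (Φ σ) (sdN Φ k (bdl K σ)))

variable {K}

@[simp] lemma consL_single (a : V) (l : List V) (c : K) :
    consL K a (Finsupp.single l c) = Finsupp.single (a :: l) c := by
  simp [consL]

@[simp] lemma mapL_single (f : V → W) (l : List V) (c : K) :
    mapL K f (Finsupp.single l c) = Finsupp.single (l.map f) c := by
  simp [mapL]

@[simp] lemma bd_single (l : List V) (c : K) :
    bd K (Finsupp.single l c) = c • bdl K l := by
  simp [bd]

lemma bd_consL (a : V) (c : List V →₀ K) :
    bd K (consL K a c) = c - consL K a (bd K c) := by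
  induction c using Finsupp.induction_linear with
  | zero => simp
  | add f g hf hg => simp only [map_add, hf, hg]; abel
  | single l c => simp [bdl, smul_sub]

lemma bd_bdl (l : List V) : bd K (bdl K l) = 0 := by
  induction l with
  | nil => simp [bdl]
  | cons a l ih => simp [bdl, bd_consL, ih]

lemma bd_bd (c : List V →₀ K) : bd K (bd K c) = 0 := by
  induction c using Finsupp.induction_linear with
  | zero => simp
  | add f g hf hg => simp [hf, hg]
  | single l c => simp [bd_bdl]

lemma mapL_consL (f : V → W) (a : V) (c : List V →₀ K) :
    mapL K f (consL K a c) = consL K (f a) (mapL K f c) := by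
  induction c using Finsupp.induction_linear with
  | zero => simp
  | add f g hf hg => simp [hf, hg]
  | single l c => simp

lemma mapL_bdl (f : V → W) (l : List V) : mapL K f (bdl K l) = bdl K (l.map f) := by
  induction l with
  | nil => simp [bdl]
  | cons a l ih => simp [bdl, mapL_consL, ih]

lemma mapL_bd (f : V → W) (c : List V →₀ K) : mapL K f (bd K c) = bd K (mapL K f c) := by
  induction c using Finsupp.induction_linear with
  | zero => simp
  | add f g hf hg => simp [hf, hg]
  | single l c => simp [mapL_bdl]

lemma sdN_zero_single (Φ : List V → W) (l : List V) (c : K) :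
    sdN K Φ 0 (Finsupp.single l c) = Finsupp.single [] c := by
  simp [sdN]

lemma sdN_succ_single (Φ : List V → W) (k : ℕ) (l : List V) (c : K) :
    sdN K Φ (k+1) (Finsupp.single l c) = c • consL K (Φ l) (sdN K Φ k (bdl K l)) := by
  simp [sdN]

lemma bd_sdN_zero (Φ : List V → W) (c : List V →₀ K) : bd K (sdN K Φ 0 c) = 0 := by
  induction c using Finsupp.induction_linear with
  | zero => simp
  | add f g hf hg => simp [hf, hg]
  | single l c => simp [sdN_zero_single, bdl]

lemma bd_sdN (Φ : List V → W) (k : ℕ) (c : List V →₀ K) :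
    bd K (sdN K Φ (k+1) c) = sdN K Φ k (bd K c) := by
  induction k generalizing c with
  | zero =>
    induction c using Finsupp.induction_linear with
    | zero => simp
    | add f g hf hg => simp [hf, hg]
    | single l c => simp [sdN_succ_single, bd_consL, bd_sdN_zero]
  | succ k ih =>
    induction c using Finsupp.induction_linear with
    | zero => simp
    | add f g hf hg => simp [hf, hg]
    | single l c => 
      rw [sdN_succ_single, map_smul, bd_consL, ih, bd_bdl]; simp

lemma mapL_sdN (f : V → V) (g : W → W) (Φ : List V → W)
    (h : ∀ l, l ≠ [] → Φ (l.map f) = g (Φ l)) (k : ℕ) (c : List V →₀ K) :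
    mapL K g (sdN K Φ k c) = sdN K Φ k (mapL K f c) := by
  induction k generalizing c with
  | zero =>
    induction c using Finsupp.induction_linear with
    | zero => simp
    | add f g hf hg => simp [hf, hg]
    | single l c => simp [sdN_zero_single]
  | succ k ih =>
    induction c using Finsupp.induction_linear with
    | zero => simp
    | add f g hf hg => simp [hf, hg]
    | single l c =>
      rw [mapL_single, sdN_succ_single, sdN_succ_single, map_smul, mapL_consL, ih, mapL_bdl]
      by_cases hl : l = []
      · subst hl; simp [bdl]
      · rw [h l hl]

/-- support induction -/
lemma map_mem_supported {X Y : Type} (F : (X →₀ K) →ₗ[K] (Y →₀ K)) (s : Set X) (t : Set Y)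
    (h : ∀ x ∈ s, F (Finsupp.single x 1) ∈ Finsupp.supported K K t) (c : X →₀ K)
    (hc : c ∈ Finsupp.supported K K s) : F c ∈ Finsupp.supported K K t := by
  rw [Finsupp.supported_eq_span_single] at hc
  induction hc using Submodule.span_induction with
  | mem x hx => obtain ⟨y, hy, rfl⟩ := hx; exact h y hy
  | zero => simp
  | add x y _ _ hx hy => rw [map_add]; exact Submodule.add_mem _ hx hy
  | smul a x _ hx => rw [map_smul]; exact Submodule.smul_mem _ _ hx

lemma consL_mem {s : Set (List V)} {t : Set (List V)} (a : V) (h : ∀ l ∈ s, a :: l ∈ t)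
    (c : List V →₀ K) (hc : c ∈ Finsupp.supported K K s) :
    consL K a c ∈ Finsupp.supported K K t := by
  refine map_mem_supported _ s t (fun l hl => ?_) c hc
  rw [consL_single]
  exact Finsupp.single_mem_supported K 1 (h l hl)

lemma bdl_mem (l : List V) :
    bdl K l ∈ Finsupp.supported K K {τ | τ.Sublist l ∧ τ.length + 1 = l.length} := by
  induction l with
  | nil => simp [bdl]
  | cons a l ih =>
    rw [bdl]
    refine Submodule.sub_mem _ (Finsupp.single_mem_supported K 1 ?_) ?_
    · simp
    · refine consL_mem a ?_ _ ih
      rintro τ ⟨h1, h2⟩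
      exact ⟨h1.cons_cons a, by simp [h2]⟩

lemma sdN_mem (Φ : List V → W) (Good : List V → Prop)
    (hG : ∀ σ τ, Good σ → τ.Sublist σ → Good τ) (r : W → W → Prop)
    (hr : ∀ σ τ, Good σ → τ.Sublist σ → τ ≠ [] → r (Φ σ) (Φ τ)) (k : ℕ) (σ : List V)
    (hσ : Good σ) (hk : σ.length = k) :
    sdN K Φ k (Finsupp.single σ 1) ∈ Finsupp.supported K K
      {L | L.Pairwise r ∧ L.length = k ∧ ∀ w ∈ L, ∃ τ, τ.Sublist σ ∧ τ ≠ [] ∧ w = Φ τ} := by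
  induction k generalizing σ with
  | zero =>
    rw [sdN_zero_single]
    apply Finsupp.single_mem_supported
    simp
  | succ k ih =>
    rw [sdN_succ_single, one_smul]
    refine consL_mem (Φ σ) (s := {L | L.Pairwise r ∧ L.length = k ∧
      ∀ w ∈ L, ∃ τ, τ.Sublist σ ∧ τ ≠ [] ∧ w = Φ τ}) ?_ _ ?_
    · rintro L ⟨h1, h2, h3⟩
      refine ⟨?_, by simp [h2], ?_⟩
      · rw [List.pairwise_cons]
        refine ⟨fun w hw => ?_, h1⟩
        obtain ⟨τ, ht, hn, rfl⟩ := h3 w hw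
        exact hr σ τ hσ ht hn
      · intro w hw
        rcases List.mem_cons.1 hw with rfl | hw
        · refine ⟨σ, List.Sublist.refl _, ?_, rfl⟩
          rintro rfl; simp at hk
        · exact h3 w hw
    · refine map_mem_supported _ _ _ ?_ _ (bdl_mem σ)
      rintro τ ⟨h1, h2⟩
      refine Finsupp.supported_mono ?_ (ih τ (hG σ τ hσ h1) (by omega))
      rintro L ⟨a, b, c⟩
      refine ⟨a, b, fun w hw => ?_⟩
      obtain ⟨τ', x, y, z⟩ := c w hw
      exact ⟨τ', x.trans h1, y, z⟩

end chains
end ZpTKF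

namespace ZpTKF
set_option linter.unusedSectionVars false
set_option linter.unusedSimpArgs false
section cochains
variable {p : ℕ} [Fact p.Prime] {V W : Type}

noncomputable def del (act : ZMod p → V → V) :
    (List V →₀ ZMod p) →ₗ[ZMod p] (List V →₀ ZMod p) :=
  mapL (ZMod p) (act 1) - LinearMap.id

noncomputable def nu (act : ZMod p → V → V) :
    (List V →₀ ZMod p) →ₗ[ZMod p] (List V →₀ ZMod p) :=
  ∑ g : ZMod p, mapL (ZMod p) (act g)

noncomputable def TT (act : ZMod p → V → V) : ℕ →
    ((List V →₀ ZMod p) →ₗ[ZMod p] (List V →₀ ZMod p))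
  | 0 => LinearMap.id
  | k + 1 => if Even k then del act else nu act

lemma TT_comm (act : ZMod p → V → V) (act' : ZMod p → W → W)
    (F : (List V →₀ ZMod p) →ₗ[ZMod p] (List W →₀ ZMod p))
    (h : ∀ g c, mapL _ (act' g) (F c) = F (mapL _ (act g) c)) (k : ℕ) (c : List V →₀ ZMod p) :
    TT act' k (F c) = F (TT act k c) := by
  cases k with
  | zero => simp [TT]
  | succ k =>
    simp only [TT]
    split_ifs
    · simp [del, h]
    · simp [nu, h, LinearMap.sum_apply]

lemma mapL_mapL {U : Type} (f : V → W) (g : W → U) (c : List V →₀ ZMod p) :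
    mapL (ZMod p) g (mapL _ f c) = mapL _ (g ∘ f) c := by
  induction c using Finsupp.induction_linear with
  | zero => simp
  | add f g hf hg => simp [hf, hg]
  | single l c => simp

lemma del_nu (act : ZMod p → V → V) (h : ∀ g g' v, act g (act g' v) = act (g + g') v)
    (c : List V →₀ ZMod p) : del act (nu act c) = 0 := by
  have h' : ∀ g g', act g ∘ act g' = act (g + g') := fun g g' => funext (h g g')
  simp only [del, nu, LinearMap.sub_apply, LinearMap.sum_apply, map_sum, mapL_mapL, h',
    LinearMap.id_apply, Finset.sum_sub_distrib]
  rw [sub_eq_zero]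
  exact Fintype.sum_equiv (Equiv.addLeft (1 : ZMod p)) _ _ (fun x => rfl)

lemma nu_del (act : ZMod p → V → V) (h : ∀ g g' v, act g (act g' v) = act (g + g') v)
    (c : List V →₀ ZMod p) : nu act (del act c) = 0 := by
  have h' : ∀ g g', act g ∘ act g' = act (g + g') := fun g g' => funext (h g g')
  simp only [del, nu, LinearMap.sub_apply, LinearMap.sum_apply, map_sub, mapL_mapL, h',
    LinearMap.id_apply, sub_eq_zero]
  exact Fintype.sum_equiv (Equiv.addRight (1 : ZMod p)) _ _ (fun x => rfl)

noncomputable def YY (act : ZMod p → V → V) (vtx : ℕ → V) : ℕ → (List V →₀ ZMod p)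
  | 0 => Finsupp.single [] 1
  | k + 1 => consL _ (vtx k) (TT act k (YY act vtx k))

lemma bd_YY (act : ZMod p → V → V) (h : ∀ g g' v, act g (act g' v) = act (g + g') v)
    (vtx : ℕ → V) (k : ℕ) : bd _ (YY act vtx (k+1)) = TT act k (YY act vtx k) := by
  have hT : ∀ k (c : List V →₀ ZMod p), bd _ (TT act k c) = TT act k (bd _ c) :=
    fun k c => (TT_comm act act (bd _) (fun g c => mapL_bd _ _) k c).symm
  induction k with
  | zero => simp [YY, TT, bdl]
  | succ k ih =>
    rw [YY, bd_consL, hT, ih]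
    cases k with
    | zero => simp [YY, TT, del]
    | succ k =>
      simp only [TT, Nat.even_add_one]
      by_cases hk : Even k <;> simp [hk, del_nu act h, nu_del act h]

lemma YY_mem (act : ZMod p → V → V) {U : Type} (q : V → U) (hq : ∀ g v, q (act g v) = q v)
    (vtx : ℕ → V) (k : ℕ) : YY act vtx k ∈ Finsupp.supported (ZMod p) (ZMod p)
      {l | l.map q = ((List.range k).map (q ∘ vtx)).reverse} := by
  have hmap : ∀ (s : List U) (g : ZMod p) (c : List V →₀ ZMod p),
      c ∈ Finsupp.supported (ZMod p) (ZMod p) {l : List V | l.map q = s} →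
      mapL _ (act g) c ∈ Finsupp.supported (ZMod p) (ZMod p) {l : List V | l.map q = s} := by
    intro s g c hc
    refine map_mem_supported _ _ _ ?_ c hc
    intro l hl
    rw [mapL_single]
    apply Finsupp.single_mem_supported
    simp only [Set.mem_ofPred_eq, List.map_map] at hl ⊢
    rw [← hl]
    apply List.map_congr_left
    intro a _; exact hq g a
  induction k with
  | zero => 
    apply Finsupp.single_mem_supported
    simp
  | succ k ih =>
    refine consL_mem (s := {l | l.map q = ((List.range k).map (q ∘ vtx)).reverse}) _ ?_ _ ?_
    · intro l hl
      simp only [Set.mem_ofPred_eq] at hl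
      simp [hl, List.range_succ]
    · cases k with
      | zero => simpa [TT] using ih
      | succ k =>
        rw [TT]
        split_ifs
        · exact Submodule.sub_mem _ (hmap _ _ _ ih) ih
        · rw [nu, LinearMap.sum_apply]
          exact Submodule.sum_mem _ (fun g _ => hmap _ _ _ ih)

/-! cochains -/

def FZ (a b : ZMod p) : ℤ := if b.val < a.val then 1 else 0

lemma FZ_eq (a b : ZMod p) : (p : ℤ) * FZ a b = (b - a).val - b.val + a.val := by
  unfold FZ
  split_ifs with h
  · have h1 : (a - b).val = a.val - b.val := ZMod.val_sub h.le
    have h2 : a - b ≠ 0 := by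
      intro h0; rw [h0, ZMod.val_zero] at h1; omega
    have : NeZero (a - b) := ⟨h2⟩
    have h3 := ZMod.val_neg_of_ne_zero (a - b)
    rw [neg_sub] at h3
    have h4 := ZMod.val_lt a
    omega
  · have h1 : (b - a).val = b.val - a.val := ZMod.val_sub (by omega)
    omega

def car (a b c : ZMod p) : ℤ := FZ b c - FZ a c + FZ a b

lemma car_inv (g a b c : ZMod p) : car (g + a) (g + b) (g + c) = car a b c := by
  have hp : (p : ℤ) ≠ 0 := by exact_mod_cast (Fact.out : p.Prime).ne_zero
  apply mul_left_cancel₀ hp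
  simp only [car, mul_add, mul_sub, FZ_eq, add_sub_add_left_eq_sub]
  ring

lemma car_eq1 (a c : ZMod p) : car a a c = 0 := by simp [car, FZ]
lemma car_eq2 (a c : ZMod p) : car a c c = 0 := by simp [car, FZ]

lemma sum_FZ (a b : ZMod p) : ∑ g : ZMod p, FZ (g + a) (g + b) = (b - a).val := by
  have hp : (p : ℤ) ≠ 0 := by exact_mod_cast (Fact.out : p.Prime).ne_zero
  apply mul_left_cancel₀ hp
  rw [Finset.mul_sum]
  simp only [FZ_eq, add_sub_add_left_eq_sub, Finset.sum_add_distrib, Finset.sum_sub_distrib]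
  have h : ∀ a : ZMod p, ∑ g : ZMod p, ((g + a).val : ℤ) = ∑ g : ZMod p, (g.val : ℤ) :=
    fun a => Fintype.sum_equiv (Equiv.addRight a) _ _ (fun x => rfl)
  rw [h, h]
  simp

def c2 : List (ZMod p) → ZMod p
  | [] => 0
  | [_] => 1
  | [_, _] => 0
  | a :: b :: c :: l => (car a b c : ℤ) * c2 (c :: l)

def c1 : List (ZMod p) → ZMod p
  | [] => 0
  | [_] => 0
  | a :: b :: l => (b - a) * c2 (b :: l)

def d2 : List (ZMod p) → ZMod p
  | [] => 1
  | [_] => 0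
  | a :: b :: l => (FZ a b : ℤ) * c2 (b :: l)

def d1 : List (ZMod p) → ZMod p
  | [] => 0
  | a :: l => a * c2 (a :: l)

noncomputable def ev (f : List (ZMod p) → ZMod p) : (List (ZMod p) →₀ ZMod p) →ₗ[ZMod p] ZMod p :=
  Finsupp.linearCombination (ZMod p) f

@[simp] lemma ev_single (f : List (ZMod p) → ZMod p) (l : List (ZMod p)) (c : ZMod p) :
    ev f (Finsupp.single l c) = c * f l := by simp [ev]

lemma ev_consL (f f' : List (ZMod p) → ZMod p) (a x : ZMod p) (h : ∀ l, f (a :: l) = x * f' l)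
    (c : List (ZMod p) →₀ ZMod p) : ev f (consL _ a c) = x * ev f' c := by
  induction c using Finsupp.induction_linear with
  | zero => simp
  | add f g hf hg => simp [hf, hg, mul_add]
  | single l c => simp [h]; ring

lemma c2_bdl : ∀ l : List (ZMod p), ev c2 (bdl _ l) = 0
  | [] => by simp [bdl]
  | [a] => by simp [bdl, c2]
  | [a, b] => by simp [bdl, c2]
  | a :: b :: c :: l => by
    have ih := c2_bdl (c :: l)
    rw [bdl, map_sub, ev_single, sub_eq_zero] at ih
    simp only [bdl, map_sub, consL_single, ev_single]
    have key : ev c2 (consL _ a (consL _ b (consL _ c (bdl (ZMod p) l))))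
        = (car a b c : ℤ) * ev c2 (consL _ c (bdl (ZMod p) l)) := by
      have := ev_consL (p := p) (fun l => c2 (a :: b :: l)) (fun l => c2 l) c (car a b c : ℤ)
      rw [ev_consL c2 (fun l => c2 (a :: l)) a 1 (by simp),
        ev_consL (fun l => c2 (a :: l)) (fun l => c2 (a :: b :: l)) b 1 (by simp),
        ev_consL (fun l => c2 (a :: b :: l)) (fun l => c2 (c :: l)) c (car a b c : ℤ)
          (by intro l; rfl),
        ev_consL c2 (fun l => c2 (c :: l)) c 1 (by simp)]
      ring
    rw [key, ← ih]
    cases l with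
    | nil => simp [c2]
    | cons d l =>
      simp only [c2, car]; push_cast; ring

lemma c2_cons_bdl (a : ZMod p) (l : List (ZMod p)) : ev c2 (consL _ a (bdl _ l)) = c2 l := by
  have ih := c2_bdl (a :: l)
  rw [bdl, map_sub, ev_single, sub_eq_zero] at ih
  rw [← ih, one_mul]

lemma d1_bdl : ∀ l : List (ZMod p), ev d1 (bdl _ l) = c1 l
  | [] => by simp [bdl, c1]
  | [a] => by simp [bdl, c1, d1]
  | a :: b :: l => by
    rw [bdl, map_sub, ev_consL d1 (fun l => c2 (a :: l)) a a (by intro l; rfl)]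
    have := c2_cons_bdl a (b :: l)
    rw [ev_consL c2 (fun l => c2 (a :: l)) a 1 (by simp)] at this
    rw [one_mul] at this
    rw [this]
    simp [d1, c1]; ring

lemma d2_bdl : ∀ l : List (ZMod p), ev d2 (bdl _ l) = c2 l
  | [] => by simp [bdl, c2]
  | [a] => by simp [bdl, c2, d2]
  | [a, b] => by simp [bdl, c2, d2]
  | a :: b :: c :: l => by
    rw [bdl, map_sub, bdl, map_sub, map_sub,
      ev_consL d2 (fun l => d2 (a :: l)) a 1 (by simp), ev_consL d2 (fun l => d2 (a :: l)) a 1 (by simp),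
      ev_consL (fun l => d2 (a :: l)) (fun l => c2 (b :: l)) b (FZ a b : ℤ) (by intro l; rfl)]
    have := c2_cons_bdl b (c :: l)
    rw [ev_consL c2 (fun l => c2 (b :: l)) b 1 (by simp), one_mul] at this
    rw [this]
    simp [d2, c2, car]; ring

def sh (g x : ZMod p) : ZMod p := g + x

lemma c2_inv (g : ZMod p) : ∀ l : List (ZMod p), c2 (l.map (sh g)) = c2 l
  | [] => rfl
  | [a] => rfl
  | [a, b] => rfl
  | a :: b :: c :: l => by
    have := c2_inv g (c :: l)
    simp only [List.map_cons, sh] at this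
    simp [c2, car_inv, this, sh]

lemma ev_bd (f f' : List (ZMod p) → ZMod p) (h : ∀ l, ev f (bdl _ l) = f' l)
    (c : List (ZMod p) →₀ ZMod p) : ev f (bd _ c) = ev f' c := by
  induction c using Finsupp.induction_linear with
  | zero => simp
  | add f g hf hg => simp [hf, hg]
  | single l c => simp [h]

lemma d1_del (c : List (ZMod p) →₀ ZMod p) : ev d1 (del sh c) = ev c2 c := by
  induction c using Finsupp.induction_linear with
  | zero => simp
  | add f g hf hg => simp [hf, hg]
  | single l c =>
    cases l with
    | nil => simp [del, d1, c2]
    | cons a l =>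
      have := c2_inv 1 (a :: l)
      simp only [List.map_cons, sh] at this
      simp only [del, LinearMap.sub_apply, mapL_single, LinearMap.id_apply, map_sub, ev_single,
        List.map_cons, d1, sh, this]
      ring

lemma d2_nu (c : List (ZMod p) →₀ ZMod p) : ev d2 (nu sh c) = ev c1 c := by
  induction c using Finsupp.induction_linear with
  | zero => simp
  | add f g hf hg => simp [hf, hg]
  | single l c =>
    simp only [nu, LinearMap.sum_apply, map_sum, mapL_single, ev_single]
    rw [← Finset.mul_sum]
    congr 1
    match l with
    | [] => simp [d2, c1]
    | [a] => simp [d2, c1]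
    | a :: b :: l =>
      have := fun g => c2_inv g (b :: l)
      simp only [List.map_cons, sh] at this
      simp only [List.map_cons, d2, c1, sh, this]
      rw [← Finset.sum_mul, ← Int.cast_sum, sum_FZ]
      simp

lemma main_eval (w : ℕ → (List (ZMod p) →₀ ZMod p)) (h0 : w 0 = Finsupp.single [] 1)
    (hw : ∀ k, bd _ (w (k+1)) = TT sh k (w k)) (k : ℕ) :
    ev (if Even k then c2 else c1) (w (k+1)) = 1 := by
  induction k with
  | zero =>
    have := ev_bd d2 c2 d2_bdl (w 1)
    rw [hw, h0] at this
    simpa [TT, d2] using this.symm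
  | succ k ih =>
    by_cases hk : Even k
    · have := ev_bd d1 c1 d1_bdl (w (k+2))
      rw [hw, TT, if_pos hk, d1_del] at this
      simp only [hk, Nat.even_add_one, if_true, if_false, not_true] at ih ⊢
      rw [← this, ih]
    · have := ev_bd d2 c2 d2_bdl (w (k+2))
      rw [hw, TT, if_neg hk, d2_nu] at this
      simp only [hk, Nat.even_add_one, if_true, if_false, not_false_eq_true] at ih ⊢
      rw [← this, ih]

lemma c2_chain : ∀ l : List (ZMod p), c2 l ≠ 0 → l.IsChain (· ≠ ·)
  | [] => by simp
  | [a] => by simp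
  | [a, b] => by simp [c2]
  | a :: b :: c :: l => by
    intro h
    simp only [c2] at h
    have h1 := c2_chain (c :: l) (right_ne_zero_of_mul h)
    have h2 := left_ne_zero_of_mul h
    rw [List.isChain_cons_cons, List.isChain_cons_cons]
    refine ⟨?_, ?_, h1⟩
    · rintro rfl; simp [car_eq1] at h2
    · rintro rfl; simp [car_eq2] at h2

lemma c1_chain : ∀ l : List (ZMod p), c1 l ≠ 0 → l.IsChain (· ≠ ·)
  | [] => by simp
  | [a] => by simp
  | a :: b :: l => by
    intro h
    simp only [c1] at h
    have h1 := c2_chain (b :: l) (right_ne_zero_of_mul h)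
    have h2 := left_ne_zero_of_mul h
    rw [List.isChain_cons_cons]
    refine ⟨?_, h1⟩
    rintro rfl; simp at h2

lemma ev_eq_zero (f : List (ZMod p) → ZMod p) (s : Set (List (ZMod p)))
    (h : ∀ l ∈ s, f l = 0) (c : List (ZMod p) →₀ ZMod p)
    (hc : c ∈ Finsupp.supported (ZMod p) (ZMod p) s) : ev f c = 0 := by
  rw [ev, Finsupp.linearCombination_apply, Finsupp.sum]
  refine Finset.sum_eq_zero (fun l hl => ?_)
  rw [h l (hc hl), smul_zero]

end cochains
end ZpTKF

namespace ZpTKF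
set_option linter.unusedSectionVars false
set_option linter.unusedSimpArgs false
section labels
variable {p : ℕ} [Fact p.Prime] (α : ℕ)

def cnt (S : Finset (ZMod p × ℕ)) (ε : ZMod p) : ℕ := (S.filter (fun x => x.1 = ε)).card
def hh (S : Finset (ZMod p × ℕ)) : ℕ :=
  Finset.univ.inf' Finset.univ_nonempty (cnt S)
def exc (S : Finset (ZMod p × ℕ)) : Finset (ZMod p) :=
  Finset.univ.filter (fun ε => hh S < cnt S ε)
def ell (S : Finset (ZMod p × ℕ)) : ℕ := p * hh S + (exc S).card
def hi (S : Finset (ZMod p × ℕ)) : Finset (ZMod p × ℕ) := S.filter (fun x => α ≤ x.2)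
def top (S : Finset (ZMod p × ℕ)) : ℕ := S.sup Prod.snd
def slice (S : Finset (ZMod p × ℕ)) (j : ℕ) : Finset (ZMod p) :=
  Finset.univ.filter (fun ε => (ε, j) ∈ S)
def level (S : Finset (ZMod p × ℕ)) : ℕ :=
  if hi α S = ∅ then top S else α + ell (hi α S) - 1
def key (S : Finset (ZMod p × ℕ)) : Finset (ZMod p) :=
  if hi α S = ∅ then slice S (top S)
  else if exc (hi α S) = ∅ then slice (hi α S) (top (hi α S)) else exc (hi α S)
def sg (A : Finset (ZMod p)) (d : ZMod p) : ZMod p :=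
  if (A.card : ZMod p) = 0 then d else (∑ a ∈ A, a) / (A.card : ZMod p)

lemma hh_le (S : Finset (ZMod p × ℕ)) (ε : ZMod p) : hh S ≤ cnt S ε :=
  Finset.inf'_le _ (Finset.mem_univ _)
lemma hh_ex (S : Finset (ZMod p × ℕ)) : ∃ ε, hh S = cnt S ε := by
  obtain ⟨ε, _, h⟩ := Finset.exists_mem_eq_inf' Finset.univ_nonempty (cnt S)
  exact ⟨ε, h⟩
lemma exc_lt (S : Finset (ZMod p × ℕ)) : (exc S).card < p := by
  obtain ⟨ε, h⟩ := hh_ex S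
  have : exc S ⊂ Finset.univ := by
    rw [Finset.ssubset_univ_iff]
    intro h1
    have : ε ∈ exc S := by rw [h1]; simp
    simp [exc, h] at this
  have := Finset.card_lt_card this
  simpa using this
lemma cnt_mono {S S' : Finset (ZMod p × ℕ)} (h : S ⊆ S') (ε : ZMod p) : cnt S ε ≤ cnt S' ε :=
  Finset.card_le_card (Finset.filter_subset_filter _ h)
lemma card_eq_sum (S : Finset (ZMod p × ℕ)) : S.card = ∑ ε, cnt S ε :=
  Finset.card_eq_sum_card_fiberwise (fun _ _ => Finset.mem_coe.2 (Finset.mem_univ _))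

lemma hh_mono {S S' : Finset (ZMod p × ℕ)} (h : S ⊆ S') : hh S ≤ hh S' := by
  obtain ⟨ε, h1⟩ := hh_ex S'
  rw [h1]; exact (hh_le S ε).trans (cnt_mono h ε)

lemma ell_pos {S : Finset (ZMod p × ℕ)} (h : S.Nonempty) : 1 ≤ ell S := by
  have hp := (Fact.out : p.Prime).pos
  by_contra h1
  have h2 : ell S = 0 := by omega
  simp only [ell, Nat.add_eq_zero_iff, mul_eq_zero, Finset.card_eq_zero] at h2
  have h3 : hh S = 0 := by omega
  have : ∀ ε, cnt S ε = 0 := by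
    intro ε
    by_contra h4
    have : ε ∈ exc S := by simp [exc, h3]; omega
    rw [h2.2] at this
    simp at this
  have h5 := card_eq_sum S
  simp [this] at h5
  simp [h5] at h

lemma ell_mono {S S' : Finset (ZMod p × ℕ)} (h : S ⊆ S') :
    ell S < ell S' ∨ (ell S = ell S' ∧ exc S = exc S' ∧ (exc S = ∅ → S = S')) := by
  have hp := (Fact.out : p.Prime).pos
  rcases (hh_mono h).lt_or_eq with h1 | h1
  · left
    have := exc_lt S
    have h3 : p * (hh S + 1) ≤ p * hh S' := Nat.mul_le_mul_left _ h1
    unfold ell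
    rw [mul_add] at h3
    omega
  · have hs : exc S ⊆ exc S' := by
      intro ε
      simp only [exc, Finset.mem_filter, Finset.mem_univ, true_and]
      have := cnt_mono h ε
      omega
    by_cases h2 : exc S = exc S'
    · right
      refine ⟨by rw [ell, ell, h1, h2], h2, fun h3 => ?_⟩
      apply Finset.eq_of_subset_of_card_le h
      rw [card_eq_sum, card_eq_sum S]
      have : ∀ T : Finset (ZMod p × ℕ), exc T = ∅ → ∀ ε, cnt T ε = hh T := by
        intro T hT ε
        have h4 : ε ∉ exc T := by simp [hT]
        simp only [exc, Finset.mem_filter, Finset.mem_univ, true_and] at h4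
        have := hh_le T ε
        omega
      apply Finset.sum_le_sum
      intro ε _
      rw [this S h3, this S' (h2 ▸ h3), h1]
    · left
      have := Finset.card_lt_card (Finset.ssubset_iff_subset_ne.2 ⟨hs, h2⟩)
      unfold ell
      rw [h1]; omega

lemma top_mem {S : Finset (ZMod p × ℕ)} (h : S.Nonempty) : ∃ ε, (ε, top S) ∈ S := by
  obtain ⟨x, hx, h1⟩ := Finset.exists_mem_eq_sup S h Prod.snd
  refine ⟨x.1, ?_⟩
  rw [top, h1]
  exact hx

lemma level_mono {S S' : Finset (ZMod p × ℕ)} (h : S ⊆ S') (hS : S.Nonempty)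
    (H1 : ∀ ε ε' j, (ε, j) ∈ S' → (ε', j) ∈ S' → j < α → ε = ε')
    (H2 : ∀ j, α ≤ j → ∃ ε, (ε, j) ∉ S') :
    level α S < level α S' ∨ (level α S = level α S' ∧ key α S = key α S' ∧
      0 < (key α S).card ∧ (key α S).card < p) := by
  have hp := (Fact.out : p.Prime)
  have hsub : hi α S ⊆ hi α S' := Finset.filter_subset_filter _ h
  have hlow : ∀ T : Finset (ZMod p × ℕ), hi α T = ∅ → ∀ x ∈ T, x.2 < α := by
    intro T hT x hx
    by_contra h1
    have : x ∈ hi α T := by simp [hi, hx]; omega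
    simp [hT] at this
  by_cases h1 : hi α S' = ∅
  · have h2 : hi α S = ∅ := by rw [h1] at hsub; exact Finset.subset_empty.1 hsub
    simp only [level, key, h1, h2, if_true]
    have h3 : top S ≤ top S' := Finset.sup_mono h
    rcases h3.lt_or_eq with h3 | h3
    · left; exact h3
    · right
      obtain ⟨ε, he⟩ := top_mem hS
      have hsl : ∀ T ⊆ S', (ε, top S) ∈ T → slice T (top S) = {ε} := by
        intro T hT hε
        ext ε'
        simp only [slice, Finset.mem_filter, Finset.mem_univ, true_and, Finset.mem_singleton]
        constructor
        · intro h5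
          exact H1 _ _ _ (hT h5) (hT hε) (hlow S h2 _ he)
        · rintro rfl; exact hε
      refine ⟨h3, ?_⟩
      rw [← h3, hsl S h he, hsl S' (Finset.Subset.refl _) (h he)]
      simp [hp.one_lt]
  · have h1' := ell_pos (Finset.nonempty_iff_ne_empty.2 h1)
    by_cases h2 : hi α S = ∅
    · left
      simp only [level, h1, h2, if_true, if_false]
      obtain ⟨ε, he⟩ := top_mem hS
      have := hlow S h2 _ he
      simp only at this
      omega
    · have h2' := ell_pos (Finset.nonempty_iff_ne_empty.2 h2)
      simp only [level, key, h1, h2, if_false]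
      rcases ell_mono hsub with h3 | ⟨h3, h4, h5⟩
      · left; omega
      · right
        refine ⟨by omega, ?_⟩
        rw [← h4]
        by_cases h6 : exc (hi α S) = ∅
        · rw [← h5 h6]
          simp only [h6, if_true, true_and]
          obtain ⟨ε, he⟩ := top_mem (Finset.nonempty_iff_ne_empty.2 h2)
          constructor
          · rw [Finset.card_pos]
            exact ⟨ε, by simp [slice, he]⟩
          · have hα : α ≤ top (hi α S) := by
              have := he
              simp only [hi, Finset.mem_filter] at this
              exact this.2
            obtain ⟨ε', he'⟩ := H2 _ hα
            have : slice (hi α S) (top (hi α S)) ⊂ Finset.univ := by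
              rw [Finset.ssubset_univ_iff]
              intro h7
              have h8 : ε' ∈ slice (hi α S) (top (hi α S)) := by rw [h7]; simp
              simp only [slice, Finset.mem_filter, Finset.mem_univ, true_and] at h8
              exact he' (h (Finset.mem_filter.1 h8).1)
            have := Finset.card_lt_card this
            simpa using this
        · simp only [h6, if_false, true_and]
          refine ⟨?_, exc_lt _⟩
          rw [Finset.card_pos]; exact Finset.nonempty_iff_ne_empty.2 h6

/-! equivariance -/
def Shift (g : ZMod p) (S S' : Finset (ZMod p × ℕ)) : Prop := ∀ ε j, (g + ε, j) ∈ S' ↔ (ε, j) ∈ S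
def ShiftA (g : ZMod p) (A A' : Finset (ZMod p)) : Prop := ∀ ε, g + ε ∈ A' ↔ ε ∈ A

lemma ShiftA.eq_map {g : ZMod p} {A A' : Finset (ZMod p)} (h : ShiftA g A A') :
    A' = A.map (Equiv.addLeft g).toEmbedding := by
  ext x
  simp only [Finset.mem_map_equiv, Equiv.addLeft_symm, Equiv.coe_addLeft]
  rw [← h]; simp

lemma ShiftA.card {g : ZMod p} {A A' : Finset (ZMod p)} (h : ShiftA g A A') :
    A'.card = A.card := by rw [h.eq_map]; simp

lemma sg_shift {g : ZMod p} {A A' : Finset (ZMod p)} (h : ShiftA g A A') (d : ZMod p) :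
    sg A' (g + d) = g + sg A d := by
  unfold sg
  rw [h.card]
  split_ifs with h1
  · rfl
  · rw [h.eq_map]
    simp only [Finset.sum_map, Equiv.coe_toEmbedding, Equiv.coe_addLeft, Finset.sum_add_distrib,
      Finset.sum_const, nsmul_eq_mul]
    field_simp
    rw [Finset.sum_add_distrib, Finset.sum_const, nsmul_eq_mul, mul_comm]

lemma Shift.cnt {g : ZMod p} {S S' : Finset (ZMod p × ℕ)} (h : Shift g S S') (ε : ZMod p) :
    cnt S' (g + ε) = cnt S ε := by
  symm
  unfold ZpTKF.cnt
  apply Finset.card_bij (fun x _ => (g + x.1, x.2))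
  · rintro ⟨a, j⟩ hx
    simp only [Finset.mem_filter] at hx ⊢
    exact ⟨(h _ _).2 hx.1, by rw [hx.2]⟩
  · rintro ⟨a, j⟩ _ ⟨b, k⟩ _ h1
    simpa using h1
  · rintro ⟨a, j⟩ hx
    simp only [Finset.mem_filter] at hx
    obtain ⟨h1, rfl⟩ := hx
    exact ⟨(ε, j), by simpa using (h _ _).1 h1, rfl⟩

lemma Shift.hh {g : ZMod p} {S S' : Finset (ZMod p × ℕ)} (h : Shift g S S') :
    hh S' = hh S := by
  apply le_antisymm
  · obtain ⟨ε, h1⟩ := hh_ex S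
    rw [h1, ← h.cnt]; exact hh_le _ _
  · obtain ⟨ε, h1⟩ := hh_ex S'
    have := h.cnt (ε - g)
    rw [add_sub_cancel] at this
    rw [h1, this]; exact hh_le _ _

lemma Shift.exc {g : ZMod p} {S S' : Finset (ZMod p × ℕ)} (h : Shift g S S') :
    ShiftA g (exc S) (exc S') := by
  intro ε
  simp [ZpTKF.exc, h.cnt, h.hh]

lemma Shift.ell {g : ZMod p} {S S' : Finset (ZMod p × ℕ)} (h : Shift g S S') :
    ell S' = ell S := by
  rw [ZpTKF.ell, ZpTKF.ell, h.hh, h.exc.card]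

lemma Shift.hi {g : ZMod p} {S S' : Finset (ZMod p × ℕ)} (h : Shift g S S') :
    Shift g (hi α S) (hi α S') := by
  intro ε j
  simp [ZpTKF.hi, h ε j]

lemma Shift.le_top {g : ZMod p} {S S' : Finset (ZMod p × ℕ)} (h : Shift g S S') :
    top S' ≤ top S := by
  apply Finset.sup_le
  rintro ⟨a, j⟩ hx
  have : (a - g, j) ∈ S := by rw [← h]; simpa using hx
  exact Finset.le_sup (f := Prod.snd) (b := (a - g, j)) this

lemma Shift.symm {g : ZMod p} {S S' : Finset (ZMod p × ℕ)} (h : Shift g S S') :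
    Shift (-g) S' S := by
  intro ε j
  rw [← h]; simp

lemma Shift.top {g : ZMod p} {S S' : Finset (ZMod p × ℕ)} (h : Shift g S S') :
    top S' = top S := le_antisymm h.le_top h.symm.le_top

lemma Shift.slice {g : ZMod p} {S S' : Finset (ZMod p × ℕ)} (h : Shift g S S') (j : ℕ) :
    ShiftA g (slice S j) (slice S' j) := by
  intro ε
  simp [ZpTKF.slice, h ε j]

lemma Shift.empty {g : ZMod p} {S S' : Finset (ZMod p × ℕ)} (h : Shift g S S') :
    S' = ∅ ↔ S = ∅ := by
  simp only [Finset.eq_empty_iff_forall_notMem, Prod.forall]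
  constructor
  · intro h1 a b h2
    exact h1 _ _ ((h a b).2 h2)
  · intro h1 a b h2
    apply h1 (a - g) b
    rw [← h]; simpa using h2

lemma ShiftA.empty {g : ZMod p} {S S' : Finset (ZMod p)} (h : ShiftA g S S') :
    S' = ∅ ↔ S = ∅ := by
  rw [← Finset.card_eq_zero, h.card, Finset.card_eq_zero]

lemma Shift.level {g : ZMod p} {S S' : Finset (ZMod p × ℕ)} (h : Shift g S S') :
    level α S' = level α S := by
  simp only [ZpTKF.level, (h.hi α).empty, h.top, (h.hi α).ell]

lemma Shift.key {g : ZMod p} {S S' : Finset (ZMod p × ℕ)} (h : Shift g S S') :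
    ShiftA g (key α S) (key α S') := by
  simp only [ZpTKF.key, (h.hi α).empty, (h.hi α).exc.empty, h.top, (h.hi α).top]
  split_ifs
  · exact h.slice _
  · exact (h.hi α).slice _
  · exact (h.hi α).exc

lemma balanced (S : Finset (ZMod p × ℕ)) (N : ℕ) (hN : N ≤ ell S) :
    ∃ T ⊆ S, T.card = N ∧ ∀ ε, N / p ≤ cnt T ε ∧ cnt T ε ≤ (N + p - 1) / p := by
  have hp := (Fact.out : p.Prime).pos
  have hdiv := Nat.div_add_mod N p
  have hmod := Nat.mod_lt N hp
  set q := N / p with hq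
  set r := N % p with hr
  have hexc := exc_lt S
  have hqh : q ≤ hh S := by
    by_contra h1
    have h2 : p * (hh S + 1) ≤ p * q := Nat.mul_le_mul_left _ (by omega)
    rw [mul_add] at h2
    unfold ell at hN
    omega
  have hB : ∃ B : Finset (ZMod p), B.card = r ∧ ∀ ε ∈ B, q + 1 ≤ cnt S ε := by
    rcases hqh.lt_or_eq with h1 | h1
    · obtain ⟨B, _, h2⟩ := Finset.exists_subset_card_eq
        (s := (Finset.univ : Finset (ZMod p))) (n := r) (by simpa using hmod.le)
      exact ⟨B, h2, fun ε _ => le_trans h1 (hh_le S ε)⟩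
    · obtain ⟨B, h3, h2⟩ := Finset.exists_subset_card_eq
        (s := exc S) (n := r) (by unfold ell at hN; rw [← h1] at hN; omega)
      refine ⟨B, h2, fun ε he => ?_⟩
      have := h3 he
      simp only [exc, Finset.mem_filter] at this
      omega
  obtain ⟨B, hB1, hB2⟩ := hB
  have hch : ∀ ε, ∃ U ⊆ S.filter (fun x => x.1 = ε), U.card = q + if ε ∈ B then 1 else 0 := by
    intro ε
    apply Finset.exists_subset_card_eq
    change _ ≤ cnt S ε
    split_ifs with h
    · exact hB2 ε h
    · exact hqh.trans (hh_le S ε)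
  choose U hU1 hU2 using hch
  have hU3 : ∀ ε x, x ∈ U ε → x ∈ S ∧ x.1 = ε := fun ε x hx => Finset.mem_filter.1 (hU1 ε hx)
  have hcnt : ∀ ε, cnt (Finset.univ.biUnion U) ε = q + if ε ∈ B then 1 else 0 := by
    intro ε
    rw [← hU2 ε, cnt]
    congr 1
    ext x
    simp only [Finset.mem_filter, Finset.mem_biUnion, Finset.mem_univ, true_and]
    constructor
    · rintro ⟨⟨a, ha⟩, rfl⟩
      rwa [(hU3 _ _ ha).2]
    · intro hx
      exact ⟨⟨ε, hx⟩, (hU3 _ _ hx).2⟩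
  refine ⟨Finset.univ.biUnion U, ?_, ?_, ?_⟩
  · intro x hx
    simp only [Finset.mem_biUnion, Finset.mem_univ, true_and] at hx
    obtain ⟨a, ha⟩ := hx
    exact (hU3 _ _ ha).1
  · rw [card_eq_sum]
    simp only [hcnt, Finset.sum_add_distrib]
    simp [hB1]
    exact hdiv
  · intro ε
    rw [hcnt]
    refine ⟨by omega, ?_⟩
    rw [Nat.le_div_iff_mul_le hp]
    split_ifs with h
    · have : 0 < r := by rw [← hB1]; exact Finset.card_pos.2 ⟨ε, h⟩
      rw [add_mul, mul_comm q p]; omega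
    · rw [add_zero, mul_comm q p]; omega

end labels
end ZpTKF

namespace ZpTKF
set_option linter.unusedSectionVars false
section final
variable {n p : ℕ} [Fact p.Prime]

abbrev PP (n p : ℕ) := {X : Fin n → Option (ZMod p) // ∃ i, X i ≠ none}

def actP (g : ZMod p) (X : PP n p) : PP n p :=
  ⟨fun i => (X.1 i).map fun δ => g + δ, by
    obtain ⟨i, hi⟩ := X.2
    exact ⟨i, by simpa using hi⟩⟩

def actV (g : ZMod p) (v : ZMod p × Fin n) : ZMod p × Fin n := (g + v.1, v.2)
def actR (g : ZMod p) (v : ZMod p × ℕ) : ZMod p × ℕ := (g + v.1, v.2)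

def sv : List (ZMod p × Fin n) → Fin n → Option (ZMod p)
  | [] => fun _ => none
  | v :: l => Function.update (sv l) v.2 (some v.1)

lemma sv_ne (l : List (ZMod p × Fin n)) (h : l ≠ []) : ∃ i, sv l i ≠ none := by
  cases l with
  | nil => simp at h
  | cons v l => exact ⟨v.2, by simp [sv]⟩

lemma sv_act (g : ZMod p) (l : List (ZMod p × Fin n)) :
    sv (l.map (actV g)) = fun i => (sv l i).map fun δ => g + δ := by
  induction l with
  | nil => rfl
  | cons v l ih =>
    funext i
    simp only [List.map_cons, sv, ih, actV]
    by_cases h : i = v.2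
    · subst h; simp
    · simp [h]

lemma sv_eq_some (l : List (ZMod p × Fin n)) (h : (l.map Prod.snd).Nodup) (i : Fin n)
    (ε : ZMod p) : sv l i = some ε ↔ (ε, i) ∈ l := by
  induction l with
  | nil => simp [sv]
  | cons v l ih =>
    simp only [List.map_cons, List.nodup_cons] at h
    have ih := ih h.2
    simp only [sv, List.mem_cons]
    by_cases h1 : i = v.2
    · subst h1
      have : (ε, v.2) ∉ l := fun h2 => h.1 (List.mem_map.2 ⟨_, h2, rfl⟩)
      simp [this, Prod.ext_iff, eq_comm]
    · simp [h1, ih, Prod.ext_iff]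

noncomputable def svP [Inhabited (PP n p)] (l : List (ZMod p × Fin n)) : PP n p :=
  open Classical in if h : ∃ i, sv l i ≠ none then ⟨sv l, h⟩ else default

lemma svP_val [Inhabited (PP n p)] (l : List (ZMod p × Fin n)) (h : l ≠ []) :
    (svP l).1 = sv l := by
  rw [svP, dif_pos (sv_ne l h)]

def GoodP (c : List (PP n p)) : Prop := c.Pairwise (fun X Y => PSub Y.1 X.1)
def relR (v w : ZMod p × ℕ) : Prop := w.2 < v.2 ∨ v = w

theorem no_map (hn : 1 ≤ n) (Φ : List (PP n p) → ZMod p × ℕ)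
    (heq : ∀ g l, l ≠ [] → Φ (l.map (actP g)) = actR g (Φ l))
    (hmono : ∀ σ τ, GoodP σ → τ.Sublist σ → τ ≠ [] → relR (Φ σ) (Φ τ))
    (hb : ∀ σ, GoodP σ → σ ≠ [] → (Φ σ).2 + 1 < n) : False := by
  let _ : Inhabited (PP n p) := ⟨⟨fun _ => some 0, ⟨⟨0, hn⟩, by simp⟩⟩⟩
  let vtx : ℕ → ZMod p × Fin n := fun k => (0, ⟨k % n, Nat.mod_lt _ hn⟩)
  have hact : ∀ (g g' : ZMod p) (v : ZMod p × Fin n), actV g (actV g' v) = actV (g + g') v := by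
    intro g g' v; simp [actV, add_assoc]
  let y := YY actV vtx
  let z : ℕ → (List (PP n p) →₀ ZMod p) := fun k => sdN _ svP k (y k)
  let u : ℕ → (List (ZMod p × ℕ) →₀ ZMod p) := fun k => sdN _ Φ k (z k)
  let w : ℕ → (List (ZMod p) →₀ ZMod p) := fun k => mapL _ Prod.fst (u k)
  have hy : ∀ k, bd _ (y (k+1)) = TT actV k (y k) := bd_YY actV hact vtx
  have hz : ∀ k, bd _ (z (k+1)) = TT actP k (z k) := by
    intro k
    simp only [z]
    rw [bd_sdN, hy]
    refine (TT_comm actV actP (sdN _ svP k) (fun g c => mapL_sdN _ _ _ ?_ _ _) k (y k)).symm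
    intro l hl
    apply Subtype.ext
    rw [svP_val _ (by simpa using hl), sv_act]
    simp only [actP, svP_val l hl]
  have hu : ∀ k, bd _ (u (k+1)) = TT actR k (u k) := by
    intro k
    simp only [u]
    rw [bd_sdN, hz]
    exact (TT_comm actP actR (sdN _ Φ k) (fun g c => mapL_sdN _ _ _ (heq g) _ _) k (z k)).symm
  have hw : ∀ k, bd _ (w (k+1)) = TT sh k (w k) := by
    intro k
    simp only [w]
    rw [← mapL_bd, hu]
    refine (TT_comm actR sh (mapL _ Prod.fst) (fun g c => ?_) k (u k)).symm
    rw [mapL_mapL, mapL_mapL]; rfl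
  have hw0 : w 0 = Finsupp.single [] 1 := by
    simp [w, u, z, y, YY, sdN_zero_single]
  have hmain := main_eval w hw0 hw (n - 1)
  rw [Nat.sub_add_cancel hn] at hmain
  -- supports
  have hym : y n ∈ Finsupp.supported (ZMod p) (ZMod p)
      {l | (l.map Prod.snd).Nodup ∧ l.length = n} := by
    refine Finsupp.supported_mono ?_ (YY_mem actV Prod.snd (fun g v => rfl) vtx n)
    intro l hl
    have hl : l.map Prod.snd = _ := hl
    constructor
    · rw [hl, List.nodup_reverse]
      apply List.Nodup.map_on _ List.nodup_range
      intro a ha b hb h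
      simp only [Function.comp, vtx, Fin.mk.injEq] at h
      rw [List.mem_range] at ha hb
      rwa [Nat.mod_eq_of_lt ha, Nat.mod_eq_of_lt hb] at h
    · have := congrArg List.length hl
      simpa using this
  have hzm : z n ∈ Finsupp.supported (ZMod p) (ZMod p)
      {c | GoodP c ∧ c.length = n} := by
    refine map_mem_supported _ _ _ ?_ _ hym
    rintro l ⟨h1, h2⟩
    refine Finsupp.supported_mono ?_ (sdN_mem svP (fun l => (l.map Prod.snd).Nodup) ?_
      (fun X Y => PSub Y.1 X.1) ?_ n l h1 h2)
    · rintro L ⟨a, b, _⟩; exact ⟨a, b⟩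
    · intro σ τ h h'
      exact h.sublist (h'.map _)
    · intro σ τ h h' hne i hi
      have hne' : σ ≠ [] := by rintro rfl; exact hne (List.sublist_nil.1 h')
      rw [svP_val _ hne] at hi ⊢
      rw [svP_val _ hne']
      obtain ⟨ε, he⟩ := Option.ne_none_iff_exists'.1 hi
      rw [he, sv_eq_some σ h]
      rw [sv_eq_some τ (h.sublist (h'.map _))] at he
      exact h'.subset he
  have hum : u n ∈ Finsupp.supported (ZMod p) (ZMod p)
      {L | L.Pairwise relR ∧ L.length = n ∧ ∀ v ∈ L, v.2 + 1 < n} := by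
    refine map_mem_supported _ _ _ ?_ _ hzm
    rintro c ⟨h1, h2⟩
    refine Finsupp.supported_mono ?_ (sdN_mem Φ GoodP ?_ relR hmono n c h1 h2)
    · rintro L ⟨a, b, d⟩
      refine ⟨a, b, fun v hv => ?_⟩
      obtain ⟨τ, ht, hne, rfl⟩ := d v hv
      exact hb τ (List.Pairwise.sublist ht h1) hne
    · intro σ τ h h'
      exact List.Pairwise.sublist h' h
  have hwm : w n ∈ Finsupp.supported (ZMod p) (ZMod p) {L | ¬ L.IsChain (· ≠ ·)} := by
    refine map_mem_supported _ _ _ ?_ _ hum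
    rintro L ⟨h1, h2, h3⟩
    rw [mapL_single]
    apply Finsupp.single_mem_supported
    intro h4
    rw [List.isChain_map] at h4
    have h5 : L.IsChain (fun v w => w.2 < v.2) := by
      have h6 := h1.isChain
      clear h1 h2 h3
      induction L with
      | nil => simp
      | cons a L ih =>
        cases L with
        | nil => simp
        | cons b L =>
          rw [List.isChain_cons_cons] at h4 h6 ⊢
          refine ⟨?_, ih h4.2 h6.2⟩
          rcases h6.1 with h | h
          · exact h
          · exact absurd (congrArg Prod.fst h) h4.1
    have h7 : (L.map Prod.snd).IsChain (fun a b => b < a) := by rw [List.isChain_map]; exact h5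
    have h8 : (L.map Prod.snd).Pairwise (fun a b => b < a) := by
      rw [← List.isChain_iff_pairwise (R := fun a b : ℕ => b < a)]; exact h7
    have h9 : (L.map Prod.snd).Nodup := h8.imp (fun h => by omega)
    have h10 := List.toFinset_card_of_nodup h9
    have h11 : (L.map Prod.snd).toFinset ⊆ Finset.range (n - 1) := by
      intro x hx
      simp only [List.mem_toFinset, List.mem_map] at hx
      obtain ⟨v, hv, rfl⟩ := hx
      have := h3 v hv
      rw [Finset.mem_range]; omega
    have := Finset.card_le_card h11
    rw [h10, Finset.card_range, List.length_map, h2] at this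
    omega
  rw [ev_eq_zero _ _ _ _ hwm] at hmain
  · exact zero_ne_one hmain
  · intro l hl
    by_contra h
    split_ifs at h
    · exact hl (c2_chain l h)
    · exact hl (c1_chain l h)

lemma extract {A L : Type} [DecidableEq L] (Λ : A → L) (c : List A) (T : Finset L)
    (hT : T ⊆ (c.map Λ).toFinset) :
    ∃ l : List A, l.Sublist c ∧ (l.map Λ).Nodup ∧ (l.map Λ).toFinset = T := by
  induction c generalizing T with
  | nil =>
    refine ⟨[], List.Sublist.refl _, by simp, ?_⟩
    simp at hT; simp [hT]
  | cons a c ih =>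
    obtain ⟨l, h1, h2, h3⟩ := ih (T.erase (Λ a)) (by
      intro x hx
      rw [Finset.mem_erase] at hx
      have := hT hx.2
      simp only [List.map_cons, List.toFinset_cons, Finset.mem_insert] at this
      exact this.resolve_left hx.1)
    by_cases ha : Λ a ∈ T
    · refine ⟨a :: l, h1.cons_cons a, ?_, ?_⟩
      · rw [List.map_cons, List.nodup_cons]
        refine ⟨?_, h2⟩
        rw [← List.mem_toFinset, h3]; simp
      · rw [List.map_cons, List.toFinset_cons, h3, Finset.insert_erase ha]
    · refine ⟨l, h1.cons a, h2, ?_⟩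
      rw [h3, Finset.erase_eq_of_notMem ha]

lemma extractZ {L : Type} [DecidableEq L] (Λ : PP n p → L) (c : List (PP n p)) (hc : GoodP c)
    (T : Finset L) (hT : T ⊆ (c.map Λ).toFinset) (N : ℕ) (hN : T.card = N) :
    ∃ Z : Fin N → PP n p, (∀ k l, k < l → PSub (Z k).1 (Z l).1) ∧
      Function.Injective (fun k => Λ (Z k)) ∧ Finset.univ.image (fun k => Λ (Z k)) = T := by
  obtain ⟨l, h1, h2, h3⟩ := extract Λ c T hT
  have hlen : l.reverse.length = N := by
    rw [← hN, ← h3, List.toFinset_card_of_nodup h2]; simp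
  have hpw : l.reverse.Pairwise (fun X Y => PSub X.1 Y.1) := by
    rw [List.pairwise_reverse]
    exact List.Pairwise.sublist h1 hc
  have hnd : (l.reverse.map Λ).Nodup := by
    rw [List.map_reverse, List.nodup_reverse]; exact h2
  have h3' : (l.reverse.map Λ).toFinset = T := by
    rw [← h3]; ext; simp
  subst hlen
  refine ⟨fun k => l.reverse.get k, ?_, ?_, ?_⟩
  · intro k k' hk
    exact List.pairwise_iff_get.1 hpw k k' hk
  · intro k k' hk
    have hk : Λ (l.reverse.get k) = Λ (l.reverse.get k') := hk
    have : Function.Injective (fun k : Fin l.reverse.length => Λ (l.reverse.get k)) := by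
      have h := hnd
      rw [List.Nodup, List.pairwise_map, List.pairwise_iff_get] at h
      intro a b hab
      by_contra hne
      rcases lt_or_gt_of_ne hne with h' | h'
      · exact h a b h' hab
      · exact h b a h' hab.symm
    exact this hk
  · rw [← h3']
    ext x
    simp only [Finset.mem_image, Finset.mem_univ, true_and, List.mem_toFinset, List.mem_map]
    constructor
    · rintro ⟨k, rfl⟩; exact ⟨_, List.get_mem _ _, rfl⟩
    · rintro ⟨a, ha, rfl⟩
      obtain ⟨k, rfl⟩ := List.get_of_mem ha
      exact ⟨k, rfl⟩

end final
end ZpTKF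

/-- **Z_p-Tucker–Ky Fan lemma, main conclusion.**
`λ = (lam1, lam2) : (Z_p ∪ {0})^n ∖ {0} → Z_p × [m]` is a `Z_p`-equivariant map
(the value `j ∈ [m] = {1, …, m}` is modelled by the element of `Fin m` with
`val = j - 1`, so "`λ₂(X) ≤ α`" reads `(lam2 X : ℕ) + 1 ≤ α`). -/
theorem zp_tucker_ky_fan (m n p α : ℕ) (hm : 1 ≤ m) (hn : 1 ≤ n)
    (hα1 : 1 ≤ α) (hαm : α ≤ m) (hp : p.Prime)
    (lam1 : (Fin n → Option (ZMod p)) → ZMod p)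
    (lam2 : (Fin n → Option (ZMod p)) → Fin m)
    (hequiv : ∀ X : Fin n → Option (ZMod p), (∃ i, X i ≠ none) → ∀ ε : ZMod p,
      lam1 (fun i => (X i).map fun δ => ε + δ) = ε + lam1 X ∧
      lam2 (fun i => (X i).map fun δ => ε + δ) = lam2 X)
    (h1 : ∀ X Y : Fin n → Option (ZMod p), (∃ i, X i ≠ none) → (∃ i, Y i ≠ none) →
      PSub X Y → lam2 X = lam2 Y → (lam2 X : ℕ) + 1 ≤ α → lam1 X = lam1 Y)
    (h2 : ∀ Z : Fin p → (Fin n → Option (ZMod p)),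
      (∀ k, ∃ i, Z k i ≠ none) →
      (∀ k l, k ≤ l → PSub (Z k) (Z l)) →
      (∀ k l, lam2 (Z k) = lam2 (Z l)) →
      (∀ k, α + 1 ≤ (lam2 (Z k) : ℕ) + 1) →
      (Finset.univ.image fun k => lam1 (Z k)).card < p) :
    ∃ Z : Fin (n - α) → (Fin n → Option (ZMod p)),
      (∀ k, ∃ i, Z k i ≠ none) ∧
      (∀ k l, k < l → PSub (Z k) (Z l) ∧ Z k ≠ Z l) ∧
      (∀ k, α + 1 ≤ (lam2 (Z k) : ℕ) + 1) ∧
      (∀ k l, k ≠ l → (lam1 (Z k), lam2 (Z k)) ≠ (lam1 (Z l), lam2 (Z l))) ∧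
      (∀ ε : ZMod p,
        (n - α) / p ≤ (Finset.univ.filter fun k => lam1 (Z k) = ε).card ∧
        (Finset.univ.filter fun k => lam1 (Z k) = ε).card ≤ (n - α + p - 1) / p) := by
  have : Fact p.Prime := ⟨hp⟩
  by_contra hcon
  have hαn : α < n := by
    by_contra hle
    have h0 : n - α = 0 := by omega
    apply hcon
    rw [h0]
    refine ⟨fun k => k.elim0, fun k => k.elim0, fun k => k.elim0, fun k => k.elim0,
      fun k => k.elim0, fun ε => ?_⟩
    simp
  let Λ : ZpTKF.PP n p → ZMod p × ℕ := fun X => (lam1 X.1, (lam2 X.1 : ℕ))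
  let SS : List (ZpTKF.PP n p) → Finset (ZMod p × ℕ) := fun c => (c.map Λ).toFinset
  let Φ : List (ZpTKF.PP n p) → ZMod p × ℕ := fun c =>
    (ZpTKF.sg (ZpTKF.key α (SS c)) ((c.map Λ).headD (0, 0)).1, ZpTKF.level α (SS c))
  have hΛ : ∀ g X, Λ (ZpTKF.actP g X) = ZpTKF.actR g (Λ X) := by
    intro g X
    obtain ⟨ha, hb⟩ := hequiv X.1 X.2 g
    exact Prod.ext ha (congrArg Fin.val hb)
  have hshift : ∀ g c, ZpTKF.Shift g (SS c) (SS (c.map (ZpTKF.actP g))) := by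
    intro g c ε j
    simp only [SS, List.mem_toFinset, List.mem_map]
    constructor
    · rintro ⟨Y, ⟨X, hX, rfl⟩, hY⟩
      rw [hΛ] at hY
      refine ⟨X, hX, ?_⟩
      simp only [ZpTKF.actR, Prod.mk.injEq, add_right_inj] at hY
      exact Prod.ext hY.1 hY.2
    · rintro ⟨X, hX, h⟩
      exact ⟨_, ⟨X, hX, rfl⟩, by rw [hΛ, h]; rfl⟩
  have hcmp : ∀ c : List (ZpTKF.PP n p), ZpTKF.GoodP c → ∀ X ∈ c, ∀ Y ∈ c, PSub X.1 Y.1 ∨ PSub Y.1 X.1 := by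
    intro c hc X hX Y hY
    have hc' : c.Pairwise (fun X Y => PSub X.1 Y.1 ∨ PSub Y.1 X.1) := hc.imp (fun h => Or.inr h)
    have : Std.Symm (fun X Y : ZpTKF.PP n p => PSub X.1 Y.1 ∨ PSub Y.1 X.1) :=
      ⟨fun X Y h => h.symm⟩
    exact List.Pairwise.forall_of_forall
      (R := fun X Y : ZpTKF.PP n p => PSub X.1 Y.1 ∨ PSub Y.1 X.1) (fun X _ => Or.inl (fun i _ => rfl)) hc' hX hY
  have H1 : ∀ c, ZpTKF.GoodP c → ∀ ε ε' j, (ε, j) ∈ SS c → (ε', j) ∈ SS c → j < α → ε = ε' := by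
    intro c hc ε ε' j hx hy hj
    simp only [SS, List.mem_toFinset, List.mem_map, Λ, Prod.mk.injEq] at hx hy
    obtain ⟨X, hX, rfl, hXj⟩ := hx
    obtain ⟨Y, hY, rfl, hYj⟩ := hy
    have hl : lam2 X.1 = lam2 Y.1 := Fin.ext (by omega)
    rcases hcmp c hc X hX Y hY with h | h
    · exact h1 _ _ X.2 Y.2 h hl (by omega)
    · exact (h1 _ _ Y.2 X.2 h hl.symm (by omega)).symm
  have H2 : ∀ c, ZpTKF.GoodP c → ∀ j, α ≤ j → ∃ ε, (ε, j) ∉ SS c := by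
    intro c hc j hj
    by_contra hall
    push Not at hall
    obtain ⟨Z, hZ1, hZ2, hZ3⟩ := ZpTKF.extractZ Λ c hc
      (Finset.univ.image (fun ε : ZMod p => (ε, j))) (by
        intro x hx
        obtain ⟨ε, _, rfl⟩ := Finset.mem_image.1 hx
        exact hall ε) p (by
        rw [Finset.card_image_of_injective _ (fun a b h => (Prod.mk.inj h).1)]
        simp)
    have hZj : ∀ k, (lam2 (Z k).1 : ℕ) = j := by
      intro k
      have : Λ (Z k) ∈ Finset.univ.image (fun ε : ZMod p => (ε, j)) := by
        rw [← hZ3]; exact Finset.mem_image_of_mem _ (Finset.mem_univ _)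
      obtain ⟨ε, _, he⟩ := Finset.mem_image.1 this
      exact (congrArg Prod.snd he).symm
    have := h2 (fun k => (Z k).1) (fun k => (Z k).2) (by
        intro k l hkl
        rcases hkl.lt_or_eq with h | rfl
        · exact hZ1 k l h
        · exact fun i _ => rfl)
      (fun k l => Fin.ext (by rw [hZj, hZj])) (fun k => by rw [hZj]; omega)
    rw [Finset.card_image_of_injective] at this
    · simp at this
    · intro k l hkl
      apply hZ2
      exact Prod.ext hkl (by simp only [Λ, hZj])
  have hbound : ∀ c, ZpTKF.GoodP c → ZpTKF.ell (ZpTKF.hi α (SS c)) < n - α := by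
    intro c hc
    by_contra hge
    obtain ⟨T, hT1, hT2, hT3⟩ := ZpTKF.balanced (ZpTKF.hi α (SS c)) (n - α) (by omega)
    obtain ⟨Z, hZ1, hZ2, hZ3⟩ := ZpTKF.extractZ Λ c hc T
      (hT1.trans (Finset.filter_subset _ _)) (n - α) hT2
    apply hcon
    refine ⟨fun k => (Z k).1, fun k => (Z k).2, ?_, ?_, ?_, ?_⟩
    · intro k l hkl
      refine ⟨hZ1 k l hkl, fun h => hkl.ne (hZ2 ?_)⟩
      exact congrArg Λ (Subtype.ext h)
    · intro k
      have hk : Λ (Z k) ∈ T := by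
        rw [← hZ3]; exact Finset.mem_image_of_mem _ (Finset.mem_univ _)
      have hk := (Finset.mem_filter.1 (hT1 hk)).2
      exact Nat.succ_le_succ hk
    · intro k l hkl h
      apply hkl
      apply hZ2
      simp only [Prod.mk.injEq] at h
      exact Prod.ext h.1 (congrArg Fin.val h.2)
    · intro ε
      have hcard : (Finset.univ.filter fun k => lam1 (Z k).1 = ε).card = ZpTKF.cnt T ε := by
        rw [ZpTKF.cnt, ← hZ3, Finset.filter_image, Finset.card_image_of_injective _ hZ2]
      rw [hcard]
      exact hT3 ε
  refine ZpTKF.no_map hn Φ ?_ ?_ ?_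
  · intro g c hc
    simp only [Φ, ZpTKF.actR]
    refine Prod.ext ?_ ((hshift g c).level α)
    cases c with
    | nil => exact absurd rfl hc
    | cons X c =>
      have := ZpTKF.sg_shift ((hshift g (X :: c)).key α) (Λ X).1
      simp only [List.map_cons, List.headD_cons, hΛ] at this ⊢
      exact this
  · intro σ τ hσ hτ hne
    have hsub : SS τ ⊆ SS σ := by
      intro x hx
      simp only [SS, List.mem_toFinset] at hx ⊢
      exact (hτ.map Λ).subset hx
    have hSne : (SS τ).Nonempty := by
      rw [List.toFinset_nonempty_iff]
      simpa using hne
    rcases ZpTKF.level_mono α hsub hSne (H1 σ hσ) (H2 σ hσ) with h | ⟨ha, hb, hc, hd⟩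
    · left; exact h
    · right
      refine Prod.ext ?_ ha.symm
      simp only [Φ]
      rw [← hb]
      have : ((ZpTKF.key α (SS τ)).card : ZMod p) ≠ 0 := by
        rw [Ne, ZMod.natCast_eq_zero_iff]
        exact fun h => absurd (Nat.le_of_dvd hc h) (by omega)
      rw [ZpTKF.sg, ZpTKF.sg, if_neg this, if_neg this]
  · intro σ hσ hne
    simp only [Φ, ZpTKF.level]
    split_ifs with h
    · have : ZpTKF.top (SS σ) < α := by
        rw [ZpTKF.top, Finset.sup_lt_iff (by change 0 < α; omega)]
        intro x hx
        by_contra hx'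
        have : x ∈ ZpTKF.hi α (SS σ) := by
          rw [ZpTKF.hi, Finset.mem_filter]; exact ⟨hx, by omega⟩
        rw [h] at this
        simp at this
      omega
    · have := hbound σ hσ
      have h' := ZpTKF.ell_pos (Finset.nonempty_iff_ne_empty.2 h)
      omega
end

section
/- (Z_p-Tucker–Ky Fan lemma, cardinality consequence) Let m, n, p, α be integers with m, n ≥ 1, m ≥ α ≥ 1, and p prime. Let λ : (Z_p ∪ {0})^n ∖ {0} → Z_p × [m], written λ(X) = (λ_1(X), λ_2(X)), be a Z_p-equivariant map satisfying: (1) for all X_1 ⊆ X_2 in (Z_p ∪ {0})^n ∖ {0}, if λ_2(X_1) = λ_2(X_2) ≤ α then λ_1(X_1) = λ_1(X_2); and (2) for every chain X_1 ⊆ X_2 ⊆ ⋯ ⊆ X_p in (Z_p ∪ {0})^n ∖ {0}, if λ_2(X_1) = λ_2(X_2) = ⋯ = λ_2(X_p) ≥ α + 1 then |{λ_1(X_1), …, λ_1(X_p)}| < p. Then n − α ≤ (p−1)(m−α). -/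
namespace ZpTKF

section basic
variable {R : Type*} [CommRing R] {A B : Type*}

/-- coboundary on functions of lists -/
def dl : (List A → R) → List A → R
  | _, [] => 0
  | F, (a :: l) => F l - dl (fun l' => F (a :: l')) l

theorem dl_sub (F G : List A → R) (l : List A) :
    dl (fun x => F x - G x) l = dl F l - dl G l := by
  induction l generalizing F G with
  | nil => simp [dl]
  | cons a l ih => simp only [dl, ih]; ring

theorem dl_sum {ι : Type*} (s : Finset ι) (F : ι → List A → R) (l : List A) :
    dl (fun x => ∑ i ∈ s, F i x) l = ∑ i ∈ s, dl (F i) l := by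
  induction l generalizing F with
  | nil => simp [dl]
  | cons a l ih => simp only [dl, ih, Finset.sum_sub_distrib]

/-- only sublists one shorter matter -/
theorem dl_congr' (F G : List A → R) (l : List A)
    (h : ∀ l', l'.Sublist l → l'.length + 1 = l.length → F l' = G l') : dl F l = dl G l := by
  induction l generalizing F G with
  | nil => simp [dl]
  | cons a l ih =>
    simp only [dl]
    rw [h l (List.sublist_cons_self a l) (by simp), ih (fun l' => F (a :: l')) (fun l' => G (a :: l'))]
    intro l' h1 h2
    exact h _ (h1.cons_cons a) (by simp [h2])

theorem dl_congr (k : ℕ) (F G : List A → R) (h : ∀ l, l.length = k → F l = G l)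
    (l : List A) (hl : l.length = k + 1) : dl F l = dl G l :=
  dl_congr' F G l (fun l' _ h2 => h l' (by omega))

theorem dl_zero (l : List A) : dl (fun _ => (0 : R)) l = 0 := by
  induction l with
  | nil => simp [dl]
  | cons a l ih => simp [dl, ih]

theorem dl_dl (F : List A → R) (l : List A) : dl (dl F) l = 0 := by
  induction l generalizing F with
  | nil => simp [dl]
  | cons a l ih =>
    have : (fun l' => dl F (a :: l')) = fun l' => F l' - dl (fun l'' => F (a :: l'')) l' := by
      funext l'; simp [dl]
    rw [dl, this, dl_sub, ih]; simp [dl]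

theorem dl_map (f : A → B) (F : List B → R) (l : List A) :
    dl (fun x => F (x.map f)) l = dl F (l.map f) := by
  induction l generalizing F with
  | nil => simp [dl]
  | cons a l ih =>
    simp only [dl, List.map_cons]
    rw [ih (fun l' => F (f a :: l'))]

/-- degenerate lists -/
theorem dl_deg (F : List A → R) (h : ∀ l, ¬ l.IsChain (· ≠ ·) → F l = 0) :
    ∀ l, ¬ l.IsChain (· ≠ ·) → dl F l = 0 := by
  intro l
  induction l generalizing F with
  | nil => simp
  | cons a l ih =>
    intro hl
    by_cases hc : l.IsChain (· ≠ ·)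
    · cases l with
      | nil => simp at hl
      | cons b l =>
        have hab : a = b := by
          by_contra hne
          exact hl (List.isChain_cons_cons.2 ⟨hne, hc⟩)
        subst hab
        have h0 : (fun l' => F (a :: a :: l')) = fun _ => (0 : R) := by
          funext l'
          exact h _ (by simp [List.isChain_cons_cons])
        simp only [dl]
        rw [h0, dl_zero]; ring
    · simp only [dl]
      rw [h l hc, ih (fun l' => F (a :: l'))]
      · ring
      · intro l' hl'
        apply h
        intro hh
        exact hl' hh.tail
      · exact hc

/-- subdivision (dual) -/
def sd (b : List A → B) : ℕ → (List B → R) → List A → R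
  | 0, F, _ => F []
  | k + 1, F, l => dl (sd b k (fun l' => F (b l :: l'))) l

theorem sd_sub (b : List A → B) (k : ℕ) (F G : List B → R) (l : List A) :
    sd b k (fun x => F x - G x) l = sd b k F l - sd b k G l := by
  induction k generalizing F G l with
  | zero => simp [sd]
  | succ k ih =>
    simp only [sd]
    rw [← dl_sub]
    congr 1
    funext x
    exact ih _ _ _

theorem sd_sum {ι : Type*} (s : Finset ι) (b : List A → B) (k : ℕ) (F : ι → List B → R)
    (l : List A) :
    sd b k (fun x => ∑ i ∈ s, F i x) l = ∑ i ∈ s, sd b k (F i) l := by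
  induction k generalizing F l with
  | zero => simp [sd]
  | succ k ih =>
    simp only [sd]
    rw [← dl_sum]
    congr 1
    funext x
    exact ih _ _

theorem sd_congr (b : List A → B) (k : ℕ) (F G : List B → R)
    (h : ∀ l, l.length = k → F l = G l) (l : List A) : sd b k F l = sd b k G l := by
  induction k generalizing F G l with
  | zero => simp [sd, h]
  | succ k ih =>
    simp only [sd]
    congr 1
    funext x
    exact ih _ _ (fun l' hl' => h _ (by simp [hl'])) _

theorem dl_sd (b : List A → B) (k : ℕ) (F : List B → R) (l : List A) (hl : l.length = k + 1) :
    sd b (k + 1) (dl F) l = dl (sd b k F) l := by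
  induction k generalizing F l with
  | zero =>
    simp only [sd]
    apply dl_congr 0 _ _ _ _ hl
    intro l' _
    simp [dl]
  | succ k ih =>
    rw [sd]
    have h1 : ∀ l', sd b (k + 1) (fun l' => dl F (b l :: l')) l' =
        sd b (k + 1) F l' - sd b (k + 1) (dl (fun x => F (b l :: x))) l' := by
      intro l'
      rw [← sd_sub]
      rfl
    rw [dl_congr (k + 1) _ (fun l' => sd b (k + 1) F l' - dl (sd b k (fun x => F (b l :: x))) l') _ l hl]
    · rw [dl_sub, dl_dl, sub_zero]
    · intro l' hl'
      rw [h1, ih _ _ hl']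

theorem sd_map (b : List A → B) (f : A → A) (g : B → B)
    (h : ∀ l, l ≠ [] → b (l.map f) = g (b l)) (k : ℕ) (F : List B → R) (l : List A)
    (hl : l.length = k) :
    sd b k (fun x => F (x.map g)) l = sd b k F (l.map f) := by
  induction k generalizing F l with
  | zero => simp [sd]
  | succ k ih =>
    simp only [sd]
    rw [← dl_map]
    apply dl_congr k _ _ _ _ hl
    intro l' hl'
    rw [h l (by rintro rfl; simp at hl), ← ih _ _ hl']
    rfl

theorem sd_supp (b : List A → B) (k : ℕ) (F : List B → R) (l : List A) (hl : l.length = k)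
    (h : ∀ L : List (List A), L.length = k → L.Pairwise (fun x y => y.Sublist x) →
      (∀ x ∈ L, x.Sublist l ∧ x ≠ []) → F (L.map b) = 0) : sd b k F l = 0 := by
  induction k generalizing F l with
  | zero => simpa [sd] using h [] (by simp) (by simp) (by simp)
  | succ k ih =>
    simp only [sd]
    rw [dl_congr' _ (fun _ => 0), dl_zero]
    intro l' h1 h2
    apply ih _ _ (by omega)
    intro L hL1 hL2 hL3
    apply h (l :: L) (by simp [hL1])
    · rw [List.pairwise_cons]
      exact ⟨fun x hx => (hL3 x hx).1.trans h1, hL2⟩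
    · intro x hx
      rcases List.mem_cons.1 hx with rfl | hx
      · exact ⟨List.Sublist.refl _, by rintro rfl; simp at hl⟩
      · exact ⟨(hL3 x hx).1.trans h1, (hL3 x hx).2⟩

end basic

section act
variable {p : ℕ} [Fact p.Prime] {A B : Type*}

/-- the operators of the minimal resolution -/
def D (act : ZMod p → A → A) : ℕ → (List A → ZMod p) → List A → ZMod p
  | 0, F, l => F l
  | k + 1, F, l => if Even k then F (l.map (act 1)) - F l else ∑ g, F (l.map (act g))

theorem D_congr (act : ZMod p → A → A) (k j : ℕ) (F G : List A → ZMod p)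
    (h : ∀ l, l.length = k → F l = G l) (l : List A) (hl : l.length = k) :
    D act j F l = D act j G l := by
  cases j with
  | zero => exact h l hl
  | succ j =>
    simp only [D]
    split_ifs
    · rw [h l hl, h _ (by simpa using hl)]
    · exact Finset.sum_congr rfl (fun g _ => h _ (by simpa using hl))

theorem D_sub (act : ZMod p → A → A) (j : ℕ) (F G : List A → ZMod p) (l : List A) :
    D act j (fun x => F x - G x) l = D act j F l - D act j G l := by
  cases j with
  | zero => rfl
  | succ j =>
    simp only [D]
    split_ifs
    · ring
    · simp

theorem D_dl (act : ZMod p → A → A) (j : ℕ) (F : List A → ZMod p) (l : List A) :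
    D act j (dl F) l = dl (D act j F) l := by
  cases j with
  | zero => rfl
  | succ j =>
    by_cases hj : Even j
    · have : D act (j+1) F = fun l => F (l.map (act 1)) - F l := by
        funext l; simp [D, hj]
      rw [this, dl_sub, dl_map]; simp [D, hj]
    · have : D act (j+1) F = fun l => ∑ g, F (l.map (act g)) := by
        funext l; simp [D, hj]
      rw [this, dl_sum]
      simp only [D, hj, if_false]
      exact Finset.sum_congr rfl (fun g _ => (dl_map _ _ _).symm)

theorem D_sd (actA : ZMod p → A → A) (actB : ZMod p → B → B) (b : List A → B)
    (hb : ∀ g l, l ≠ [] → b (l.map (actA g)) = actB g (b l)) (j k : ℕ) (F : List B → ZMod p)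
    (l : List A) (hl : l.length = k) :
    D actA j (sd b k F) l = sd b k (D actB j F) l := by
  cases j with
  | zero => rfl
  | succ j =>
    by_cases hj : Even j
    · have : D actB (j+1) F = fun l => F (l.map (actB 1)) - F l := by
        funext l; simp [D, hj]
      rw [this, sd_sub, sd_map b (actA 1) (actB 1) (hb 1) k F l hl]; simp [D, hj]
    · have : D actB (j+1) F = fun l => ∑ g, F (l.map (actB g)) := by
        funext l; simp [D, hj]
      rw [this, sd_sum]
      simp only [D, hj, if_false]
      exact Finset.sum_congr rfl (fun g _ => (sd_map b (actA g) (actB g) (hb g) k F l hl).symm)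

theorem D_D (act : ZMod p → A → A) (hact : ∀ g h a, act g (act h a) = act (g + h) a) (k : ℕ)
    (F : List A → ZMod p) (l : List A) :
    D act (k + 1) (D act (k + 2) F) l = 0 := by
  have hm : ∀ g h, (List.map (act g) (List.map (act h) l)) = l.map (act (g + h)) := by
    intro g h
    rw [List.map_map]
    congr 1
    funext a
    exact hact g h a
  by_cases hk : Even k
  · have hk' : ¬ Even (k + 1) := by simpa [Nat.even_add_one] using hk
    simp only [D, hk, hk', if_true, if_false, hm]
    rw [sub_eq_zero]
    exact Fintype.sum_equiv (Equiv.addRight 1) _ _ (fun x => by simp)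
  · have hk' : Even (k + 1) := by simpa [Nat.even_add_one] using hk
    simp only [D, hk, hk', if_true, if_false, hm, Finset.sum_sub_distrib]
    rw [sub_eq_zero]
    exact Fintype.sum_equiv (Equiv.addLeft 1) _ _ (fun x => by simp)

/-- the fundamental chains (dual) -/
def E (act : ZMod p → A → A) (apex : ℕ → A) : ℕ → (List A → ZMod p) → ZMod p
  | 0, F => F []
  | k + 1, F => E act apex k (D act k (fun l => F (apex k :: l)))

theorem E_sub (act : ZMod p → A → A) (apex : ℕ → A) (k : ℕ) (F G : List A → ZMod p) :
    E act apex k (fun x => F x - G x) = E act apex k F - E act apex k G := by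
  induction k generalizing F G with
  | zero => rfl
  | succ k ih =>
    simp only [E]
    rw [← ih]
    congr 1
    funext x
    exact D_sub _ _ _ _ _

theorem E_congr (act : ZMod p → A → A) (apex : ℕ → A) (k : ℕ) (F G : List A → ZMod p)
    (h : ∀ l, l.length = k → F l = G l) :
    E act apex k F = E act apex k G := by
  induction k generalizing F G with
  | zero => exact h [] rfl
  | succ k ih =>
    simp only [E]
    apply ih
    intro l hl
    apply D_congr act k _ _ _ _ l hl
    intro l' hl'
    exact h _ (by simp [hl'])

theorem E_zero (act : ZMod p → A → A) (apex : ℕ → A) (k : ℕ) :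
    E act apex k (fun _ => 0) = 0 := by
  have := E_sub act apex k (fun _ => 0) (fun _ => 0)
  simpa using this

theorem E_dl (act : ZMod p → A → A) (hact : ∀ g h a, act g (act h a) = act (g + h) a)
    (apex : ℕ → A) (k : ℕ) (F : List A → ZMod p) :
    E act apex (k + 1) (dl F) = E act apex k (D act k F) := by
  induction k generalizing F with
  | zero => simp [E, D, dl]
  | succ k ih =>
    rw [E]
    have h1 : D act (k+1) (fun l => dl F (apex (k+1) :: l)) =
        fun l => D act (k+1) F l - dl (D act (k+1) (fun x => F (apex (k+1) :: x))) l := by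
      funext l
      rw [← D_dl, ← D_sub]
      rfl
    rw [h1, E_sub, ih]
    rw [E_congr act apex k (D act k _) (fun _ => 0), E_zero, sub_zero]
    intro l hl
    cases k with
    | zero =>
      have : l = [] := List.length_eq_zero_iff.1 hl
      subst this
      simp [D]
    | succ k => exact D_D act hact _ _ _

/-- the cochains on lists of group elements -/
def V : ℕ → List (ZMod p) → ZMod p
  | 0, [] => 1
  | 0, _ :: _ => 0
  | _ + 1, [] => 0
  | k + 1, a :: l =>
    if Even k then ∑ j ∈ Finset.range a.val, dl (V k) ((a :: l).map (((j : ZMod p) - a) + ·))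
    else if a = 0 then dl (V k) (a :: l) else 0

theorem isChain_map_add (g : ZMod p) (l : List (ZMod p)) :
    (l.map (g + ·)).IsChain (· ≠ ·) ↔ l.IsChain (· ≠ ·) := by
  rw [List.isChain_map]; simp

theorem V_deg (k : ℕ) : ∀ l : List (ZMod p), ¬ l.IsChain (· ≠ ·) → dl (V k) l = 0 := by
  induction k with
  | zero =>
    apply dl_deg
    intro l hl
    cases l with
    | nil => simp at hl
    | cons a l => simp [V]
  | succ k ih =>
    apply dl_deg
    intro l hl
    cases l with
    | nil => simp at hl
    | cons a l =>
      simp only [V]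
      split_ifs
      · apply Finset.sum_eq_zero
        intro j _
        apply ih
        rwa [isChain_map_add]
      · exact ih _ hl
      · rfl

theorem sum_range_zmod (f : ZMod p → ZMod p) :
    ∑ j ∈ Finset.range p, f (j : ZMod p) = ∑ g, f g := by
  apply Finset.sum_nbij' (fun j : ℕ => (j : ZMod p)) (fun g : ZMod p => g.val)
  · simp
  · intro g _; simpa using ZMod.val_lt g
  · intro j hj
    exact ZMod.val_cast_of_lt (by simpa using hj)
  · intro g _; simp
  · simp

theorem odd_aux (W : List (ZMod p) → ZMod p) (a : ZMod p) (l : List (ZMod p))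
    (hN : ∑ g, W (l.map (g + ·)) = 0) :
    ∑ j ∈ Finset.range (1 + a).val, W ((l.map (1 + ·)).map (((j : ZMod p) - (1 + a)) + ·)) -
      ∑ j ∈ Finset.range a.val, W (l.map (((j : ZMod p) - a) + ·)) = W l := by
  have e1 : ∀ j : ZMod p, (l.map (1 + ·)).map ((j - (1 + a)) + ·) = l.map ((j - a) + ·) := by
    intro j
    rw [List.map_map]
    congr 1
    funext x
    simp only [Function.comp]
    ring
  simp only [e1]
  have e2 : W (l.map (((a.val : ZMod p) - a) + ·)) = W l := by simp
  rcases Nat.lt_or_ge (a.val + 1) p with h | h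
  · have : (1 + a).val = a.val + 1 := by
      have : Fact (1 < p) := ⟨(Fact.out : p.Prime).one_lt⟩
      rw [add_comm, ZMod.val_add_of_lt] <;> rw [ZMod.val_one]
      exact h
    rw [this, Finset.sum_range_succ, e2]; ring
  · have h' : a.val + 1 = p := le_antisymm (ZMod.val_lt a) h
    have h0 : 1 + a = 0 := by
      have : ((a.val + 1 : ℕ) : ZMod p) = 0 := by rw [h']; simp
      rw [← this]; simp [add_comm]
    have h3 : ∑ j ∈ Finset.range p, W (l.map (((j : ZMod p) - a) + ·)) = 0 := by
      rw [sum_range_zmod (fun j => W (l.map ((j - a) + ·))), ← hN]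
      exact Fintype.sum_equiv (Equiv.subRight a) _ _ (fun x => by simp)
    have h4 : ∑ j ∈ Finset.range (a.val + 1), W (l.map (((j : ZMod p) - a) + ·)) = 0 := by
      rw [h', h3]
    rw [Finset.sum_range_succ, e2] at h4
    rw [h0]
    simp only [ZMod.val_zero, Finset.range_zero, Finset.sum_empty]
    linear_combination -h4

theorem even_aux (W : List (ZMod p) → ZMod p) (l : List (ZMod p))
    (hN : ∀ l', l'.length = l.length → W (l'.map (1 + ·)) = W l') (g : ZMod p) :
    W (l.map (g + ·)) = W l := by
  have : ∀ j : ℕ, W (l.map ((j : ZMod p) + ·)) = W l := by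
    intro j
    induction j with
    | zero => simp
    | succ j ih =>
      rw [← ih, ← hN (l.map ((j : ZMod p) + ·)) (by simp), List.map_map]
      congr 2
      funext x
      simp only [Function.comp]
      push_cast
      ring
  simpa using this g.val

theorem D_V (k : ℕ) : ∀ l : List (ZMod p), l.length = k + 1 →
    D (fun g x => g + x) (k + 1) (V (k + 1)) l = dl (V k) l := by
  induction k with
  | zero =>
    intro l hl
    obtain ⟨a, rfl⟩ := List.length_eq_one_iff.1 hl
    simp only [D, List.map_cons, List.map_nil, V, dl]
    simp
  | succ k ih =>
    intro l hl
    have hN : ∀ l : List (ZMod p), l.length = k + 1 + 1 →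
        D (fun g x => g + x) (k + 1) (dl (V (k + 1))) l = 0 := by
      intro l hl
      rw [D_dl, dl_congr (k + 1) _ (dl (V k)) ih l hl, dl_dl]
    cases l with
    | nil => simp at hl
    | cons a l =>
    by_cases hk : Even k
    · have hk' : ¬ Even (k + 1) := by simpa [Nat.even_add_one] using hk
      simp only [D, hk, if_true] at hN
      simp only [D, hk', if_false, List.map_cons, V]
      have key := even_aux (dl (V (k + 1))) (a :: l) (fun l' hl' => by
        have := hN l' (hl'.trans hl)
        exact sub_eq_zero.1 this)
      simp only [List.map_cons] at key
      rw [Finset.sum_eq_single (-a)]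
      · rw [if_pos (by simp)]
        exact key (-a)
      · intro g _ hg
        rw [if_neg]
        intro h
        exact hg (eq_neg_of_add_eq_zero_left h)
      · simp
    · have hk' : Even (k + 1) := by simpa [Nat.even_add_one] using hk
      have := hN (a :: l) hl
      simp only [D, hk, if_false] at this
      have h2 := odd_aux (dl (V (k + 1))) a (a :: l) this
      simp only [D, hk', if_true, List.map_cons, V] at h2 ⊢
      exact h2

theorem main_one (actA : ZMod p → A → A) (hactA : ∀ g h a, actA g (actA h a) = actA (g + h) a)
    (actB : ZMod p → B → B) (apex : ℕ → A)
    (b1 : List A → B) (hb1 : ∀ g l, l ≠ [] → b1 (l.map (actA g)) = actB g (b1 l))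
    (b2 : List B → ZMod p) (hb2 : ∀ g l, l ≠ [] → b2 (l.map (actB g)) = g + b2 l) (k : ℕ) :
    E actA apex (k + 1) (sd b1 (k + 1) (sd b2 (k + 1) (dl (V k)))) = 1 := by
  have step : ∀ k (F : List (ZMod p) → ZMod p),
      E actA apex (k + 1) (sd b1 (k + 1) (sd b2 (k + 1) (dl F))) =
      E actA apex k (sd b1 k (sd b2 k (D (fun g x => g + x) k F))) := by
    intro k F
    rw [E_congr actA apex (k + 1) _ (dl (sd b1 k (sd b2 k F))), E_dl _ hactA]
    · apply E_congr
      intro l hl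
      rw [D_sd actA actB b1 hb1 _ _ _ _ hl]
      apply sd_congr
      intro l' hl'
      exact D_sd actB _ b2 hb2 _ _ _ _ hl'
    · intro l hl
      rw [← dl_sd _ _ _ _ hl]
      apply sd_congr
      intro l' hl'
      exact dl_sd _ _ _ _ hl'
  induction k with
  | zero => rw [step]; simp [E, sd, D, V]
  | succ k ih =>
    rw [step, ← ih]
    apply E_congr
    intro l hl
    apply sd_congr
    intro l' hl'
    apply sd_congr
    intro l'' hl''
    exact D_V k l'' hl''

/-- section of a partially free action -/
theorem exists_sec {S : Type*} (act : ZMod p → S → S) (h0 : ∀ x, act 0 x = x)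
    (hact : ∀ g h a, act g (act h a) = act (g + h) a) :
    ∃ s : S → ZMod p, ∀ x, (∀ g, act g x = x → g = 0) → ∀ g, s (act g x) = g + s x := by
  let st : Setoid S :=
    { r := fun x y => ∃ g, act g x = y
      iseqv := ⟨fun x => ⟨0, h0 x⟩, fun {x y} ⟨g, hg⟩ => ⟨-g, by rw [← hg, hact]; simp [h0]⟩,
        fun {x y z} ⟨g, hg⟩ ⟨h, hh⟩ => ⟨h + g, by rw [← hact, hg, hh]⟩⟩ }
  have hex : ∀ x, ∃ g, act g (Quotient.out (Quotient.mk st x)) = x := fun x => Quotient.mk_out x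
  choose s hs using hex
  refine ⟨s, fun x hx g => ?_⟩
  have hq : Quotient.mk st (act g x) = Quotient.mk st x := (Quotient.sound ⟨g, rfl⟩ : Quotient.mk st x = _).symm
  have h1 := hs (act g x)
  rw [hq] at h1
  have h2 := hs x
  generalize Quotient.out (Quotient.mk st x) = r at h1 h2
  have h3 : act (- s x) x = r := by
    have : ∀ c, act c r = x → act (-c) x = r := by
      rintro c rfl; simp [hact, h0]
    exact this _ h2
  have h4 : act (s (act g x) - s x - g) x = x := by
    have : act (-g) (act (s (act g x)) (act (- s x) x)) = x := by
      rw [h3, h1, hact]; simp [h0]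
    rw [hact, hact] at this
    convert this using 2
    ring
  have := hx _ h4
  linear_combination this

theorem E_supp {n : ℕ} [NeZero n] (k : ℕ) (hk : k ≤ n) (F : List (Fin n × ZMod p) → ZMod p)
    (h : ∀ l : List (Fin n × ZMod p), l.map (fun a => a.1.val) = (List.range k).reverse → F l = 0) :
    E (fun g (a : Fin n × ZMod p) => (a.1, g + a.2)) (fun k => (Fin.ofNat n k, 0)) k F = 0 := by
  induction k generalizing F with
  | zero => exact h [] (by simp)
  | succ k ih =>
    simp only [E]
    apply ih (by omega)
    intro l hl
    have key : ∀ g : ZMod p, F ((Fin.ofNat n k, 0) :: l.map (fun a => (a.1, g + a.2))) = 0 := by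
      intro g
      apply h
      rw [List.range_succ, List.reverse_append, ← hl]
      simp [Function.comp_def, Nat.mod_eq_of_lt (show k < n by omega)]
    have key0 : F ((Fin.ofNat n k, 0) :: l) = 0 := by simpa using key 0
    cases k with
    | zero => exact key0
    | succ k =>
      simp only [D]
      split_ifs
      · rw [key, key0]; simp
      · exact Finset.sum_eq_zero (fun g _ => key g)

end act

theorem chain_comb {A : Type*} {R S T : A → A → Prop} (l : List A) (h1 : l.IsChain R)
    (h2 : l.Pairwise S) (h : ∀ x ∈ l, ∀ y ∈ l, R x y → S x y → T x y) : l.IsChain T := by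
  induction l with
  | nil => simp
  | cons a l ih =>
    cases l with
    | nil => simp
    | cons b l =>
      rw [List.isChain_cons_cons] at h1 ⊢
      rw [List.pairwise_cons] at h2
      exact ⟨h a (by simp) b (by simp) h1.1 (h2.1 b (by simp)),
        ih h1.2 h2.2 (fun x hx y hy => h x (List.mem_cons_of_mem _ hx) y (List.mem_cons_of_mem _ hy))⟩

end ZpTKF
/-- **Z_p-Tucker–Ky Fan lemma, cardinality consequence:** `n − α ≤ (p−1)(m−α)`.
`λ = (lam1, lam2) : (Z_p ∪ {0})^n ∖ {0} → Z_p × [m]` is a `Z_p`-equivariant map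
(the value `j ∈ [m] = {1, …, m}` is modelled by the element of `Fin m` with
`val = j - 1`, so "`λ₂(X) ≤ α`" reads `(lam2 X : ℕ) + 1 ≤ α`). -/
theorem zp_tucker_ky_fan_card (m n p α : ℕ) (hm : 1 ≤ m) (hn : 1 ≤ n)
    (hα1 : 1 ≤ α) (hαm : α ≤ m) (hp : p.Prime)
    (lam1 : (Fin n → Option (ZMod p)) → ZMod p)
    (lam2 : (Fin n → Option (ZMod p)) → Fin m)
    (hequiv : ∀ X : Fin n → Option (ZMod p), (∃ i, X i ≠ none) → ∀ ε : ZMod p,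
      lam1 (fun i => (X i).map fun δ => ε + δ) = ε + lam1 X ∧
      lam2 (fun i => (X i).map fun δ => ε + δ) = lam2 X)
    (h1 : ∀ X Y : Fin n → Option (ZMod p), (∃ i, X i ≠ none) → (∃ i, Y i ≠ none) →
      PSub X Y → lam2 X = lam2 Y → (lam2 X : ℕ) + 1 ≤ α → lam1 X = lam1 Y)
    (h2 : ∀ Z : Fin p → (Fin n → Option (ZMod p)),
      (∀ k, ∃ i, Z k i ≠ none) →
      (∀ k l, k ≤ l → PSub (Z k) (Z l)) →
      (∀ k l, lam2 (Z k) = lam2 (Z l)) →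
      (∀ k, α + 1 ≤ (lam2 (Z k) : ℕ) + 1) →
      (Finset.univ.image fun k => lam1 (Z k)).card < p) :
    n - α ≤ (p - 1) * (m - α) := by
  by_contra hcon
  have hlt : α + (p - 1) * (m - α) < n := by omega
  haveI : Fact p.Prime := ⟨hp⟩
  haveI : NeZero n := ⟨by omega⟩
  classical
  -- types
  let P := {X : Fin n → Option (ZMod p) // ∃ i, X i ≠ none}
  let actA : ZMod p → Fin n × ZMod p → Fin n × ZMod p := fun g a => (a.1, g + a.2)
  let actB : ZMod p → P → P := fun g X => ⟨fun i => (X.1 i).map (fun δ => g + δ), by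
    obtain ⟨i, hi⟩ := X.2
    exact ⟨i, by simpa using hi⟩⟩
  let actS : ZMod p → Finset (ZMod p × Fin m) → Finset (ZMod p × Fin m) :=
    fun g σ => σ.image (fun a => (g + a.1, a.2))
  obtain ⟨s, hs⟩ := ZpTKF.exists_sec actS (by intro x; simp [actS])
    (by intro g h x; simp [actS, Finset.image_image, Function.comp_def, add_assoc])
  let f : List (Fin n × ZMod p) → Fin n → Option (ZMod p) :=
    fun l i => (l.find? (fun a => a.1 = i)).map Prod.snd
  let dflt : P := ⟨fun _ => some 0, ⟨⟨0, hn⟩, by simp⟩⟩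
  let b1 : List (Fin n × ZMod p) → P := fun l => if h : ∃ i, f l i ≠ none then ⟨f l, h⟩ else dflt
  have hf : ∀ l, l ≠ [] → ∃ i, f l i ≠ none := by
    intro l hl
    cases l with
    | nil => exact absurd rfl hl
    | cons a l => exact ⟨a.1, by simp [f]⟩
  have hb1v : ∀ l, l ≠ [] → (b1 l).1 = f l := by
    intro l hl
    simp only [b1, dif_pos (hf l hl)]
  have hb1 : ∀ g l, l ≠ [] → b1 (l.map (actA g)) = actB g (b1 l) := by
    intro g l hl
    apply Subtype.ext
    rw [hb1v _ (by simpa using hl)]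
    simp only [actB, hb1v l hl]
    funext i
    simp only [f, List.find?_map, Option.map_map]
    rfl
  let lamP : P → ZMod p × Fin m := fun X => (lam1 X.1, lam2 X.1)
  have hlamP : ∀ g X, lamP (actB g X) = (g + (lamP X).1, (lamP X).2) := by
    intro g X
    have := hequiv X.1 X.2 g
    exact Prod.ext this.1 this.2
  let σ : List P → Finset (ZMod p × Fin m) := fun l => (l.map lamP).toFinset
  have hσ : ∀ g l, σ (l.map (actB g)) = actS g (σ l) := by
    intro g l
    ext x
    simp [σ, actS, hlamP]
  let Fr : Finset (ZMod p × Fin m) → Prop := fun τ => ∀ g, actS g τ = τ → g = 0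
  have hFr : ∀ g τ, Fr (actS g τ) ↔ Fr τ := by
    have hcomm : ∀ g h τ, actS g (actS h τ) = actS h (actS g τ) := by
      intro g h x; simp [actS, Finset.image_image, Function.comp_def, add_left_comm]
    have hinj : ∀ g, Function.Injective (actS g) := by
      intro g
      apply Finset.image_injective
      rintro ⟨a, b⟩ ⟨c, d⟩ h
      simpa using h
    intro g τ
    constructor
    · intro h c hc
      exact h c (by rw [hcomm, hc])
    · intro h c hc
      rw [hcomm] at hc
      exact h c (hinj g hc)
  let hd : List P → ZMod p := fun l => match l with
    | [] => 0
    | X :: _ => (lamP X).1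
  let b2 : List P → ZMod p := fun l => if Fr (σ l) then s (σ l) else hd l
  have hb2 : ∀ g l, l ≠ [] → b2 (l.map (actB g)) = g + b2 l := by
    intro g l hl
    simp only [b2, hσ, hFr]
    split_ifs with h
    · exact hs _ h g
    · cases l with
      | nil => exact absurd rfl hl
      | cons a l => simp [hd, hlamP]
  obtain ⟨k, rfl⟩ : ∃ k, n = k + 1 := ⟨n - 1, by omega⟩
  have hone := ZpTKF.main_one actA (by intro g h a; simp [actA, add_assoc]) actB
    (fun k' => (Fin.ofNat (k + 1) k', 0)) b1 hb1 b2 hb2 k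
  have hzero := ZpTKF.E_supp (p := p) (n := k + 1) (k + 1) le_rfl
    (ZpTKF.sd b1 (k + 1) (ZpTKF.sd b2 (k + 1) (ZpTKF.V k |> ZpTKF.dl))) ?_
  · have : (1 : ZMod p) = 0 := hone.symm.trans hzero
    exact one_ne_zero this
  intro l hl
  have hlen : l.length = k + 1 := by simpa using congrArg List.length hl
  have hnod : (l.map (fun a => a.1.val)).Nodup := by
    rw [hl]; simpa using List.nodup_range
  apply ZpTKF.sd_supp _ _ _ _ hlen
  intro L hL1 hL2 hL3
  -- the list of signed vectors is a decreasing chain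
  have hch : (L.map b1).Pairwise (fun X Y => PSub Y.1 X.1) := by
    rw [List.pairwise_map]
    apply hL2.imp_of_mem
    intro x y hx hy hxy
    rw [hb1v x (hL3 x hx).2, hb1v y (hL3 y hy).2]
    intro i hi
    simp only [f] at hi ⊢
    cases hy' : y.find? (fun a => a.1 = i) with
    | none => simp [hy'] at hi
    | some a =>
      have ha := List.mem_of_find?_eq_some hy'
      have ha1 : a.1 = i := by simpa using List.find?_some hy'
      cases hx' : x.find? (fun a => a.1 = i) with
      | none =>
        exact absurd ha1 (by simpa using List.find?_eq_none.1 hx' a (hxy.subset ha))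
      | some c =>
        have hc := List.mem_of_find?_eq_some hx'
        have hc1 : c.1 = i := by simpa using List.find?_some hx'
        have : c = a := List.inj_on_of_nodup_map hnod ((hL3 x hx).1.subset hc)
          ((hL3 y hy).1.subset ha) (by simp [ha1, hc1])
        simp [this]
  have hM : (L.map b1).length = k + 1 := by simpa using hL1
  generalize L.map b1 = M at hch hM
  apply ZpTKF.sd_supp _ _ _ _ hM
  intro L' hL1' hL2' hL3'
  apply ZpTKF.V_deg
  intro hchain
  -- simplices of K
  have hK1 : ∀ x ∈ L', ∀ a ∈ σ x, ∀ c ∈ σ x, a.2 = c.2 → (a.2 : ℕ) + 1 ≤ α → a = c := by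
    intro x hx a ha c hc hac hα
    have hxp := hch.sublist (hL3' x hx).1
    simp only [σ, List.mem_toFinset, List.mem_map] at ha hc
    obtain ⟨X, hX, rfl⟩ := ha
    obtain ⟨Y, hY, rfl⟩ := hc
    have hcmp : PSub Y.1 X.1 ∨ PSub X.1 Y.1 := by
      obtain ⟨i, rfl⟩ := List.mem_iff_get.1 hX
      obtain ⟨i', rfl⟩ := List.mem_iff_get.1 hY
      rcases lt_trichotomy i i' with h | h | h
      · exact Or.inl (List.pairwise_iff_get.1 hxp _ _ h)
      · subst h
        exact Or.inl (fun _ _ => rfl)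
      · exact Or.inr (List.pairwise_iff_get.1 hxp _ _ h)
    have hac' : lam2 X.1 = lam2 Y.1 := hac
    rcases hcmp with h | h
    · exact Prod.ext (h1 Y.1 X.1 Y.2 X.2 h hac'.symm (by rw [← hac']; exact hα)).symm hac
    · exact Prod.ext (h1 X.1 Y.1 X.2 Y.2 h hac' hα) hac
  have hK2 : ∀ x ∈ L', ∀ j : Fin m, α + 1 ≤ (j : ℕ) + 1 → ¬ ∀ g, (g, j) ∈ σ x := by
    intro x hx j hj hall
    have hxp := hch.sublist (hL3' x hx).1
    simp only [σ, List.mem_toFinset, List.mem_map] at hall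
    have h3 : ∀ g, ∃ i : Fin x.length, lamP (x.get i) = (g, j) := by
      intro g
      obtain ⟨X, hX, h⟩ := hall g
      obtain ⟨i, rfl⟩ := List.mem_iff_get.1 hX
      exact ⟨i, h⟩
    choose idx hidx using h3
    have hinj : Function.Injective idx := by
      intro g h hgh
      have h1 := hidx g
      rw [hgh, hidx h] at h1
      exact (congrArg Prod.fst h1).symm
    have hcard : (Finset.univ.image idx).card = p := by
      rw [Finset.card_image_of_injective _ hinj, Finset.card_univ, ZMod.card]
    let e := (Finset.univ.image idx).orderEmbOfFin hcard
    have he : ∀ k', ∃ g, idx g = e k' := by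
      intro k'
      have := Finset.orderEmbOfFin_mem (Finset.univ.image idx) hcard k'
      obtain ⟨g, _, hg⟩ := Finset.mem_image.1 this
      exact ⟨g, hg⟩
    have h2' := h2 (fun k' => (x.get (e k'.rev)).1) (fun k' => (x.get (e k'.rev)).2) ?_ ?_ ?_
    · have : (Finset.univ.image fun k' : Fin p => lam1 (x.get (e k'.rev)).1) = Finset.univ := by
        rw [Finset.eq_univ_iff_forall]
        intro g
        have hm : idx g ∈ Set.range e := by
          rw [Finset.range_orderEmbOfFin]; simp
        obtain ⟨k', hk'⟩ := hm
        rw [Finset.mem_image]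
        refine ⟨k'.rev, Finset.mem_univ _, ?_⟩
        rw [Fin.rev_rev, hk']
        exact congrArg Prod.fst (hidx g)
      rw [this, Finset.card_univ, ZMod.card] at h2'
      exact lt_irrefl _ h2'
    · intro a c hac
      rcases hac.eq_or_lt with rfl | hac
      · intro i _; rfl
      · have : e c.rev < e a.rev := e.strictMono (Fin.rev_lt_rev.2 hac)
        exact List.pairwise_iff_get.1 hxp _ _ this
    · intro a c
      obtain ⟨g, hg⟩ := he a.rev
      obtain ⟨g', hg'⟩ := he c.rev
      simp only [← hg, ← hg']
      exact (congrArg Prod.snd (hidx g)).trans (congrArg Prod.snd (hidx g')).symm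
    · intro a
      obtain ⟨g, hg⟩ := he a.rev
      simp only [← hg]
      have : lam2 (x.get (idx g)).1 = j := congrArg Prod.snd (hidx g)
      rw [this]
      exact hj
  have hp2 := hp.two_le
  have hfib : ∀ x ∈ L', ∀ j : Fin m, ((σ x).filter (fun a => a.2 = j)).card ≤
      if (j : ℕ) < α then 1 else p - 1 := by
    intro x hx j
    split_ifs with hj
    · rw [Finset.card_le_one]
      intro a ha c hc
      rw [Finset.mem_filter] at ha hc
      exact hK1 x hx a ha.1 c hc.1 (ha.2.trans hc.2.symm) (by rw [ha.2]; omega)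
    · have hn2 := hK2 x hx j (by omega)
      push Not at hn2
      obtain ⟨g, hg⟩ := hn2
      have : ((σ x).filter (fun a => a.2 = j)).card ≤ (Finset.univ.erase g).card := by
        apply Finset.card_le_card_of_injOn Prod.fst
        · intro a ha
          have ha := Finset.mem_filter.1 ha
          simp only [Finset.coe_erase, Finset.coe_univ, Set.mem_sdiff, Set.mem_univ, true_and,
            Set.mem_singleton_iff]
          rintro rfl
          apply hg
          rw [← ha.2]
          exact ha.1
        · intro a ha c hc hac
          have ha := Finset.mem_filter.1 ha
          have hc := Finset.mem_filter.1 hc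
          exact Prod.ext hac (ha.2.trans hc.2.symm)
      simpa [Finset.card_erase_of_mem, ZMod.card] using this
  have hcardK : ∀ x ∈ L', (σ x).card ≤ k := by
    intro x hx
    have h4 : (σ x).card = ∑ j : Fin m, ((σ x).filter (fun a => a.2 = j)).card :=
      Finset.card_eq_sum_card_fiberwise (fun a _ => Finset.mem_coe.2 (Finset.mem_univ _))
    have h5 : (σ x).card ≤ ∑ j : Fin m, if (j : ℕ) < α then 1 else p - 1 := by
      rw [h4]; exact Finset.sum_le_sum (fun j _ => hfib x hx j)
    have h6 : (∑ j : Fin m, if (j : ℕ) < α then 1 else p - 1) = α + (p - 1) * (m - α) := by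
      rw [Fin.sum_univ_eq_sum_range (fun j => if j < α then 1 else p - 1) m]
      obtain ⟨d, rfl⟩ := Nat.exists_eq_add_of_le hαm
      rw [Finset.sum_range_add]
      rw [Finset.sum_congr rfl (g := fun _ => 1) (by intro i hi; simp at hi; simp [hi])]
      simp [mul_comm]
    omega
  have hfree : ∀ x ∈ L', Fr (σ x) := by
    intro x hx g hg
    by_contra hg0
    obtain ⟨X, hX⟩ := List.exists_mem_of_ne_nil _ (hL3' x hx).2
    have hX' : lamP X ∈ σ x := by
      simp only [σ, List.mem_toFinset, List.mem_map]; exact ⟨X, hX, rfl⟩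
    have hiter : ∀ t : ℕ, ((t : ZMod p) * g + (lamP X).1, (lamP X).2) ∈ σ x := by
      intro t
      induction t with
      | zero => simpa using hX'
      | succ t ih =>
        rw [← hg]
        simp only [actS, Finset.mem_image]
        exact ⟨_, ih, by simp; ring⟩
    have hall : ∀ c, (c, (lamP X).2) ∈ σ x := by
      intro c
      have := hiter ((c - (lamP X).1) / g).val
      simpa [hg0] using this
    have h7 := hfib x hx (lamP X).2
    have h8 : p ≤ ((σ x).filter (fun a => a.2 = (lamP X).2)).card := by
      have : (Finset.univ : Finset (ZMod p)).card ≤ ((σ x).filter (fun a => a.2 = (lamP X).2)).card := by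
        apply Finset.card_le_card_of_injOn (fun c => (c, (lamP X).2))
        · intro c _
          simp only [Finset.coe_filter, Set.mem_ofPred_eq, and_true]
          exact hall c
        · intro a _ c _ h
          exact congrArg Prod.fst h
      simpa [ZMod.card] using this
    split_ifs at h7 <;> omega
  -- strictly decreasing cardinalities
  rw [List.isChain_map] at hchain
  have hcc : L'.IsChain (fun x y => (σ y).card < (σ x).card) := by
    apply ZpTKF.chain_comb _ hchain hL2'
    intro x hx y hy hne hxy
    have hss : σ y ⊆ σ x := by
      intro a ha
      simp only [σ, List.mem_toFinset, List.mem_map] at ha ⊢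
      obtain ⟨X, hX, rfl⟩ := ha
      exact ⟨X, hxy.subset hX, rfl⟩
    apply Finset.card_lt_card
    refine Finset.ssubset_iff_subset_ne.2 ⟨hss, fun heq => hne ?_⟩
    simp only [b2, if_pos (hfree x hx), if_pos (hfree y hy), heq]
  have hpw : (L'.map (fun x => (σ x).card)).Pairwise (fun a c => c < a) := by
    rw [← List.isChain_iff_pairwise, List.isChain_map]
    exact hcc
  have hnd : (L'.map (fun x => (σ x).card)).Nodup := hpw.imp (fun h => (ne_of_lt h).symm)
  have hsub : (L'.map (fun x => (σ x).card)).toFinset ⊆ Finset.Icc 1 k := by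
    intro c hc
    simp only [List.mem_toFinset, List.mem_map] at hc
    obtain ⟨x, hx, rfl⟩ := hc
    rw [Finset.mem_Icc]
    refine ⟨?_, hcardK x hx⟩
    obtain ⟨X, hX⟩ := List.exists_mem_of_ne_nil _ (hL3' x hx).2
    apply Finset.card_pos.2
    exact ⟨lamP X, by simp only [σ, List.mem_toFinset, List.mem_map]; exact ⟨X, hX, rfl⟩⟩
  have := Finset.card_le_card hsub
  rw [List.toFinset_card_of_nodup hnd] at this
  simp [hL1'] at this
end

section
/- Let r ≥ 2 be an integer and p ≥ r a prime. Let H be an r-uniform hypergraph with clique number ω(H) ≥ p, and let c : V(H) → [C] be a proper coloring of H (C arbitrary). Then there exist pairwise disjoint subsets U_1, …, U_p of V(H) spanning a complete r-uniform p-partite subhypergraph of H that is balanced and colorful with respect to c, and with |U_1| + ⋯ + |U_p| = Xind_{Z_p}(Hom(K^r_p, H)) + p. -/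
/-- The pairwise disjoint sets `U 0, …, U (p-1)` span a complete `r`-uniform `p`-partite
subhypergraph of the hypergraph with edge set `Eh`: every `r`-subset of `⋃ i, U i`
meeting each `U i` in at most one vertex is an edge. -/
def SpansComplete {W : Type*} [DecidableEq W] (Eh : Set (Finset W)) (r : ℕ) {p : ℕ}
    (U : ZMod p → Finset W) : Prop :=
  ∀ T : Finset W, T.card = r → (∀ v ∈ T, ∃ i, v ∈ U i) →
    (∀ i, (T ∩ U i).card ≤ 1) → T ∈ Eh

/-- Elements of the `Z_p`-hom-complex `Hom(K^r_p, H)`: `p`-tuples of nonempty pairwise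
disjoint vertex subsets spanning a complete `r`-uniform `p`-partite subhypergraph. -/
def HomElem {W : Type*} [DecidableEq W] (Eh : Set (Finset W)) (r p : ℕ)
    (U : ZMod p → Finset W) : Prop :=
  (∀ i, (U i).Nonempty) ∧ (∀ i j, i ≠ j → Disjoint (U i) (U j)) ∧
    SpansComplete Eh r U

/-- The cross-index `Xind_{Z_p}(Hom(K^r_p, H))`: the least `n` such that there is an
order-preserving `Z_p`-map from `Hom(K^r_p, H)` (ordered by componentwise inclusion,
with `Z_p` acting by cyclic shift) to `Q_{n,p}` (ground set `Z_p × [n+1]`, where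
`(ε, i) ≤ (ε', j)` iff `i < j` or `(ε, i) = (ε', j)`, and `ε·(ε', j) = (ε + ε', j)`). -/
noncomputable def XindHom {W : Type*} [DecidableEq W] (Eh : Set (Finset W)) (r p : ℕ) : ℕ :=
  sInf {n | ∃ φ : (ZMod p → Finset W) → ZMod p × Fin (n + 1),
    (∀ x y, HomElem Eh r p x → HomElem Eh r p y → (∀ i, x i ⊆ y i) →
      ((φ x).2 < (φ y).2 ∨ φ x = φ y)) ∧
    (∀ (ε : ZMod p) (x), HomElem Eh r p x →
      φ (fun i => x (i + ε)) = (ε + (φ x).1, (φ x).2))}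

theorem sgn_exists (p : ℕ) (hp : p.Prime) (α : Type*) :
    ∃ s : (ZMod p → α) → ZMod p, ∀ f : ZMod p → α, (∃ i j, f i ≠ f j) →
      ∀ ε, s (fun i => f (i + ε)) = ε + s f := by
  classical
  haveI : Fact p.Prime := ⟨hp⟩
  let S : Setoid (ZMod p → α) :=
    { r := fun f g => ∃ ε : ZMod p, f = fun i => g (i + ε)
      iseqv := by
        refine ⟨fun f => ⟨0, by simp⟩, ?_, ?_⟩
        · rintro f g ⟨ε, rfl⟩
          exact ⟨-ε, by simp⟩
        · rintro f g h ⟨ε, rfl⟩ ⟨δ, rfl⟩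
          exact ⟨ε + δ, by funext i; simp [add_assoc]⟩ }
  let rep : (ZMod p → α) → (ZMod p → α) := fun f => (Quotient.mk S f).out
  have hrep : ∀ f, ∃ ε : ZMod p, f = fun i => rep f (i + ε) := fun f =>
    S.symm (Quotient.exact (s := S) (Quotient.out_eq (Quotient.mk S f)))
  choose s hs using hrep
  refine ⟨s, fun f hf ε => ?_⟩
  have hre : rep (fun i => f (i + ε)) = rep f := by
    have : Quotient.mk S (fun i => f (i + ε)) = Quotient.mk S f := Quotient.sound ⟨ε, rfl⟩
    simp only [rep, this]
  have h1 := hs (fun i => f (i + ε))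
  rw [hre] at h1
  have h2 := hs f
  by_contra hne
  set a := s (fun i => f (i + ε)) with ha
  set b := s f with hb
  have h3 : ∀ i, rep f (i + (ε + b)) = rep f (i + a) := by
    intro i
    have e1 := congrFun h1 i
    have e2 := congrFun h2 (i + ε)
    rw [← e1, e2, add_assoc]
  have hper : Function.Periodic (rep f) (a - (ε + b)) := by
    intro i
    have := h3 (i - (ε + b))
    rw [sub_add_cancel] at this
    rw [this]; congr 1; ring
  have hd : a - (ε + b) ≠ 0 := sub_ne_zero.mpr hne
  have hconst : ∀ j, rep f j = rep f 0 := by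
    intro j
    have := (hper.nsmul (j * (a - (ε + b))⁻¹).val) 0
    rw [← this]; congr 1
    simp [hd]
  obtain ⟨i, j, hij⟩ := hf
  apply hij
  rw [congrFun h2 i, congrFun h2 j, hconst, hconst (j + b)]

section aux
variable {p : ℕ} [NeZero p]

/-- minimum of a cardinality profile -/
def mn (a : ZMod p → ℕ) : ℕ := Finset.univ.inf' Finset.univ_nonempty a

/-- indices above the minimum -/
def big (a : ZMod p → ℕ) : Finset (ZMod p) := Finset.univ.filter (fun i => mn a < a i)

/-- size of the largest balanced part -/
def ell (a : ZMod p → ℕ) : ℕ := p * mn a + (big a).card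

theorem mn_le (a : ZMod p → ℕ) (i) : mn a ≤ a i := Finset.inf'_le _ (Finset.mem_univ i)

theorem mn_attained (a : ZMod p → ℕ) : ∃ i, a i = mn a := by
  obtain ⟨i, _, h⟩ := Finset.exists_mem_eq_inf' (Finset.univ_nonempty (α := ZMod p)) a
  exact ⟨i, h.symm⟩

theorem mn_shift (a : ZMod p → ℕ) (ε) : mn (fun i => a (i + ε)) = mn a := by
  apply le_antisymm
  · obtain ⟨i, hi⟩ := mn_attained a
    have := mn_le (fun i => a (i + ε)) (i - ε)
    simp only [sub_add_cancel] at this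
    omega
  · obtain ⟨i, hi⟩ := mn_attained (fun i => a (i + ε))
    rw [← hi]; exact mn_le a _

theorem ell_shift (a : ZMod p → ℕ) (ε) : ell (fun i => a (i + ε)) = ell a := by
  unfold ell
  rw [mn_shift]
  congr 1
  apply Finset.card_bij (fun i _ => i + ε)
  · intro i hi; simpa [big, mn_shift] using hi
  · intro i _ j _ h; simpa using h
  · intro j hj
    exact ⟨j - ε, by simpa [big, mn_shift] using hj, by simp⟩

theorem big_lt (a : ZMod p → ℕ) : (big a).card < p := by
  obtain ⟨i, hi⟩ := mn_attained a
  have : (big a).card < (Finset.univ : Finset (ZMod p)).card := by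
    apply Finset.card_lt_card
    refine ⟨Finset.subset_univ _, fun h => ?_⟩
    have := h (Finset.mem_univ i)
    simp [big, hi] at this
  simpa [ZMod.card] using this

theorem ell_mono (a b : ZMod p → ℕ) (h : ∀ i, a i ≤ b i) :
    ell a < ell b ∨ (ell a = ell b ∧ mn a = mn b ∧ big a = big b) := by
  have hm : mn a ≤ mn b := by
    obtain ⟨i, hi⟩ := mn_attained b
    rw [← hi]; exact (mn_le a i).trans (h i)
  rcases hm.lt_or_eq with hm | hm
  · left
    have := big_lt a
    unfold ell
    have : p * (mn a + 1) ≤ p * mn b := Nat.mul_le_mul_left _ hm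
    rw [mul_add] at this
    omega
  · have hs : big a ⊆ big b := by
      intro i hi
      simp only [big, Finset.mem_filter, Finset.mem_univ, true_and] at hi ⊢
      have := h i
      omega
    rcases (Finset.card_le_card hs).lt_or_eq with hc | hc
    · left; unfold ell; rw [hm]; omega
    · right
      refine ⟨by unfold ell; rw [hm, hc], hm, Finset.eq_of_subset_of_card_le hs hc.ge⟩

theorem exists_sizes (a : ZMod p → ℕ) (N : ℕ) (hN : N ≤ ell a) :
    ∃ d : ZMod p → ℕ, (∀ i, d i ≤ a i) ∧ (∀ i j, d i ≤ d j + 1) ∧ ∑ i, d i = N := by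
  have hp : 0 < p := Nat.pos_of_ne_zero (NeZero.ne p)
  have hdiv := Nat.div_add_mod N p
  have hmod := Nat.mod_lt N hp
  have hbig := big_lt a
  have hq : N / p ≤ mn a := by
    by_contra hcon
    have : p * (mn a + 1) ≤ p * (N / p) := Nat.mul_le_mul_left _ (by omega)
    rw [mul_add] at this
    unfold ell at hN
    omega
  have ht : N % p ≤ (Finset.univ.filter (fun i => N / p < a i)).card := by
    rcases hq.lt_or_eq with h | h
    · have : (Finset.univ.filter (fun i => N / p < a i)) = Finset.univ := by
        ext i; have := mn_le a i; simp; omega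
      rw [this, Finset.card_univ, ZMod.card]; omega
    · have : (Finset.univ.filter (fun i => N / p < a i)) = big a := by rw [h]; rfl
      rw [this]; unfold ell at hN; rw [← h] at hN; omega
  obtain ⟨I, hI, hIc⟩ := Finset.exists_subset_card_eq ht
  refine ⟨fun i => N / p + if i ∈ I then 1 else 0, ?_, ?_, ?_⟩
  · intro i
    have := mn_le a i
    by_cases hi : i ∈ I
    · have := hI hi
      simp at this
      simp [hi]; omega
    · simp [hi]; omega
  · intro i j
    dsimp only
    split_ifs <;> omega
  · rw [Finset.sum_add_distrib]
    simp [ZMod.card, hIc]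
    omega

end aux

/-- **Theorem 2(ii):** any properly colored `r`-uniform hypergraph `H` with `ω(H) ≥ p`
contains a colorful balanced complete `r`-uniform `p`-partite subhypergraph with
`Xind_{Z_p}(Hom(K^r_p, H)) + p` vertices. -/
theorem colorful_balanced_complete_subhypergraph {W : Type*} [Fintype W] [DecidableEq W]
    (r p : ℕ) [NeZero p] (hr : 2 ≤ r) (hp : p.Prime) (hrp : r ≤ p)
    (Eh : Set (Finset W)) (hunif : ∀ e ∈ Eh, e.card = r)
    (hclique : ∃ S : Finset W, S.card = p ∧ ∀ T ⊆ S, T.card = r → T ∈ Eh)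
    (C : ℕ) (c : W → Fin C)
    (hc : ∀ e ∈ Eh, ∃ u ∈ e, ∃ v ∈ e, c u ≠ c v) :
    ∃ U : ZMod p → Finset W,
      (∀ i j, i ≠ j → Disjoint (U i) (U j)) ∧
      SpansComplete Eh r U ∧
      (∀ i j, (U i).card ≤ (U j).card + 1) ∧
      (∀ i, Set.InjOn c ↑(U i)) ∧
      (∑ i, (U i).card) = XindHom Eh r p + p := by
  classical
  set A : (ZMod p → Finset W) → ZMod p → Finset (Fin C) := fun x i => (x i).image c with hA
  set a : (ZMod p → Finset W) → ZMod p → ℕ := fun x i => (A x i).card with ha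
  have hpos : ∀ x, HomElem Eh r p x → ∀ i, 0 < a x i := by
    intro x hx i
    exact Finset.card_pos.mpr ((hx.1 i).image c)
  have hnc : ∀ x, HomElem Eh r p x → ∃ i j, A x i ≠ A x j := by
    intro x hx
    by_contra! hcon
    obtain ⟨col, hcol⟩ := (hx.1 0).image c
    have : ∀ i, ∃ u ∈ x i, c u = col := by
      intro i
      have : col ∈ A x i := by rw [hcon i 0]; exact hcol
      simpa [hA] using this
    choose u hu huc using this
    have hinj : Function.Injective u := by
      intro i j hij
      by_contra hne
      exact Finset.disjoint_left.mp (hx.2.1 i j hne) (hu i) (hij ▸ hu j)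
    obtain ⟨R, hRc⟩ : ∃ R : Finset (ZMod p), R.card = r := by
      have : r ≤ (Finset.univ : Finset (ZMod p)).card := by
        rwa [Finset.card_univ, ZMod.card]
      obtain ⟨R, _, h⟩ := Finset.exists_subset_card_eq this
      exact ⟨R, h⟩
    have hE : R.image u ∈ Eh := by
      apply hx.2.2
      · rw [Finset.card_image_of_injective _ hinj, hRc]
      · intro v hv
        obtain ⟨i, _, rfl⟩ := Finset.mem_image.mp hv
        exact ⟨i, hu i⟩
      · intro i
        rw [Finset.card_le_one]
        have key : ∀ v ∈ R.image u ∩ x i, v = u i := by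
          intro v hv
          obtain ⟨h1, h2⟩ := Finset.mem_inter.mp hv
          obtain ⟨j, _, rfl⟩ := Finset.mem_image.mp h1
          by_cases hji : j = i
          · rw [hji]
          · exact absurd h2 (Finset.disjoint_left.mp (hx.2.1 j i hji) (hu j))
        intro v hv w hw
        rw [key v hv, key w hw]
    obtain ⟨v, hv, w, hw, hne⟩ := hc _ hE
    obtain ⟨i, _, rfl⟩ := Finset.mem_image.mp hv
    obtain ⟨j, _, rfl⟩ := Finset.mem_image.mp hw
    exact hne ((huc i).trans (huc j).symm)
  -- some element has a large balanced colorful part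
  have hx : ∃ x, HomElem Eh r p x ∧ XindHom Eh r p + p ≤ ell (a x) := by
    rcases hn : XindHom Eh r p with _ | k
    · obtain ⟨S, hS, hST⟩ := hclique
      have e : ZMod p ≃ S := Fintype.equivOfCardEq (by simp [ZMod.card, hS])
      have hx : HomElem Eh r p (fun i => {(e i : W)}) := by
        refine ⟨fun i => Finset.singleton_nonempty _, ?_, ?_⟩
        · intro i j hij
          rw [Finset.disjoint_singleton]
          intro h
          exact hij (e.injective (Subtype.ext h))
        · intro T hT hTU _
          refine hST T (fun v hv => ?_) hT
          obtain ⟨i, hi⟩ := hTU v hv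
          rw [Finset.mem_singleton] at hi
          rw [hi]; exact (e i).2
      refine ⟨_, hx, ?_⟩
      obtain ⟨i, hi⟩ := mn_attained (a (fun i => {(e i : W)}))
      have h1 := hpos _ hx i
      rw [hi] at h1
      have : p * 1 ≤ p * mn (a (fun i => {(e i : W)})) := Nat.mul_le_mul_left _ h1
      unfold ell
      omega
    · by_contra! hcon
      have hlow : ∀ x, HomElem Eh r p x → p ≤ ell (a x) := by
        intro x hx
        obtain ⟨i, hi⟩ := mn_attained (a x)
        have h1 := hpos _ hx i
        rw [hi] at h1
        have : p * 1 ≤ p * mn (a x) := Nat.mul_le_mul_left _ h1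
        unfold ell
        omega
      obtain ⟨s1, hs1⟩ := sgn_exists p hp (Finset (Fin C))
      obtain ⟨s2, hs2⟩ := sgn_exists p hp Prop
      have hmem : k ∈ {n | ∃ φ : (ZMod p → Finset W) → ZMod p × Fin (n + 1),
          (∀ x y, HomElem Eh r p x → HomElem Eh r p y → (∀ i, x i ⊆ y i) →
            ((φ x).2 < (φ y).2 ∨ φ x = φ y)) ∧
          (∀ (ε : ZMod p) (x), HomElem Eh r p x →
            φ (fun i => x (i + ε)) = (ε + (φ x).1, (φ x).2))} := by
        refine ⟨fun x => (if big (a x) = ∅ then s1 (A x) else s2 (fun i => mn (a x) < a x i),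
          ⟨min (ell (a x) - p) k, by omega⟩), ?_, ?_⟩
        · intro x y hx hy hxy
          have hAs : ∀ i, A x i ⊆ A y i := fun i => Finset.image_subset_image (hxy i)
          have b1 := hlow x hx
          have b2 := hlow y hy
          have b3 := hcon x hx
          have b4 := hcon y hy
          rcases ell_mono (a x) (a y) (fun i => Finset.card_le_card (hAs i)) with h | ⟨h1, h2, h3⟩
          · left
            rw [Fin.lt_def]
            simp only
            omega
          · right
            by_cases hb : big (a x) = ∅
            · have hb' : big (a y) = ∅ := h3 ▸ hb
              have hAA : A x = A y := by
                funext i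
                apply Finset.eq_of_subset_of_card_le (hAs i)
                have g1 : i ∉ big (a y) := by simp [hb']
                simp only [big, Finset.mem_filter, Finset.mem_univ, true_and] at g1
                have g2 := mn_le (a x) i
                change a y i ≤ a x i
                omega
              simp only [hb, hb', hAA, h1, if_true]
            · have hb' : big (a y) ≠ ∅ := h3 ▸ hb
              have hff : (fun i => mn (a x) < a x i) = (fun i => mn (a y) < a y i) := by
                funext i
                have : i ∈ big (a x) ↔ i ∈ big (a y) := by rw [h3]
                simpa [big] using this
              simp only [hb, hb', hff, h1, if_false]
        · intro ε x hx
          have e0 : A (fun i => x (i + ε)) = fun i => A x (i + ε) := rfl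
          have e1 : a (fun i => x (i + ε)) = fun i => a x (i + ε) := rfl
          have e2 : big (fun i => a x (i + ε)) = ∅ ↔ big (a x) = ∅ := by
            simp only [big, mn_shift, Finset.filter_eq_empty_iff, Finset.mem_univ, true_imp_iff]
            constructor
            · intro h i
              have := @h (i - ε)
              simpa using this
            · intro h i
              exact @h (i + ε)
          simp only [e0, e1, ell_shift, e2, mn_shift]
          by_cases hb : big (a x) = ∅
          · simp only [hb, if_true]
            rw [hs1 _ (hnc x hx)]
          · simp only [hb, if_false]
            rw [hs2 (fun i => mn (a x) < a x i)]
            obtain ⟨i, hi⟩ := Finset.nonempty_iff_ne_empty.mpr hb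
            obtain ⟨j, hj⟩ := mn_attained (a x)
            refine ⟨i, j, fun h => ?_⟩
            simp only [big, Finset.mem_filter, Finset.mem_univ, true_and] at hi
            have : mn (a x) < a x j := h ▸ hi
            omega
      have := Nat.sInf_le hmem
      change XindHom Eh r p ≤ k at this
      omega
  obtain ⟨x, hx, hxl⟩ := hx
  obtain ⟨d, hd1, hd2, hd3⟩ := exists_sizes (a x) _ hxl
  have hU : ∀ i, ∃ V : Finset W, V ⊆ x i ∧ V.card = d i ∧ Set.InjOn c ↑V := by
    intro i
    obtain ⟨B, hB, hBc⟩ := Finset.exists_subset_card_eq (hd1 i)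
    have : ∀ b : B, ∃ v ∈ x i, c v = b := by
      intro b
      simpa [hA] using hB b.2
    choose g hg hgc using this
    have hginj : Function.Injective g := by
      intro b b' h
      apply Subtype.ext
      rw [← hgc b, ← hgc b', h]
    refine ⟨Finset.univ.image g, ?_, ?_, ?_⟩
    · intro v hv
      obtain ⟨b, _, rfl⟩ := Finset.mem_image.mp hv
      exact hg b
    · rw [Finset.card_image_of_injective _ hginj]; simp [hBc]
    · intro v hv w hw h
      obtain ⟨b, _, rfl⟩ := Finset.mem_image.mp (Finset.mem_coe.mp hv)
      obtain ⟨b', _, rfl⟩ := Finset.mem_image.mp (Finset.mem_coe.mp hw)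
      rw [hgc, hgc] at h
      rw [Subtype.ext h]
  choose U hUx hUc hUi using hU
  refine ⟨U, ?_, ?_, ?_, hUi, ?_⟩
  · intro i j hij
    exact (hx.2.1 i j hij).mono (hUx i) (hUx j)
  · intro T hT hTU hT1
    refine hx.2.2 T hT (fun v hv => ?_) (fun i => ?_)
    · obtain ⟨i, hi⟩ := hTU v hv
      exact ⟨i, hUx i hi⟩
    · refine le_trans (Finset.card_le_card ?_) (hT1 i)
      intro v hv
      obtain ⟨h1, h2⟩ := Finset.mem_inter.mp hv
      obtain ⟨j, hj⟩ := hTU v h1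
      by_cases hji : j = i
      · exact Finset.mem_inter.mpr ⟨h1, hji ▸ hj⟩
      · exact absurd h2 (Finset.disjoint_left.mp (hx.2.1 j i hji) (hUx j hj))
  · intro i j
    rw [hUc, hUc]; exact hd2 i j
  · simp only [hUc]; exact hd3
end

section
/- Let r ≥ 2 be an integer and p ≥ r a prime. If H is an r-uniform hypergraph with clique number ω(H) ≥ p and with finite chromatic number, then χ(H) ≥ (Xind_{Z_p}(Hom(K^r_p, H)) + p) / (r − 1). -/
/-- The chromatic number of a hypergraph: the least `C` admitting a proper coloring
with colors in `[C]`. -/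
noncomputable def chrHyp {W : Type*} (Eh : Set (Finset W)) : ℕ :=
  sInf {C | ∃ c : W → Fin C, ∀ e ∈ Eh, ∃ u ∈ e, ∃ v ∈ e, c u ≠ c v}

theorem aux_const {p : ℕ} [Fact p.Prime] {β : Type*} (A : ZMod p → β) (ε : ZMod p)
    (hε : ε ≠ 0) (h : ∀ i, A (i + ε) = A i) (j : ZMod p) : A j = A 0 := by
  have h1 : ∀ n : ℕ, A ((n : ZMod p) * ε) = A 0 := by
    intro n
    induction n with
    | zero => simp
    | succ k ih =>
      rw [← ih, ← h ((k : ZMod p) * ε)]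
      congr 1
      push_cast
      ring
  have h2 := h1 (j / ε).val
  rw [ZMod.natCast_zmod_val, div_mul_cancel₀ _ hε] at h2
  exact h2

theorem aux_sign (p : ℕ) [Fact p.Prime] (β : Type*) :
    ∃ g : (ZMod p → β) → ZMod p, ∀ A : ZMod p → β, (¬ ∀ j, A j = A 0) →
      ∀ ε, g (fun i => A (i + ε)) = ε + g A := by
  classical
  let S : Setoid (ZMod p → β) :=
    { r := fun A B => ∃ ε, ∀ i, A i = B (i + ε)
      iseqv := by
        refine ⟨fun A => ⟨0, by simp⟩, ?_, ?_⟩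
        · rintro A B ⟨ε, h⟩
          exact ⟨-ε, fun i => by rw [h]; simp⟩
        · rintro A B D ⟨ε, h⟩ ⟨δ, h'⟩
          exact ⟨ε + δ, fun i => by rw [h, h', add_assoc]⟩ }
  let rep : (ZMod p → β) → (ZMod p → β) := fun A => (Quotient.mk S A).out
  have hrep : ∀ A, ∃ ε, ∀ i, A i = rep A (i + ε) := fun A =>
    S.symm (Quotient.mk_out (s := S) A)
  choose g hg using hrep
  refine ⟨g, fun A hA ε => ?_⟩
  have hr : rep (fun i => A (i + ε)) = rep A := by
    have : Quotient.mk S (fun i => A (i + ε)) = Quotient.mk S A :=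
      Quotient.sound (s := S) ⟨ε, fun i => rfl⟩
    simp only [rep, this]
  have h1 := hg (fun i => A (i + ε))
  rw [hr] at h1
  have h2 := hg A
  by_contra hne
  apply hA
  refine aux_const A (g (fun i => A (i + ε)) - (ε + g A)) (sub_ne_zero.2 hne) ?_
  intro i
  have h3 := h1 (i - (ε + g A) + g A)
  have h4 : A i = rep A (i + g A) := h2 i
  have e1 : i - (ε + g A) + g A + ε = i := by ring
  simp only [e1] at h3
  rw [h2, h3]
  congr 1
  ring

theorem aux_color {W : Type*} [DecidableEq W] {r p C : ℕ} [Fact p.Prime] (hr : 2 ≤ r)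
    (Eh : Set (Finset W)) (c : W → Fin C)
    (hc : ∀ e ∈ Eh, ∃ u ∈ e, ∃ v ∈ e, c u ≠ c v)
    (U : ZMod p → Finset W) (hU : HomElem Eh r p U) (k : Fin C) :
    (Finset.univ.filter (fun i => k ∈ (U i).image c)).card ≤ r - 1 := by
  by_contra hlt
  have hle : r ≤ (Finset.univ.filter (fun i => k ∈ (U i).image c)).card := by omega
  obtain ⟨I, hI, hIc⟩ := Finset.exists_subset_card_eq hle
  have hI' : ∀ i ∈ I, ∃ v, v ∈ U i ∧ c v = k := by
    intro i hi
    have := (Finset.mem_filter.1 (hI hi)).2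
    simpa using this
  have hv : ∀ i, ∃ v, v ∈ U i ∧ (i ∈ I → c v = k) := by
    intro i
    by_cases hi : i ∈ I
    · obtain ⟨v, h1, h2⟩ := hI' i hi
      exact ⟨v, h1, fun _ => h2⟩
    · obtain ⟨v, h1⟩ := hU.1 i
      exact ⟨v, h1, fun h => absurd h hi⟩
  choose f hf hfk using hv
  have huniq : ∀ i j, f i ∈ U j → i = j := by
    intro i j h
    by_contra hne
    exact (Finset.disjoint_left.1 (hU.2.1 i j hne)) (hf i) h
  have hinj : Function.Injective f := fun i j h => huniq i j (h ▸ hf j)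
  have hE : I.image f ∈ Eh := by
    apply hU.2.2
    · rw [Finset.card_image_of_injective _ hinj, hIc]
    · intro v hv
      obtain ⟨i, _, rfl⟩ := Finset.mem_image.1 hv
      exact ⟨i, hf i⟩
    · intro i
      rw [Finset.card_le_one]
      intro a ha b hb
      obtain ⟨ha, ha'⟩ := Finset.mem_inter.1 ha
      obtain ⟨hb, hb'⟩ := Finset.mem_inter.1 hb
      obtain ⟨x, _, rfl⟩ := Finset.mem_image.1 ha
      obtain ⟨y, _, rfl⟩ := Finset.mem_image.1 hb
      rw [huniq _ _ ha', huniq _ _ hb']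
  obtain ⟨u, hu, v, hv, hne⟩ := hc _ hE
  obtain ⟨x, hx, rfl⟩ := Finset.mem_image.1 hu
  obtain ⟨y, hy, rfl⟩ := Finset.mem_image.1 hv
  exact hne (by rw [hfk x hx, hfk y hy])

theorem chromatic_ge_xind {W : Type*} [Fintype W] [DecidableEq W]
    (r p : ℕ) (hr : 2 ≤ r) (hp : p.Prime) (hrp : r ≤ p)
    (Eh : Set (Finset W)) (hunif : ∀ e ∈ Eh, e.card = r)
    (hclique : ∃ S : Finset W, S.card = p ∧ ∀ T ⊆ S, T.card = r → T ∈ Eh)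
    (hfin : ∃ C, ∃ c : W → Fin C, ∀ e ∈ Eh, ∃ u ∈ e, ∃ v ∈ e, c u ≠ c v) :
    XindHom Eh r p + p ≤ (r - 1) * chrHyp Eh := by
  haveI : Fact p.Prime := ⟨hp⟩
  obtain ⟨c, hc⟩ : ∃ c : W → Fin (chrHyp Eh), ∀ e ∈ Eh, ∃ u ∈ e, ∃ v ∈ e, c u ≠ c v :=
    Nat.sInf_mem (s := {C | ∃ c : W → Fin C, ∀ e ∈ Eh, ∃ u ∈ e, ∃ v ∈ e, c u ≠ c v}) hfin
  generalize chrHyp Eh = C at c hc ⊢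
  let A : (ZMod p → Finset W) → ZMod p → Finset (Fin C) := fun U i => (U i).image c
  have hlow : ∀ U, HomElem Eh r p U → p ≤ ∑ i, (A U i).card := by
    intro U hU
    calc p = ∑ i : ZMod p, 1 := by simp [ZMod.card]
      _ ≤ _ := Finset.sum_le_sum fun i _ => Finset.card_pos.2 ((hU.1 i).image c)
  have hup : ∀ U, HomElem Eh r p U → ∑ i, (A U i).card ≤ (r - 1) * C := by
    intro U hU
    have h1 : ∑ i, (A U i).card =
        ∑ k : Fin C, (Finset.univ.filter (fun i => k ∈ A U i)).card := by
      have := Finset.sum_card_bipartiteAbove_eq_sum_card_bipartiteBelow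
        (s := (Finset.univ : Finset (ZMod p))) (t := (Finset.univ : Finset (Fin C)))
        (fun i k => k ∈ A U i)
      simpa [Finset.bipartiteAbove, Finset.bipartiteBelow] using this
    rw [h1]
    calc _ ≤ ∑ k : Fin C, (r - 1) :=
          Finset.sum_le_sum fun k _ => aux_color hr Eh c hc U hU k
      _ = _ := by simp [mul_comm]
  have hnc : ∀ U, HomElem Eh r p U → ¬ ∀ j, A U j = A U 0 := by
    intro U hU h
    obtain ⟨v, hv⟩ := hU.1 0
    have h2 := aux_color hr Eh c hc U hU (c v)
    have h3 : (Finset.univ.filter (fun i => c v ∈ (U i).image c)) = Finset.univ := by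
      apply Finset.filter_true_of_mem
      intro i _
      have h4 : (U i).image c = (U 0).image c := h i
      rw [h4]
      exact Finset.mem_image_of_mem c hv
    rw [h3, Finset.card_univ, ZMod.card] at h2
    omega
  -- existence
  have hex : ∃ U, HomElem Eh r p U := by
    obtain ⟨S, hS, hST⟩ := hclique
    have e : ZMod p ≃ S := Fintype.equivOfCardEq (by simp [ZMod.card, hS])
    refine ⟨fun i => {(e i : W)}, fun i => Finset.singleton_nonempty _, ?_, ?_⟩
    · intro i j hij
      simp only [Finset.disjoint_singleton]
      intro h
      exact hij (e.injective (Subtype.ext h))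
    · intro T hT hTU _
      refine hST T ?_ hT
      intro v hv
      obtain ⟨i, hi⟩ := hTU v hv
      rw [Finset.mem_singleton.1 hi]
      exact (e i).2
  obtain ⟨U₀, hU₀⟩ := hex
  have hpC : p ≤ (r - 1) * C := (hlow U₀ hU₀).trans (hup U₀ hU₀)
  obtain ⟨g, hg⟩ := aux_sign p (Finset (Fin C))
  suffices h : XindHom Eh r p ≤ (r - 1) * C - p by omega
  apply Nat.sInf_le
  refine ⟨fun U => (g (A U), ⟨min (∑ i, (A U i).card - p) ((r - 1) * C - p), by omega⟩), ?_, ?_⟩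
  · intro x y hx hy hxy
    have hsub : ∀ i, A x i ⊆ A y i := fun i => Finset.image_subset_image (hxy i)
    by_cases heq : A x = A y
    · right
      simp only [heq]
    · left
      have hlt : ∑ i, (A x i).card < ∑ i, (A y i).card := by
        obtain ⟨i, hi⟩ := Function.ne_iff.1 heq
        exact Finset.sum_lt_sum (fun i _ => Finset.card_le_card (hsub i))
          ⟨i, Finset.mem_univ _, Finset.card_lt_card ((hsub i).ssubset_of_ne hi)⟩
      have := hlow x hx
      have := hup y hy
      rw [Fin.lt_def]
      simp only
      omega
  · intro ε x hx
    have h1 := hg (A x) (hnc x hx) ε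
    have h2 : ∑ i, (A x (i + ε)).card = ∑ i, (A x i).card :=
      Equiv.sum_comp (Equiv.addRight ε) (fun i => (A x i).card)
    have h3 : A (fun i => x (i + ε)) = fun i => A x (i + ε) := rfl
    simp only [h3, h1, h2]
end

section
/- Let F be a hypergraph with n vertices and let p be a prime number. Then for any proper coloring c : V(KG^p(F)) → [C] (C arbitrary) of the Kneser hypergraph KG^p(F), there exist pairwise disjoint subsets U_1, …, U_p of V(KG^p(F)) (i.e., pairwise disjoint collections of edges of F) such that: (a) |U_1| + ⋯ + |U_p| = n − alt_p(F); (b) ||U_i| − |U_j|| ≤ 1 for all i, j ∈ [p]; (c) whenever one edge of F is chosen from each U_i, the p chosen edges of F are pairwise vertex-disjoint (so they form an edge of KG^p(F)); and (d) within each U_i the vertices receive pairwise distinct colors under c. -/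
/-- `X` has an alternating subsequence of length `m`: nonzero entries at increasing
positions with consecutive values distinct (zero is `none`, `ε ∈ Z_p` is `some ε`). -/
def HasAltSeq {n p : ℕ} (X : Fin n → Option (ZMod p)) (m : ℕ) : Prop :=
  ∃ s : Fin m → Fin n, StrictMono s ∧ (∀ j, X (s j) ≠ none) ∧
    ∀ (j : ℕ) (h : j + 1 < m), X (s ⟨j, by omega⟩) ≠ X (s ⟨j + 1, h⟩)

/-- `alt(X)`: the maximum length of an alternating subsequence of `X`. -/
noncomputable def altVec {n p : ℕ} (X : Fin n → Option (ZMod p)) : ℕ :=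
  sSup {m | HasAltSeq X m}

/-- `alt_p(F, σ)` for a hypergraph `F` with edge set `E` and a bijection
`σ : [n] → V(F)`: the maximum of `alt(X)` over vectors `X` such that for every
`ε ∈ Z_p` the set `σ(X^ε)` contains no edge of `F`. -/
noncomputable def altSigma {V : Type*} {n : ℕ} (E : Set (Finset V)) (p : ℕ)
    (σ : Fin n ≃ V) : ℕ :=
  sSup {a | ∃ X : Fin n → Option (ZMod p), a = altVec X ∧
    ∀ ε : ZMod p, ∀ e ∈ E, ¬ ((e : Set V) ⊆ σ '' {i | X i = some ε})}

/-- `alt_p(F)`: the minimum of `alt_p(F, σ)` over all bijections `σ`. -/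
noncomputable def altHyp {V : Type*} [Fintype V] (E : Set (Finset V)) (p : ℕ) : ℕ :=
  sInf {a | ∃ σ : Fin (Fintype.card V) ≃ V, a = altSigma E p σ}

/-- Edges of the Kneser hypergraph `KG^r(F)`: sets of `r` pairwise vertex-disjoint
edges of `F`. -/
def KGEdges {V : Type*} (E : Set (Finset V)) (r : ℕ) :
    Set (Finset {e : Finset V // e ∈ E}) :=
  {S | S.card = r ∧ ∀ e ∈ S, ∀ f ∈ S, e ≠ f → Disjoint e.1 f.1}

namespace ZpT

/-- coboundary on lists -/
def dl {P R : Type*} [CommRing R] : (List P → R) → List P → R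
  | _, [] => 0
  | f, x :: l => f l - dl (fun m => f (x :: m)) l

def Hl {P R : Type*} [CommRing R] (T : P → P) : (List P → R) → List P → R
  | _, [] => 0
  | f, x :: l => f (x :: T x :: l.map T) - Hl T (fun m => f (x :: m)) l

def Kl {P R : Type*} [CommRing R] (T : P → P) (e : P) (f : List P → R) (l : List P) : R :=
  f (e :: l.map T) - Hl T f l

section
variable {P Q R : Type*} [CommRing R]

theorem dl_sub (f g : List P → R) (l : List P) :
    dl (fun m => f m - g m) l = dl f l - dl g l := by
  induction l generalizing f g with
  | nil => simp [dl]
  | cons x l ih => simp only [dl, ih]; ring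

theorem dl_sum {ι : Type*} (S : Finset ι) (f : ι → List P → R) (l : List P) :
    dl (fun m => ∑ t ∈ S, f t m) l = ∑ t ∈ S, dl (f t) l := by
  induction l generalizing f with
  | nil => simp [dl]
  | cons x l ih => simp only [dl, ih]; rw [Finset.sum_sub_distrib]

theorem dl_mul (a : R) (f : List P → R) (l : List P) :
    dl (fun m => a * f m) l = a * dl f l := by
  induction l generalizing f with
  | nil => simp [dl]
  | cons x l ih => simp only [dl, ih]; ring

theorem dl_map (T : P → Q) (f : List Q → R) (l : List P) :
    dl (fun m => f (m.map T)) l = dl f (l.map T) := by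
  induction l generalizing f with
  | nil => simp [dl]
  | cons x l ih => simp only [dl, List.map_cons]; rw [ih (fun m => f (T x :: m))]

theorem Hl_sub (T : P → P) (f g : List P → R) (l : List P) :
    Hl T (fun m => f m - g m) l = Hl T f l - Hl T g l := by
  induction l generalizing f g with
  | nil => simp [Hl]
  | cons x l ih => simp only [Hl, ih]; ring

theorem H_homotopy (T : P → P) (f : List P → R) (l : List P) :
    Hl T (dl f) l + dl (Hl T f) l = f (l.map T) - f l := by
  induction l generalizing f with
  | nil => simp [Hl, dl]
  | cons x l ih =>
    have h1 := ih (fun m => f (x :: m))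
    simp only [Hl, dl, List.map_cons]
    rw [Hl_sub, dl_sub, dl_map T (fun m => f (x :: T x :: m))]
    change _ + _ = _ at h1
    have h2 : Hl T f l = Hl T (fun m => f m) l := rfl
    have h3 : Hl T (dl fun m => f (x :: m)) l = Hl T (fun m => dl (fun m => f (x :: m)) m) l := rfl
    have h4 : dl (Hl T fun m => f (x :: m)) l = dl (fun m => Hl T (fun m => f (x :: m)) m) l := rfl
    rw [h3, h4] at h1
    linear_combination h1

theorem K_homotopy (T : P → P) (e : P) (f : List P → R) (l : List P) :
    Kl T e (dl f) l = f l - dl (Kl T e f) l := by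
  have h := H_homotopy T f l
  have h5 : dl (Kl T e f) l = dl (fun m => f (e :: m.map T) - Hl T f m) l := rfl
  rw [h5, dl_sub, dl_map T (fun m => f (e :: m))]
  have h6 : dl (fun m => Hl T f m) l = dl (Hl T f) l := rfl
  rw [h6]
  simp only [Kl, dl]
  linear_combination -h

end

/-- vectors -/
abbrev Vc (p : ℕ) := ℕ → Option (ZMod p)

def rot {ι : Type*} {p : ℕ} (t : ZMod p) (x : ι → Option (ZMod p)) : ι → Option (ZMod p) :=
  fun i => (x i).map (fun g => g + t)

def vle {ι : Type*} {p : ℕ} (x y : ι → Option (ZMod p)) : Prop :=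
  ∀ i, x i ≠ none → y i = x i

def vnz {ι : Type*} {p : ℕ} (x : ι → Option (ZMod p)) : Prop := ∃ i, x i ≠ none

theorem vnz_rot {ι : Type*} {p : ℕ} (t : ZMod p) (x : ι → Option (ZMod p)) (h : vnz x) :
    vnz (rot t x) := by
  obtain ⟨i, hi⟩ := h
  exact ⟨i, by simpa [rot] using hi⟩

theorem vle_rot {ι : Type*} {p : ℕ} (t : ZMod p) (x y : ι → Option (ZMod p)) (h : vle x y) :
    vle (rot t x) (rot t y) := by
  intro i hi
  have : x i ≠ none := by simpa [rot] using hi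
  simp [rot, h i this]

def Tk {p : ℕ} (k : ℕ) (x : Vc p) : Vc p := Function.update x k (some 0)
def ek {p : ℕ} (k : ℕ) : Vc p := Function.update (fun _ => none) k (some 0)

def opA {p : ℕ} [NeZero p] (n : ℕ) (f : List (Vc p) → ZMod p) : List (Vc p) → ZMod p :=
  if n = 0 then f else
  if n % 2 = 1 then fun l => f (l.map (rot 1)) - f l else fun l => ∑ t : ZMod p, f (l.map (rot t))

def Ev {p : ℕ} [NeZero p] : ℕ → (List (Vc p) → ZMod p) → ZMod p
  | 0, f => f []
  | n + 1, f => Ev n (opA n (Kl (Tk n) (ek n) f))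

structure Good {p : ℕ} (n : ℕ) (l : List (Vc p)) : Prop where
  nz : ∀ x ∈ l, vnz x
  sup : ∀ x ∈ l, ∀ i, n ≤ i → x i = none
  ch : l.Pairwise vle

theorem good_rot {p : ℕ} (n : ℕ) (l : List (Vc p)) (t : ZMod p) (h : Good n l) :
    Good n (l.map (rot t)) := by
  refine ⟨?_, ?_, ?_⟩
  · simp only [List.mem_map]
    rintro _ ⟨x, hx, rfl⟩
    exact vnz_rot t x (h.nz x hx)
  · simp only [List.mem_map]
    rintro _ ⟨x, hx, rfl⟩ i hi
    simp [rot, h.sup x hx i hi]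
  · rw [List.pairwise_map]
    exact h.ch.imp (fun {a b} hab => vle_rot t a b hab)

theorem vle_T {p n : ℕ} {x : Vc p} (h : ∀ i, n ≤ i → x i = none) : vle x (Tk n x) := by
  intro i hi
  have : i ≠ n := by rintro rfl; exact hi (h _ le_rfl)
  simp [Tk, this]

theorem vle_trans {ι : Type*} {p : ℕ} {x y z : ι → Option (ZMod p)} (h : vle x y) (h' : vle y z) :
    vle x z := by
  intro i hi
  rw [h' i (by rw [h i hi]; exact hi), h i hi]

theorem vle_TT {p n : ℕ} {x y : Vc p} (h : vle x y) : vle (Tk n x) (Tk n y) := by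
  intro i hi
  by_cases hin : i = n
  · subst hin; simp [Tk]
  · simp only [Tk, Function.update_of_ne hin] at hi ⊢
    exact h i hi

theorem good_T {p n : ℕ} {l : List (Vc p)} (h : Good n l) : Good (n+1) (l.map (Tk n)) := by
  refine ⟨?_, ?_, ?_⟩
  · simp only [List.mem_map]
    rintro _ ⟨x, hx, rfl⟩
    exact ⟨n, by simp [Tk]⟩
  · simp only [List.mem_map]
    rintro _ ⟨x, hx, rfl⟩ i hi
    have : i ≠ n := by omega
    simp [Tk, this, h.sup x hx i (by omega)]
  · rw [List.pairwise_map]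
    exact h.ch.imp (fun {a b} hab => vle_TT hab)

theorem good_eT {p n : ℕ} {l : List (Vc p)} (h : Good n l) :
    Good (n+1) (ek n :: l.map (Tk n)) := by
  have h' := good_T h
  refine ⟨?_, ?_, ?_⟩
  · intro x hx
    rcases List.mem_cons.1 hx with rfl | hx
    · exact ⟨n, by simp [ek]⟩
    · exact h'.nz x hx
  · intro x hx
    rcases List.mem_cons.1 hx with rfl | hx
    · intro i hi
      have : i ≠ n := by omega
      simp [ek, this]
    · exact h'.sup x hx
  · refine List.pairwise_cons.2 ⟨?_, h'.ch⟩
    simp only [List.mem_map]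
    rintro _ ⟨x, hx, rfl⟩ i hi
    by_cases hin : i = n
    · subst hin; simp [Tk, ek]
    · simp [ek, hin] at hi

theorem good_cons {p n : ℕ} {x : Vc p} {l : List (Vc p)} :
    Good n (x :: l) ↔ (vnz x ∧ (∀ i, n ≤ i → x i = none) ∧ (∀ y ∈ l, vle x y)) ∧ Good n l := by
  constructor
  · rintro ⟨a, b, c⟩
    rw [List.pairwise_cons] at c
    exact ⟨⟨a x (by simp), b x (by simp), c.1⟩, fun y hy => a y (by simp [hy]),
      fun y hy => b y (by simp [hy]), c.2⟩
  · rintro ⟨⟨a, b, c⟩, d⟩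
    refine ⟨?_, ?_, List.pairwise_cons.2 ⟨c, d.ch⟩⟩
    · intro y hy
      rcases List.mem_cons.1 hy with rfl | hy
      · exact a
      · exact d.nz y hy
    · intro y hy
      rcases List.mem_cons.1 hy with rfl | hy
      · exact b
      · exact d.sup y hy

theorem Hl_congr {p n : ℕ} (l : List (Vc p)) (hl : Good n l) (f g : List (Vc p) → ZMod p)
    (h : ∀ m, Good (n+1) m → m.length = l.length + 1 →
      (∀ y ∈ m, ∃ x ∈ l, vle x y) → f m = g m) :
    Hl (Tk n) f l = Hl (Tk n) g l := by
  induction l generalizing f g with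
  | nil => simp [Hl]
  | cons x l ih =>
    have hl' := hl
    rw [good_cons] at hl'
    obtain ⟨⟨h1, h2, h3⟩, h4⟩ := hl'
    simp only [Hl]
    have hxm : ∀ i, n + 1 ≤ i → x i = none := fun i hi => h2 i (by omega)
    congr 1
    · apply h
      · rw [good_cons]
        refine ⟨⟨h1, hxm, ?_⟩, by simpa using good_T hl⟩
        intro y hy
        have hy' : y ∈ (x :: l).map (Tk n) := by simpa using hy
        obtain ⟨z, hz, rfl⟩ := List.mem_map.1 hy'
        rcases List.mem_cons.1 hz with rfl | hz
        · exact vle_T h2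
        · exact vle_trans (h3 z hz) (vle_T (h4.sup z hz))
      · simp
      · intro y hy
        rcases List.mem_cons.1 hy with rfl | hy
        · exact ⟨y, by simp, fun _ _ => rfl⟩
        · have hy' : y ∈ (x :: l).map (Tk n) := by simpa using hy
          obtain ⟨z, hz, rfl⟩ := List.mem_map.1 hy'
          exact ⟨z, hz, vle_T (hl.sup z hz)⟩
    · apply ih h4
      intro m hm hlen hy
      apply h
      · rw [good_cons]
        refine ⟨⟨h1, hxm, ?_⟩, hm⟩
        intro y hym
        obtain ⟨z, hz, hzy⟩ := hy y hym
        exact vle_trans (h3 z hz) hzy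
      · simp [hlen]
      · intro y hym
        rcases List.mem_cons.1 hym with rfl | hym
        · exact ⟨y, by simp, fun _ _ => rfl⟩
        · obtain ⟨z, hz, hzy⟩ := hy y hym
          exact ⟨z, by simp [hz], hzy⟩

theorem Ev_congr {p : ℕ} [NeZero p] (n : ℕ) (f g : List (Vc p) → ZMod p)
    (h : ∀ m, Good n m → m.length = n → f m = g m) : Ev n f = Ev n g := by
  induction n generalizing f g with
  | zero => exact h [] ⟨by simp, by simp, by simp⟩ rfl
  | succ n ih =>
    simp only [Ev]
    apply ih
    have key : ∀ l, Good n l → l.length = n → Kl (Tk n) (ek n) f l = Kl (Tk n) (ek n) g l := by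
      intro l hl hn
      unfold Kl
      congr 1
      · exact h _ (good_eT hl) (by simp [hn])
      · exact Hl_congr l hl f g (fun m hm hlen _ => h m hm (by omega))
    intro m hm hlen
    unfold opA
    split_ifs
    · exact key m hm hlen
    · have k1 := key m hm hlen
      have k2 := key _ (good_rot n m 1 hm) (by simp [hlen])
      beta_reduce
      rw [k1, k2]
    · exact Finset.sum_congr rfl (fun t _ => key _ (good_rot n m t hm) (by simp [hlen]))

theorem Kl_sub {P R : Type*} [CommRing R] (T : P → P) (e : P) (f g : List P → R) :
    Kl T e (fun m => f m - g m) = fun l => Kl T e f l - Kl T e g l := by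
  funext l; simp only [Kl, Hl_sub]; ring

theorem opA_sub {p : ℕ} [NeZero p] (n : ℕ) (f g : List (Vc p) → ZMod p) :
    opA n (fun m => f m - g m) = fun l => opA n f l - opA n g l := by
  funext l; unfold opA; split_ifs
  · rfl
  · ring
  · simp

theorem Ev_sub {p : ℕ} [NeZero p] (n : ℕ) (f g : List (Vc p) → ZMod p) :
    Ev n (fun m => f m - g m) = Ev n f - Ev n g := by
  induction n generalizing f g with
  | zero => rfl
  | succ n ih => simp only [Ev, Kl_sub, opA_sub, ih]

theorem Ev_zero {p : ℕ} [NeZero p] (n : ℕ) : Ev n (fun _ : List (Vc p) => 0) = 0 := by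
  have := Ev_sub n (fun _ : List (Vc p) => 0) (fun _ => 0)
  simpa using this

theorem opA_dl {p : ℕ} [NeZero p] (n : ℕ) (f : List (Vc p) → ZMod p) :
    opA n (dl f) = dl (opA n f) := by
  funext l; unfold opA; split_ifs
  · rfl
  · rw [dl_sub, dl_map]
  · rw [dl_sum]; simp only [dl_map]

theorem rot_rot {ι : Type*} {p : ℕ} (t u : ZMod p) (x : ι → Option (ZMod p)) :
    rot t (rot u x) = rot (t + u) x := by
  funext i; simp only [rot, Option.map_map]; congr 1; funext g; simp; ring

theorem opA_opA {p : ℕ} [NeZero p] (n : ℕ) (f : List (Vc p) → ZMod p) (l : List (Vc p))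
    (hl : n = 0 → l = []) :
    opA n (opA (n+1) f) l = 0 := by
  have hr : ∀ (t u : ZMod p), (rot t ∘ rot u : Vc p → Vc p) = rot (t + u) := by
    intro t u; funext x; exact rot_rot t u x
  have e1 : ∑ t : ZMod p, f (l.map (rot (t + 1))) = ∑ t : ZMod p, f (l.map (rot t)) :=
    Fintype.sum_equiv (Equiv.addRight 1) _ _ (fun t => rfl)
  rcases Nat.eq_zero_or_pos n with rfl | hn
  · simp [opA, hl rfl]
  · have n0 : ¬ n = 0 := by omega
    have n1 : ¬ n + 1 = 0 := by omega
    by_cases h : n % 2 = 1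
    · have h' : ¬ (n + 1) % 2 = 1 := by omega
      simp only [opA, n0, n1, h, h', if_true, if_false]
      simp only [List.map_map, hr]
      rw [e1]; ring
    · have h' : (n + 1) % 2 = 1 := by omega
      simp only [opA, n0, n1, h, h', if_true, if_false]
      simp only [List.map_map, hr, Finset.sum_sub_distrib]
      rw [← e1]
      simp [add_comm]

theorem Ev_dl {p : ℕ} [NeZero p] (n : ℕ) (f : List (Vc p) → ZMod p) :
    Ev (n+1) (dl f) = Ev n (opA n f) := by
  induction n generalizing f with
  | zero => simp [Ev, opA, Kl, dl, Hl]
  | succ n ih =>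
    have : Ev (n+1+1) (dl f) = Ev (n+1) (opA (n+1) (Kl (Tk (n+1)) (ek (n+1)) (dl f))) := rfl
    rw [this]
    have h1 : Kl (Tk (n+1)) (ek (n+1)) (dl f) =
      fun l => f l - dl (Kl (Tk (n+1)) (ek (n+1)) f) l := by
        funext l; exact K_homotopy _ _ _ _
    rw [h1, opA_sub, Ev_sub]
    have h2 : (fun l => opA (n+1) (fun l => dl (Kl (Tk (n+1)) (ek (n+1)) f) l) l) =
      dl (opA (n+1) (Kl (Tk (n+1)) (ek (n+1)) f)) := opA_dl _ _
    have h3 : Ev (n+1) (fun l => opA (n+1) f l) = Ev (n+1) (opA (n+1) f) := rfl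
    have h4 : Ev (n+1) (opA (n+1) (fun l => dl (Kl (Tk (n+1)) (ek (n+1)) f) l)) = 
      Ev (n+1) (dl (opA (n+1) (Kl (Tk (n+1)) (ek (n+1)) f))) := by rw [← h2]
    rw [h4, ih]
    rw [Ev_congr n _ (fun _ => 0), Ev_zero, sub_zero]
    intro m hm hlen
    apply opA_opA
    rintro rfl
    exact List.length_eq_zero_iff.1 hlen

/-! cocycles -/
def gam {p : ℕ} (g h : ZMod p) : ℤ := if h.val < g.val then 1 else 0

theorem gam_eq {p : ℕ} [NeZero p] (g h : ZMod p) :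
    (p : ℤ) * gam g h = g.val + (h - g).val - h.val := by
  unfold gam
  have h0 : h = g + (h - g) := by ring
  have hv := ZMod.val_add g (h - g)
  rw [← h0] at hv
  have a := ZMod.val_lt g
  have b := ZMod.val_lt (h - g)
  by_cases hc : g.val + (h - g).val < p
  · rw [Nat.mod_eq_of_lt hc] at hv
    rw [if_neg (by omega)]; push_cast [hv]; ring
  · have : (g.val + (h - g).val) % p = g.val + (h - g).val - p := by
      rw [Nat.mod_eq_sub_mod (by omega), Nat.mod_eq_of_lt (by omega)]
    rw [this] at hv
    rw [if_pos (by omega)]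
    omega

def bet {p : ℕ} (g h k : ZMod p) : ℤ := gam h k - gam g k + gam g h

theorem bet_rot {p : ℕ} [NeZero p] (g h k t : ZMod p) :
    bet (g + t) (h + t) (k + t) = bet g h k := by
  have hp : (p : ℤ) ≠ 0 := by exact_mod_cast NeZero.ne p
  apply mul_left_cancel₀ hp
  simp only [bet, mul_add, mul_sub, gam_eq, add_sub_add_right_eq_sub]
  ring

theorem sum_gam {p : ℕ} [NeZero p] (g h : ZMod p) :
    ∑ t : ZMod p, gam (g + t) (h + t) = (h - g).val := by
  have hp : (p : ℤ) ≠ 0 := by exact_mod_cast NeZero.ne p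
  apply mul_left_cancel₀ hp
  rw [Finset.mul_sum]
  simp only [gam_eq, add_sub_add_right_eq_sub]
  rw [Finset.sum_sub_distrib, Finset.sum_add_distrib]
  have h1 : ∀ g : ZMod p, ∑ t : ZMod p, ((g + t).val : ℤ) = ∑ t : ZMod p, (t.val : ℤ) := fun g =>
    Fintype.sum_equiv (Equiv.addLeft g) _ _ (fun t => rfl)
  rw [h1, h1]
  simp [ZMod.card]

def Ps {p : ℕ} : List (ZMod p) → ZMod p
  | [] => 0
  | [_] => 1
  | [_, _] => 0
  | g :: h :: k :: l => (bet g h k : ZMod p) * Ps (k :: l)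

def Ph {p : ℕ} : List (ZMod p) → ZMod p
  | [] => 0
  | [_] => 0
  | g :: h :: l => (h - g) * Ps (h :: l)

def b0 {p : ℕ} : List (ZMod p) → ZMod p
  | [] => 0
  | g :: l => g * Ps (g :: l)

def b1 {p : ℕ} : List (ZMod p) → ZMod p
  | [] => 0
  | [_] => 0
  | g :: h :: l => (gam g h : ZMod p) * Ps (h :: l)

theorem dl_Ps {p : ℕ} (l : List (ZMod p)) : dl Ps l = 0 := by
  match l with
  | [] => rfl
  | [g] => simp [dl, Ps]
  | [g, h] => simp [dl, Ps]
  | [g, h, k] => simp [dl, Ps]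
  | g :: h :: k :: j :: l =>
    have ih := dl_Ps (k :: j :: l)
    simp only [dl, Ps, dl_mul] at ih ⊢
    simp only [bet]
    push_cast
    linear_combination ((gam h k : ZMod p) - gam g k + gam g h) * ih
  termination_by l.length

theorem dl_b0 {p : ℕ} (l : List (ZMod p)) : dl b0 l = Ph l := by
  match l with
  | [] => rfl
  | [g] => simp [dl, b0, Ph]
  | g :: h :: l =>
    have := dl_Ps (g :: h :: l)
    simp only [dl, b0, Ph, dl_mul] at this ⊢
    linear_combination g * this

theorem dl_b1 {p : ℕ} (l : List (ZMod p)) (hl : l.length ≠ 1) : dl b1 l = Ps l := by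
  match l with
  | [] => rfl
  | [g] => simp at hl
  | [g, h] => simp [dl, b1, Ps]
  | g :: h :: k :: l =>
    have := dl_Ps (h :: k :: l)
    simp only [dl, b1, Ps, dl_mul, bet] at this ⊢
    push_cast
    linear_combination -(gam g h : ZMod p) * this

theorem Ps_rot {p : ℕ} [NeZero p] (t : ZMod p) (l : List (ZMod p)) :
    Ps (l.map (· + t)) = Ps l := by
  match l with
  | [] => rfl
  | [g] => simp [Ps]
  | [g, h] => simp [Ps]
  | g :: h :: k :: l =>
    have ih := Ps_rot t (k :: l)
    simp only [List.map_cons, Ps, bet_rot] at ih ⊢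
    rw [ih]
  termination_by l.length

theorem b0_rot {p : ℕ} [NeZero p] (l : List (ZMod p)) :
    b0 (l.map (· + 1)) - b0 l = Ps l := by
  match l with
  | [] => simp [b0, Ps]
  | g :: l =>
    have := Ps_rot 1 (g :: l)
    simp only [List.map_cons, b0] at this ⊢
    rw [this]; ring

theorem b1_rot {p : ℕ} [NeZero p] (l : List (ZMod p)) :
    ∑ t : ZMod p, b1 (l.map (· + t)) = Ph l := by
  match l with
  | [] => simp [b1, Ph]
  | [g] => simp [b1, Ph]
  | g :: h :: l =>
    have : ∀ t : ZMod p, b1 ((g :: h :: l).map (· + t)) = (gam (g+t) (h+t) : ZMod p) * Ps (h :: l) := by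
      intro t
      have := Ps_rot t (h :: l)
      simp only [List.map_cons, b1] at this ⊢
      rw [this]
    simp only [this, Ph]
    rw [← Finset.sum_mul, ← Int.cast_sum, sum_gam]
    simp

theorem gam_self {p : ℕ} (g : ZMod p) : gam g g = 0 := by simp [gam]

/-- adjacent repeat kills -/
theorem Ps_deg {p : ℕ} (l : List (ZMod p)) (h : ¬ l.IsChain (· ≠ ·)) : Ps l = 0 := by
  match l with
  | [] => rfl
  | [g] => simp at h
  | [g, h] => simp [Ps]
  | g :: h' :: k :: l =>
    simp only [Ps]
    by_cases h1 : g = h'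
    · subst h1; simp [bet, gam_self]
    by_cases h2 : h' = k
    · subst h2; simp [bet, gam_self]
    rw [Ps_deg (k :: l), mul_zero]
    intro h3
    apply h
    simp [h1, h2, h3]
  termination_by l.length

theorem Ph_deg {p : ℕ} (l : List (ZMod p)) (h : ¬ l.IsChain (· ≠ ·)) : Ph l = 0 := by
  match l with
  | [] => rfl
  | [g] => simp at h
  | g :: h' :: l =>
    simp only [Ph]
    by_cases h1 : g = h'
    · subst h1; simp
    rw [Ps_deg (h' :: l), mul_zero]
    intro h3
    apply h
    simp [h1, h3]

theorem map_rot {p : ℕ} (s : Vc p → ZMod p) (n : ℕ)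
    (hs : ∀ x : Vc p, vnz x → (∀ i, n ≤ i → x i = none) → ∀ t, s (rot t x) = s x + t)
    (l : List (Vc p)) (hl : Good n l) (t : ZMod p) :
    (l.map (rot t)).map s = (l.map s).map (· + t) := by
  rw [List.map_map, List.map_map]
  apply List.map_congr_left
  intro x hx
  exact hs x (hl.nz x hx) (hl.sup x hx) t

theorem Ev_main {p : ℕ} [NeZero p] (s : Vc p → ZMod p) (n N : ℕ) (hn : n + 1 ≤ N)
    (hs : ∀ x : Vc p, vnz x → (∀ i, N ≤ i → x i = none) → ∀ t, s (rot t x) = s x + t) :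
    Ev (n+1) (fun l => if n % 2 = 0 then Ps (l.map s) else Ph (l.map s)) = 1 := by
  induction n with
  | zero => simp [Ev, opA, Kl, Hl, Ps]
  | succ n ih =>
    have ih := ih (by omega)
    rw [← ih]
    have hs' : ∀ x : Vc p, vnz x → (∀ i, n + 1 ≤ i → x i = none) → ∀ t, s (rot t x) = s x + t :=
      fun x hx h t => hs x hx (fun i hi => h i (by omega)) t
    rcases Nat.mod_two_eq_zero_or_one n with h | h
    · have h' : ¬ (n + 1) % 2 = 0 := by omega
      simp only [h, h', if_true, if_false]
      have : (fun l : List (Vc p) => Ph (l.map s)) = dl (fun l => b0 (l.map s)) := by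
        funext l; rw [dl_map, dl_b0]
      rw [this, Ev_dl]
      apply Ev_congr
      intro m hm _
      unfold opA
      rw [if_neg (by omega), if_pos (by omega)]
      beta_reduce
      rw [map_rot s _ hs' m hm, b0_rot]
    · have h' : (n + 1) % 2 = 0 := by omega
      have h'' : ¬ n % 2 = 0 := by omega
      simp only [h', h'', if_true, if_false]
      have : Ev (n+1+1) (fun l : List (Vc p) => Ps (l.map s)) =
          Ev (n+1+1) (dl (fun l => b1 (l.map s))) := by
        apply Ev_congr
        intro m hm hl
        rw [dl_map, dl_b1]
        simp [hl]
      rw [this, Ev_dl]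
      apply Ev_congr
      intro m hm _
      unfold opA
      rw [if_neg (by omega), if_neg (by omega)]
      simp only [map_rot s _ hs' m hm, b1_rot]

theorem chain_bound {P : Type*} (v : P → ℕ) (m : ℕ) (l : List P) (a : ℕ)
    (hb : ∀ x ∈ l, a < v x ∧ v x ≤ m) (hc : l.IsChain (fun x y => v x < v y)) :
    l = [] ∨ l.length + a ≤ m := by
  induction l generalizing a with
  | nil => simp
  | cons x l ih =>
    right
    rw [List.isChain_iff_pairwise (R := fun x y => v x < v y)] at hc
    rw [List.pairwise_cons] at hc
    have := ih (v x) (fun y hy => ⟨hc.1 y hy, (hb y (by simp [hy])).2⟩)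
      (List.isChain_iff_pairwise.2 hc.2)
    have h1 := hb x (by simp)
    rcases this with rfl | h
    · simp; omega
    · simp; omega

theorem tucker {p : ℕ} [NeZero p] (hp : 1 < p) (n m : ℕ)
    (s : (Fin n → Option (ZMod p)) → ZMod p) (v : (Fin n → Option (ZMod p)) → ℕ)
    (hs : ∀ x, vnz x → ∀ t, s (rot t x) = s x + t)
    (hv : ∀ x y, vnz x → vle x y → v x ≤ v y)
    (hsv : ∀ x y, vnz x → vle x y → v x = v y → s x = s y)
    (hb : ∀ x, vnz x → 0 < v x ∧ v x ≤ m) : n ≤ m := by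
  by_contra hlt
  obtain ⟨k, rfl⟩ : ∃ k, n = k + 1 := ⟨n - 1, by omega⟩
  let ρ : Vc p → (Fin (k+1) → Option (ZMod p)) := fun x i => x i
  have hρnz : ∀ x : Vc p, vnz x → (∀ i, k + 1 ≤ i → x i = none) → vnz (ρ x) := by
    rintro x ⟨i, hi⟩ h
    have : i < k + 1 := by by_contra h'; exact hi (h i (by omega))
    exact ⟨⟨i, this⟩, hi⟩
  have hρle : ∀ x y : Vc p, vle x y → vle (ρ x) (ρ y) := fun x y h i hi => h i hi
  have key := Ev_main (p := p) (fun x => s (ρ x)) k (k+1) le_rfl (by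
    intro x hx h t
    exact hs (ρ x) (hρnz x hx h) t)
  rw [Ev_congr (k+1) _ (fun _ => 0), Ev_zero] at key
  · have : Fact (1 < p) := ⟨hp⟩
    exact zero_ne_one key
  · intro l hl hlen
    have hdeg : ¬ (l.map (fun x => s (ρ x))).IsChain (· ≠ ·) := by
      intro hch
      rw [List.isChain_map] at hch
      have hch2 : l.IsChain (fun x y => v (ρ x) < v (ρ y)) := by
        have hpw : l.IsChain vle := hl.ch.isChain
        rw [List.isChain_iff_getElem] at hpw hch ⊢
        intro i hi
        have a1 := hpw i hi
        have a2 := hch i hi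
        have nz := hρnz _ (hl.nz l[i] (List.getElem_mem _)) (hl.sup l[i] (List.getElem_mem _))
        exact lt_of_le_of_ne (hv _ _ nz (hρle _ _ a1)) (fun h => a2 (hsv _ _ nz (hρle _ _ a1) h))
      have := chain_bound (fun x => v (ρ x)) m l 0 (fun x hx => hb _ (hρnz _ (hl.nz x hx) (hl.sup x hx))) hch2
      rcases this with rfl | h
      · simp at hlen
      · omega
    simp only [Ps_deg _ hdeg, Ph_deg _ hdeg, ite_self]

end ZpT

namespace ZpT

/-! equivariant selection -/
def shift {α : Type*} {p : ℕ} (t : ZMod p) (f : ZMod p → α) : ZMod p → α := fun ε => f (ε - t)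

theorem shift_shift {α : Type*} {p : ℕ} (t u : ZMod p) (f : ZMod p → α) :
    shift t (shift u f) = shift (t + u) f := by
  funext ε; simp only [shift]; congr 1; ring

def shiftSetoid (α : Type*) (p : ℕ) : Setoid (ZMod p → α) where
  r f g := ∃ t, f = shift t g
  iseqv := by
    refine ⟨fun f => ⟨0, by funext ε; simp [shift]⟩, ?_, ?_⟩
    · rintro f g ⟨t, rfl⟩
      exact ⟨-t, by rw [shift_shift]; funext ε; simp [shift]⟩
    · rintro f g h ⟨t, rfl⟩ ⟨u, rfl⟩
      exact ⟨t + u, by rw [shift_shift]⟩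

theorem shift_const {α : Type*} {p : ℕ} (hp : p.Prime) (f : ZMod p → α) (t u : ZMod p)
    (h : shift t f = shift u f) (htu : t ≠ u) : ∀ a b, f a = f b := by
  have : Fact p.Prime := ⟨hp⟩
  set d := u - t with hd
  have hd0 : d ≠ 0 := sub_ne_zero.2 htu.symm
  have h1 : ∀ a, f (a + d) = f a := by
    intro a
    have := congrFun h (a + u)
    simp only [shift] at this
    rw [show a + d = a + u - t by rw [hd]; ring, this]; congr 1; ring
  have h2 : ∀ (k : ℕ) a, f (a + k * d) = f a := by
    intro k
    induction k with
    | zero => intro a; simp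
    | succ k ih =>
      intro a
      rw [show a + ((k + 1 : ℕ) : ZMod p) * d = (a + k * d) + d by push_cast; ring, h1, ih]
  intro a b
  have := h2 ((b - a) / d).val a
  rw [ZMod.natCast_zmod_val, div_mul_cancel₀ _ hd0] at this
  rw [← this]; congr 1; ring

theorem exists_sel (α : Type*) {p : ℕ} (hp : p.Prime) :
    ∃ S : (ZMod p → α) → ZMod p, ∀ f, (¬ ∀ a b, f a = f b) → ∀ t, S (shift t f) = S f + t := by
  let st := shiftSetoid α p
  have hx : ∀ f : ZMod p → α, ∃ t, f = shift t (Quotient.out (Quotient.mk st f)) := by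
    intro f
    exact st.symm (Quotient.mk_out f)
  choose S hS using hx
  refine ⟨S, fun f hf t => ?_⟩
  have e : Quotient.mk st (shift t f) = Quotient.mk st f := Quotient.sound ⟨t, rfl⟩
  have h1 := hS (shift t f)
  rw [e] at h1
  have h2 := hS f
  set r := Quotient.out (Quotient.mk st f)
  by_contra hne
  have h3 : shift (S (shift t f)) r = shift (S f + t) r := by
    rw [← h1, add_comm, ← shift_shift, ← h2]
  have := shift_const hp r _ _ h3 hne
  apply hf
  rw [h2]
  intro a b
  exact this _ _

/-! level function -/
section
variable {p C : ℕ} [NeZero p]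

def hh (τ : ZMod p → Finset (Fin C)) : ℕ := Finset.univ.inf' Finset.univ_nonempty (fun ε => (τ ε).card)

def ll (τ : ZMod p → Finset (Fin C)) : ℕ := ∑ ε, min (τ ε).card (hh τ + 1)

theorem hh_le (τ : ZMod p → Finset (Fin C)) (ε) : hh τ ≤ (τ ε).card :=
  Finset.inf'_le _ (Finset.mem_univ ε)

theorem hh_att (τ : ZMod p → Finset (Fin C)) : ∃ ε, hh τ = (τ ε).card := by
  obtain ⟨ε, _, h⟩ := Finset.exists_mem_eq_inf' Finset.univ_nonempty (fun ε : ZMod p => (τ ε).card)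
  exact ⟨ε, h⟩

theorem hh_mono (τ τ' : ZMod p → Finset (Fin C)) (h : ∀ ε, τ ε ⊆ τ' ε) : hh τ ≤ hh τ' := by
  obtain ⟨ε, e⟩ := hh_att τ'
  rw [e]
  exact (hh_le τ ε).trans (Finset.card_le_card (h ε))

theorem ll_mono (τ τ' : ZMod p → Finset (Fin C)) (h : ∀ ε, τ ε ⊆ τ' ε) : ll τ ≤ ll τ' := by
  apply Finset.sum_le_sum
  intro ε _
  have := hh_mono τ τ' h
  have := Finset.card_le_card (h ε)
  omega

theorem ll_eq (τ : ZMod p → Finset (Fin C)) :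
    ll τ = p * hh τ + (Finset.univ.filter (fun ε => hh τ < (τ ε).card)).card := by
  have : ∀ ε, min (τ ε).card (hh τ + 1) = hh τ + if hh τ < (τ ε).card then 1 else 0 := by
    intro ε
    have := hh_le τ ε
    split_ifs <;> omega
  unfold ll
  rw [Finset.sum_congr rfl (fun ε _ => this ε), Finset.sum_add_distrib, Finset.card_filter]
  simp [ZMod.card]

theorem B_lt (τ : ZMod p → Finset (Fin C)) :
    (Finset.univ.filter (fun ε => hh τ < (τ ε).card)).card < p := by
  obtain ⟨ε, e⟩ := hh_att τ
  have : (Finset.univ.filter (fun ε => hh τ < (τ ε).card)) ⊂ Finset.univ := by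
    rw [Finset.filter_ssubset]
    exact ⟨ε, Finset.mem_univ _, by omega⟩
  have := Finset.card_lt_card this
  simpa [ZMod.card] using this

theorem hh_eq_of_ll (τ τ' : ZMod p → Finset (Fin C)) (h : ll τ = ll τ') : hh τ = hh τ' := by
  have hp : 0 < p := Nat.pos_of_ne_zero (NeZero.ne p)
  have a : ∀ τ : ZMod p → Finset (Fin C), ll τ / p = hh τ := by
    intro τ
    rw [ll_eq, Nat.mul_add_div hp, Nat.div_eq_of_lt (B_lt τ), add_zero]
  rw [← a, ← a, h]

theorem hh_shift (τ : ZMod p → Finset (Fin C)) (t : ZMod p) : hh (shift t τ) = hh τ := by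
  apply le_antisymm
  · obtain ⟨ε, e⟩ := hh_att τ
    rw [e]
    have := hh_le (shift t τ) (ε + t)
    simpa [shift] using this
  · obtain ⟨ε, e⟩ := hh_att (shift t τ)
    rw [e]
    exact hh_le τ _

theorem ll_pos (τ : ZMod p → Finset (Fin C)) (h : ∃ ε, (τ ε).Nonempty) : 0 < ll τ := by
  obtain ⟨ε, e⟩ := h
  have := Finset.card_pos.2 e
  refine lt_of_lt_of_le ?_ (Finset.single_le_sum (f := fun ε => min (τ ε).card (hh τ + 1)) (fun _ _ => Nat.zero_le _) (Finset.mem_univ ε))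
  omega

theorem exists_sgn (hp : p.Prime) :
    ∃ S : (ZMod p → Finset (Fin C)) → ZMod p,
      (∀ τ, (¬ ∀ a b, τ a = τ b) → ∀ t, S (shift t τ) = S τ + t) ∧
      (∀ τ τ', (∀ ε, τ ε ⊆ τ' ε) → ll τ = ll τ' → S τ = S τ') := by
  classical
  obtain ⟨S1, h1⟩ := exists_sel Prop hp
  obtain ⟨S2, h2⟩ := exists_sel (Finset (Fin C)) hp
  refine ⟨fun τ => if (∃ ε, hh τ < (τ ε).card) then S1 (fun ε => hh τ < (τ ε).card) else S2 τ, ?_, ?_⟩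
  · intro τ hτ t
    have e1 : (∃ ε, hh (shift t τ) < ((shift t τ) ε).card) ↔ (∃ ε, hh τ < (τ ε).card) := by
      rw [hh_shift]
      constructor
      · rintro ⟨ε, h⟩; exact ⟨_, h⟩
      · rintro ⟨ε, h⟩; exact ⟨ε + t, by simpa [shift] using h⟩
    by_cases hB : ∃ ε, hh τ < (τ ε).card
    · simp only [e1.2 hB, hB, if_true]
      rw [← h1]
      · rw [hh_shift]; rfl
      · intro hc
        obtain ⟨ε, e⟩ := hh_att τ
        obtain ⟨ε', e'⟩ := hB
        have := hc ε' ε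
        have := this.mp e'
        omega
    · simp only [mt e1.1 hB, hB, if_false]
      exact h2 τ hτ t
  · intro τ τ' hsub hl
    have hh1 := hh_eq_of_ll τ τ' hl
    have hterm : ∀ ε ∈ Finset.univ, min (τ ε).card (hh τ + 1) = min (τ' ε).card (hh τ' + 1) := by
      rw [← Finset.sum_eq_sum_iff_of_le]
      · exact hl
      · intro ε _
        have := Finset.card_le_card (hsub ε)
        omega
    have hB : (fun ε => hh τ < (τ ε).card) = (fun ε => hh τ' < (τ' ε).card) := by
      funext ε
      have := hterm ε (Finset.mem_univ _)
      apply propext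
      omega
    have hB' : (∃ ε, hh τ < (τ ε).card) ↔ (∃ ε, hh τ' < (τ' ε).card) := by
      constructor
      · rintro ⟨ε, h⟩; exact ⟨ε, (congrFun hB ε).mp h⟩
      · rintro ⟨ε, h⟩; exact ⟨ε, (congrFun hB ε).mpr h⟩
    by_cases h : ∃ ε, hh τ < (τ ε).card
    · simp only [h, hB'.1 h, if_true]
      exact congrArg S1 hB
    · simp only [h, mt hB'.2 h, if_false]
      congr 1
      funext ε
      apply Finset.eq_of_subset_of_card_le (hsub ε)
      have a := hh_le τ ε
      push Not at h
      have := hterm ε (Finset.mem_univ _)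
      have := h ε
      omega

/-- balanced sizes -/
theorem exists_sub (τ : ZMod p → Finset (Fin C)) (k : ℕ) (hk : k ≤ ll τ) :
    ∃ W : ZMod p → Finset (Fin C), (∀ ε, W ε ⊆ τ ε) ∧ (∑ ε, (W ε).card = k) ∧
      ∀ i j, (W i).card ≤ (W j).card + 1 := by
  classical
  have hp : 0 < p := Nat.pos_of_ne_zero (NeZero.ne p)
  have hB := B_lt τ
  rw [ll_eq] at hk
  set B := Finset.univ.filter (fun ε => hh τ < (τ ε).card) with hBdef
  have hdm := Nat.div_add_mod k p
  have hml := Nat.mod_lt k hp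
  set a := k / p
  set b := k % p
  have ha : a ≤ hh τ := by
    by_contra h
    have : p * (hh τ + 1) ≤ p * a := Nat.mul_le_mul_left p (by omega)
    rw [mul_add] at this
    omega
  have hB0 : ∃ B0 : Finset (ZMod p), B0.card = b ∧ ∀ ε ∈ B0, a + 1 ≤ (τ ε).card := by
    rcases ha.lt_or_eq with h | h
    · obtain ⟨B0, _, h0⟩ := Finset.exists_subset_card_eq (s := (Finset.univ : Finset (ZMod p))) (n := b)
        (by simp [ZMod.card]; omega)
      exact ⟨B0, h0, fun ε _ => by have := hh_le τ ε; omega⟩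
    · have : b ≤ B.card := by rw [← h] at hk; omega
      obtain ⟨B0, hs, h0⟩ := Finset.exists_subset_card_eq this
      refine ⟨B0, h0, fun ε hε => ?_⟩
      have := hs hε
      simp [hBdef] at this
      omega
  obtain ⟨B0, hb, hB0⟩ := hB0
  have : ∀ ε, ∃ W ⊆ τ ε, W.card = a + if ε ∈ B0 then 1 else 0 := by
    intro ε
    apply Finset.exists_subset_card_eq
    split_ifs with h
    · exact hB0 ε h
    · have := hh_le τ ε; omega
  choose W hW1 hW2 using this
  refine ⟨W, hW1, ?_, ?_⟩
  · simp only [hW2, Finset.sum_add_distrib]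
    simp [ZMod.card, hb, hdm]
  · intro i j
    rw [hW2, hW2]
    split_ifs <;> omega

end

/-! alt -/
section
variable {n p : ℕ}

theorem has_le {X : Fin n → Option (ZMod p)} {m : ℕ} (h : HasAltSeq X m) : m ≤ n := by
  obtain ⟨s, hs, _⟩ := h
  simpa using Fintype.card_le_of_injective s hs.injective

theorem has_zero (X : Fin n → Option (ZMod p)) : HasAltSeq X 0 :=
  ⟨fun i => i.elim0, fun i => i.elim0, fun i => i.elim0, fun j h => by omega⟩

theorem bdd (X : Fin n → Option (ZMod p)) : BddAbove {m | HasAltSeq X m} :=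
  ⟨n, fun _ h => has_le h⟩

theorem has_alt (X : Fin n → Option (ZMod p)) : HasAltSeq X (altVec X) :=
  Nat.sSup_mem ⟨0, has_zero X⟩ (bdd X)

theorem le_alt {X : Fin n → Option (ZMod p)} {m : ℕ} (h : HasAltSeq X m) : m ≤ altVec X :=
  le_csSup (bdd X) h

theorem alt_le (X : Fin n → Option (ZMod p)) : altVec X ≤ n := has_le (has_alt X)

theorem has_mono {X Y : Fin n → Option (ZMod p)} (hXY : vle X Y) {m : ℕ} (h : HasAltSeq X m) :
    HasAltSeq Y m := by
  obtain ⟨s, h1, h2, h3⟩ := h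
  refine ⟨s, h1, fun j => ?_, fun j hj => ?_⟩
  · rw [hXY _ (h2 j)]; exact h2 j
  · rw [hXY _ (h2 _), hXY _ (h2 _)]; exact h3 j hj

theorem alt_mono {X Y : Fin n → Option (ZMod p)} (hXY : vle X Y) : altVec X ≤ altVec Y :=
  le_alt (has_mono hXY (has_alt X))

theorem has_rot {X : Fin n → Option (ZMod p)} (t : ZMod p) {m : ℕ} (h : HasAltSeq X m) :
    HasAltSeq (rot t X) m := by
  obtain ⟨s, h1, h2, h3⟩ := h
  refine ⟨s, h1, fun j => ?_, fun j hj => ?_⟩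
  · simpa [rot] using h2 j
  · intro h
    exact h3 j hj (Option.map_injective (add_left_injective t) h)

theorem rot_zero {ι : Type*} (X : ι → Option (ZMod p)) : rot 0 X = X := by
  funext i; simp [rot]

theorem alt_rot (X : Fin n → Option (ZMod p)) (t : ZMod p) : altVec (rot t X) = altVec X := by
  apply le_antisymm
  · have := has_rot (-t) (has_alt (rot t X))
    rw [rot_rot, neg_add_cancel, rot_zero] at this
    exact le_alt this
  · exact le_alt (has_rot t (has_alt X))

theorem has_cons {X : Fin n → Option (ZMod p)} {m : ℕ} (s : Fin m → Fin n) (h1 : StrictMono s)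
    (h2 : ∀ j, X (s j) ≠ none)
    (h3 : ∀ (j : ℕ) (h : j + 1 < m), X (s ⟨j, by omega⟩) ≠ X (s ⟨j + 1, h⟩))
    (i : Fin n) (hi : X i ≠ none) (hi' : ∀ h : 0 < m, i < s ⟨0, h⟩ ∧ X i ≠ X (s ⟨0, h⟩)) :
    HasAltSeq X (m + 1) := by
  refine ⟨Fin.cons i s, ?_, ?_, ?_⟩
  · intro a b hab
    induction b using Fin.cases with
    | zero => exact absurd hab (by simp)
    | succ b =>
      induction a using Fin.cases with
      | zero =>
        simp only [Fin.cons_zero, Fin.cons_succ]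
        exact lt_of_lt_of_le (hi' (by have := b.2; omega)).1 (h1.monotone (by simp [Fin.le_def]))
      | succ a =>
        simp only [Fin.cons_succ]
        exact h1 (by simpa using hab)
  · intro j
    induction j using Fin.cases with
    | zero => simpa using hi
    | succ j => simpa using h2 j
  · intro j hj
    cases j with
    | zero => exact (hi' (by omega)).2
    | succ j => exact h3 j (by omega)

def IsFirst (X : Fin n → Option (ZMod p)) (g : ZMod p) : Prop :=
  ∃ i, X i = some g ∧ ∀ j < i, X j = none

theorem first_ex {X : Fin n → Option (ZMod p)} (h : vnz X) : ∃ g, IsFirst X g := by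
  obtain ⟨i, hi, hmin⟩ := WellFounded.has_min (wellFounded_lt (α := Fin n)) {i | X i ≠ none} h
  obtain ⟨g, hg⟩ := Option.ne_none_iff_exists'.1 hi
  refine ⟨g, i, hg, fun j hj => ?_⟩
  by_contra hne
  exact hmin j hne hj

theorem first_uniq {X : Fin n → Option (ZMod p)} {g h : ZMod p} (hg : IsFirst X g)
    (hh : IsFirst X h) : g = h := by
  obtain ⟨i, hi, hi'⟩ := hg
  obtain ⟨j, hj, hj'⟩ := hh
  rcases lt_trichotomy i j with h | h | h
  · rw [hj' i h] at hi; simp at hi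
  · subst h; rw [hi] at hj; simpa using hj
  · rw [hi' j h] at hj; simp at hj

theorem first_rot {X : Fin n → Option (ZMod p)} {g : ZMod p} (hg : IsFirst X g) (t : ZMod p) :
    IsFirst (rot t X) (g + t) := by
  obtain ⟨i, hi, hi'⟩ := hg
  exact ⟨i, by simp [rot, hi], fun j hj => by simp [rot, hi' j hj]⟩

theorem first_alt {X Y : Fin n → Option (ZMod p)} (hXY : vle X Y) {g h : ZMod p}
    (hg : IsFirst X g) (hh : IsFirst Y h) (he : altVec X = altVec Y) : g = h := by
  by_contra hne
  obtain ⟨i, hi, hi'⟩ := hg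
  obtain ⟨j, hj, hj'⟩ := hh
  have hYi : Y i = some g := by rw [hXY i (by simp [hi]), hi]
  have hji : j < i := by
    rcases lt_trichotomy i j with h | h | h
    · rw [hj' i h] at hYi; simp at hYi
    · subst h; rw [hYi] at hj; simp at hj; exact absurd hj hne
    · exact h
  obtain ⟨s, h1, h2, h3⟩ := has_alt X
  have hsi : ∀ k, i ≤ s k := by
    intro k
    by_contra hk
    exact h2 k (hi' _ (not_le.1 hk))
  by_cases hc : ∃ hm : 0 < altVec X, X (s ⟨0, hm⟩) = some h
  · obtain ⟨hm, hc⟩ := hc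
    have := has_cons s h1 h2 h3 i (by simp [hi]) (fun hm' => by
      have hne' : X i ≠ X (s ⟨0, hm'⟩) := by rw [hi, hc]; simpa using hne
      refine ⟨lt_of_le_of_ne (hsi _) (fun e => hne' (by rw [← e])), hne'⟩)
    have := le_alt this
    omega
  · push Not at hc
    have hYs : ∀ k, Y (s k) = X (s k) := fun k => hXY _ (h2 k)
    have := has_cons (X := Y) s h1 (fun k => by rw [hYs]; exact h2 k)
      (fun k hk => by rw [hYs, hYs]; exact h3 k hk) j (by simp [hj]) (fun hm' => by
        refine ⟨lt_of_lt_of_le hji (hsi _), ?_⟩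
        rw [hYs, hj]
        exact (hc hm').symm)
    have := le_alt this
    omega

theorem alt_pos {X : Fin n → Option (ZMod p)} (h : vnz X) : 0 < altVec X := by
  obtain ⟨i, hi⟩ := h
  have := has_cons (X := X) (m := 0) (fun i => i.elim0) (fun i => i.elim0) (fun i => i.elim0)
    (fun j h => by omega) i hi (fun h => by omega)
  exact le_alt this

end

end ZpT

/-- **Meunier's colorful theorem:** any proper coloring of `KG^p(F)` contains a
colorful balanced complete `p`-uniform `p`-partite subhypergraph with
`|V(F)| − alt_p(F)` vertices. -/
theorem meunier_colorful {V : Type*} [Fintype V] [DecidableEq V]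
    (p : ℕ) [NeZero p] (hp : p.Prime)
    (E : Set (Finset V)) (hne : ∀ e ∈ E, e.Nonempty)
    (C : ℕ) (c : {e : Finset V // e ∈ E} → Fin C)
    (hc : ∀ S ∈ KGEdges E p, ∃ e ∈ S, ∃ f ∈ S, c e ≠ c f) :
    ∃ U : ZMod p → Finset {e : Finset V // e ∈ E},
      (∀ i j, i ≠ j → Disjoint (U i) (U j)) ∧
      (∑ i, (U i).card) = Fintype.card V - altHyp E p ∧
      (∀ i j, (U i).card ≤ (U j).card + 1) ∧
      (∀ i j, i ≠ j → ∀ e ∈ U i, ∀ f ∈ U j, Disjoint e.1 f.1) ∧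
      (∀ i, Set.InjOn c ↑(U i)) := by
  classical
  obtain ⟨n, hn, σ, hσ⟩ : ∃ n, n = Fintype.card V ∧ ∃ σ : Fin n ≃ V,
      altHyp E p = altSigma E p σ :=
    ⟨_, rfl, Nat.sInf_mem (s := {a | ∃ σ : Fin (Fintype.card V) ≃ V, a = altSigma E p σ})
      ⟨_, (Fintype.equivFin V).symm, rfl⟩⟩
  rw [hσ, ← hn]
  set α := altSigma E p σ with hα
  -- the color sets
  let In : (Fin n → Option (ZMod p)) → ZMod p → {e : Finset V // e ∈ E} → Prop :=
    fun X ε e => (e.1 : Set V) ⊆ σ '' {i | X i = some ε}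
  let τ : (Fin n → Option (ZMod p)) → ZMod p → Finset (Fin C) :=
    fun X ε => Finset.univ.filter (fun q => ∃ e, c e = q ∧ In X ε e)
  have hτ : ∀ X ε q, q ∈ τ X ε ↔ ∃ e, c e = q ∧ In X ε e := by
    intro X ε q; simp [τ]
  have hInDisj : ∀ X i j, i ≠ j → ∀ e f, In X i e → In X j f → Disjoint e.1 f.1 := by
    intro X i j hij e f he hf
    rw [Finset.disjoint_left]
    intro x hx hx'
    obtain ⟨a, ha, rfl⟩ := he hx
    obtain ⟨b, hb, hab⟩ := hf hx'
    have := σ.injective hab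
    subst this
    simp only [Set.mem_ofPred_eq] at ha hb
    rw [ha] at hb
    exact hij (by simpa using hb)
  have hτle : ∀ X Y, ZpT.vle X Y → ∀ ε, τ X ε ⊆ τ Y ε := by
    intro X Y h ε q hq
    rw [hτ] at hq ⊢
    obtain ⟨e, he, hi⟩ := hq
    refine ⟨e, he, hi.trans (Set.image_mono ?_)⟩
    intro i hi
    simp only [Set.mem_ofPred_eq] at hi ⊢
    rw [h i (by simp [hi]), hi]
  have hτrot : ∀ X t, τ (ZpT.rot t X) = ZpT.shift t (τ X) := by
    intro X t
    funext ε
    ext q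
    simp only [ZpT.shift, hτ, In]
    have : {i | ZpT.rot t X i = some ε} = {i | X i = some (ε - t)} := by
      ext i
      simp only [ZpT.rot, Set.mem_ofPred_eq]
      rcases X i with _ | g
      · simp
      · simp [eq_sub_iff_add_eq]
    rw [this]
  have hτproper : ∀ X q, ¬ ∀ ε, q ∈ τ X ε := by
    intro X q hq
    have : ∀ ε, ∃ e, c e = q ∧ In X ε e := fun ε => (hτ X ε q).1 (hq ε)
    choose e he1 he2 using this
    have hinj : Function.Injective e := by
      intro i j hij
      by_contra hne'
      have := hInDisj X i j hne' _ _ (he2 i) (he2 j)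
      rw [hij, disjoint_self] at this
      obtain ⟨x, hx⟩ := hne _ (e j).2
      rw [this] at hx
      simp at hx
    obtain ⟨a, ha, b, hb, hab⟩ := hc (Finset.univ.image e) (by
      refine ⟨?_, ?_⟩
      · rw [Finset.card_image_of_injective _ hinj]; simp [ZMod.card]
      · intro a ha b hb hab
        simp only [Finset.mem_image, Finset.mem_univ, true_and] at ha hb
        obtain ⟨i, rfl⟩ := ha
        obtain ⟨j, rfl⟩ := hb
        exact hInDisj X i j (fun h => hab (by rw [h])) _ _ (he2 i) (he2 j))
    simp only [Finset.mem_image, Finset.mem_univ, true_and] at ha hb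
    obtain ⟨i, rfl⟩ := ha
    obtain ⟨j, rfl⟩ := hb
    exact hab (by rw [he1, he1])
  have hτne : ∀ X, α < altVec X → ∃ ε, (τ X ε).Nonempty := by
    intro X hX
    by_contra hcon
    push Not at hcon
    have : altVec X ≤ α := by
      apply le_csSup
      · refine ⟨n, ?_⟩
        rintro a ⟨Y, rfl, _⟩
        exact ZpT.alt_le Y
      · refine ⟨X, rfl, fun ε e he hsub => ?_⟩
        have : c ⟨e, he⟩ ∈ τ X ε := (hτ _ _ _).2 ⟨⟨e, he⟩, rfl, hsub⟩
        rw [hcon ε] at this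
        simp at this
    omega
  have hτnc : ∀ X, α < altVec X → ¬ ∀ a b, τ X a = τ X b := by
    intro X hX hcon
    obtain ⟨ε, q, hq⟩ := hτne X hX
    exact hτproper X q (fun ε' => by rw [hcon ε' ε]; exact hq)
  -- existence of a rich vector
  have main : n ≤ α ∨ ∃ X, n - α ≤ ZpT.ll (τ X) := by
    by_contra hcon
    push Not at hcon
    obtain ⟨hlt, hll⟩ := hcon
    obtain ⟨S, hS1, hS2⟩ := ZpT.exists_sgn (C := C) hp
    have hf : ∀ X : Fin n → Option (ZMod p), ∃ g, ZpT.vnz X → ZpT.IsFirst X g := by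
      intro X
      by_cases h : ZpT.vnz X
      · obtain ⟨g, hg⟩ := ZpT.first_ex h
        exact ⟨g, fun _ => hg⟩
      · exact ⟨0, fun h' => absurd h' h⟩
    choose F hF using hf
    have nzle : ∀ x y : Fin n → Option (ZMod p), ZpT.vnz x → ZpT.vle x y → ZpT.vnz y := by
      rintro x y ⟨i, hi⟩ h
      exact ⟨i, by rw [h i hi]; exact hi⟩
    have := ZpT.tucker hp.one_lt n (n - 1)
      (fun X => if altVec X ≤ α then F X else S (τ X))
      (fun X => if altVec X ≤ α then altVec X else α + ZpT.ll (τ X)) ?_ ?_ ?_ ?_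
    · omega
    · intro X hX t
      simp only [ZpT.alt_rot]
      split_ifs with h
      · exact ZpT.first_uniq (hF _ (ZpT.vnz_rot t X hX)) (ZpT.first_rot (hF X hX) t)
      · rw [hτrot]
        exact hS1 _ (hτnc X (by omega)) t
    · intro X Y hX hXY
      have h1 := ZpT.alt_mono hXY
      have h2 := ZpT.ll_mono _ _ (hτle X Y hXY)
      split_ifs <;> omega
    · intro X Y hX hXY
      have h1 := ZpT.alt_mono hXY
      split_ifs with h3 h4 h4
      · intro he
        exact ZpT.first_alt hXY (hF X hX) (hF Y (nzle X Y hX hXY)) he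
      · intro he
        have := ZpT.ll_pos _ (hτne Y (by omega))
        omega
      · omega
      · intro he
        exact hS2 _ _ (hτle X Y hXY) (by omega)
    · intro X hX
      have h1 := ZpT.alt_pos hX
      have h2 := hll X
      split_ifs with h
      · omega
      · have := ZpT.ll_pos _ (hτne X (by omega))
        omega
  rcases main with h | ⟨X, hX⟩
  · refine ⟨fun _ => ∅, ?_, ?_, ?_, ?_, ?_⟩
    · simp
    · simp; omega
    · simp
    · simp
    · simp
  · obtain ⟨W, hW1, hW2, hW3⟩ := ZpT.exists_sub (τ X) (n - α) hX
    have hr : ∀ (ε : ZMod p) (q : {q // q ∈ W ε}), ∃ e, c e = q.1 ∧ In X ε e := fun ε q =>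
      (hτ X ε q.1).1 (hW1 ε q.2)
    choose r hr1 hr2 using hr
    have hrinj : ∀ ε, Function.Injective (r ε) := by
      intro ε a b hab
      apply Subtype.ext
      rw [← hr1, ← hr1, hab]
    have hcard : ∀ ε, ((W ε).attach.image (r ε)).card = (W ε).card := by
      intro ε
      rw [Finset.card_image_of_injective _ (hrinj ε), Finset.card_attach]
    have hmem : ∀ ε e, e ∈ (W ε).attach.image (r ε) → In X ε e := by
      intro ε e he
      simp only [Finset.mem_image] at he
      obtain ⟨q, _, rfl⟩ := he
      exact hr2 ε q
    have hdis : ∀ i j, i ≠ j → ∀ e ∈ (W i).attach.image (r i), ∀ f ∈ (W j).attach.image (r j),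
        Disjoint e.1 f.1 := fun i j hij e he f hf =>
      hInDisj X i j hij e f (hmem i e he) (hmem j f hf)
    refine ⟨fun ε => (W ε).attach.image (r ε), ?_, ?_, ?_, hdis, ?_⟩
    · intro i j hij
      rw [Finset.disjoint_left]
      intro e he hf
      have := hdis i j hij e he e hf
      rw [disjoint_self] at this
      obtain ⟨x, hx⟩ := hne _ e.2
      rw [this] at hx
      simp at hx
    · simp only [hcard]; exact hW2
    · intro i j; simp only [hcard]; exact hW3 i j
    · intro ε a ha b hb hab
      simp only [Finset.coe_image, Set.mem_image] at ha hb
      obtain ⟨q, _, rfl⟩ := ha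
      obtain ⟨q', _, rfl⟩ := hb
      rw [hr1, hr1] at hab
      rw [Subtype.ext hab]
end
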